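/- arXiv:2409.06658 — 5 statements merged into one kernel-verified Lean document; each statement's English description precedes it below -/
import Mathlib

section
/- Let r ≥ 1 and n ≥ 0 be integers, let P ∈ ℂ[z₁,…,z_r] be a symmetric polynomial of degree at most n+1 in each variable, and let b₀,…,b_n be pairwise distinct complex numbers. Let x = (x₁,…,x_r), y = (y₁,…,y_r) ∈ ℂ^r with ∏_{m=1}^{r}(x_m − b_k) ≠ ∏_{m=1}^{r}(y_m − b_k) for all k, and x_m ≠ b_j, y_m ≠ b_j for all m, j. For each k, let b_k^{(1)},…,b_k^{(r−1)} ∈ ℂ be numbers (exists since ℂ is algebraically closed) such that, with Q_k(z) := ∏_{m=1}^{r}(z_m − b_k), the polynomial identity (Q_k(y) − Q_k(x))·(u − b_k)·∏_{m=1}^{r−1}(u − b_k^{(m)}) = Q_k(y)·∏_{j=1}^{r}(u − x_j) − Q_k(x)·∏_{j=1}^{r}(u − y_j) holds in the variable u, and assume b_k^{(m)} ≠ b_j for all j, m. Then P(x)/∏_{j=0}^{n}∏_{m=1}^{r}(x_m − b_j) − P(y)/∏_{j=0}^{n}∏_{m=1}^{r}(y_m − b_j) = ∑_{k=0}^{n}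 [ P(b_k, b_k^{(1)},…,b_k^{(r−1)}) / ( ∏_{j=0, j≠k}^{n}(b_k − b_j) · ∏_{j=0}^{n}∏_{m=1}^{r−1}(b_k^{(m)} − b_j) ) ] · ( ∑_{j=1}^{r} 1/(x_j − b_k) − ∑_{j=1}^{r} 1/(y_j − b_k) ). -/
open MvPolynomial Finset

/-- The vector `(c, v₁, …, v_{r-1}) ∈ ℂ^r` formed from a scalar and a vector
of length `r - 1`. -/
noncomputable def vecCons' {r : ℕ} (c : ℂ) (v : Fin (r - 1) → ℂ) : Fin r → ℂ :=
  fun i => if h : (i : ℕ) = 0 then c else v ⟨(i : ℕ) - 1, by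
    have := i.isLt; omega⟩

/-- Functions which are polynomial of degree at most `N` along the pencil spanned by `x`, `y`. -/
def PencilGood {r : ℕ} (N : ℕ) (x y : Fin r → ℂ) (f : (Fin r → ℂ) → ℂ) : Prop :=
  ∃ p : Polynomial ℂ, p.natDegree ≤ N ∧ ∀ (t : ℂ) (z : Fin r → ℂ),
    (∀ u : ℂ, ∏ j, (u - z j) = t * ∏ j, (u - x j) + (1 - t) * ∏ j, (u - y j)) →
      f z = p.eval t

theorem PencilGood.const_mul {r N : ℕ} {x y : Fin r → ℂ} {f : (Fin r → ℂ) → ℂ}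
    (h : PencilGood N x y f) (c : ℂ) : PencilGood N x y (fun z => c * f z) := by
  obtain ⟨p, hp, h⟩ := h
  refine ⟨Polynomial.C c * p, (Polynomial.natDegree_C_mul_le _ _).trans hp, fun t z hz => ?_⟩
  simp [h t z hz]

theorem PencilGood.sum {r N : ℕ} {x y : Fin r → ℂ} {ι : Type*} (s : Finset ι)
    {f : ι → (Fin r → ℂ) → ℂ}
    (h : ∀ i ∈ s, PencilGood N x y (f i)) : PencilGood N x y (fun z => ∑ i ∈ s, f i z) := by
  classical
  induction s using Finset.induction_on with
  | empty => exact ⟨0, by simp, fun t z hz => by simp⟩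
  | insert a s ha ih =>
    obtain ⟨p, hp, h1⟩ := ih (fun i hi => h i (Finset.mem_insert_of_mem hi))
    obtain ⟨q, hq, h2⟩ := h a (Finset.mem_insert_self _ _)
    refine ⟨q + p, Polynomial.natDegree_add_le_of_degree_le hq hp, fun t z hz => ?_⟩
    simp [Finset.sum_insert ha, h1 t z hz, h2 t z hz]

theorem prod_flip {r : ℕ} (z : Fin r → ℂ) (a : ℂ) :
    ∏ j, (z j - a) = (-1) ^ r * ∏ j, (a - z j) := by
  have : ∀ j, z j - a = (-1) * (a - z j) := fun j => by ring
  simp_rw [this, Finset.prod_mul_distrib]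
  simp

theorem pencilGood_multiset {r : ℕ} (x y : Fin r → ℂ) (s : Multiset ℂ) :
    PencilGood (Multiset.card s) x y (fun z => (s.map (fun a => ∏ j, (z j - a))).prod) := by
  induction s using Multiset.induction_on with
  | empty => exact ⟨1, by simp, fun t z hz => by simp⟩
  | cons a s ih =>
    obtain ⟨p, hp, h⟩ := ih
    refine ⟨(Polynomial.C ((-1) ^ r * (∏ j, (a - x j) - ∏ j, (a - y j))) * Polynomial.X
      + Polynomial.C ((-1) ^ r * ∏ j, (a - y j))) * p, ?_, fun t z hz => ?_⟩
    · refine Polynomial.natDegree_mul_le.trans ?_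
      rw [Multiset.card_cons, add_comm]
      exact add_le_add hp (Polynomial.natDegree_linear_le)
    · simp only [Multiset.map_cons, Multiset.prod_cons]
      have h' := h t z hz
      simp only at h'
      rw [h', prod_flip, hz a]
      simp only [Polynomial.eval_mul, Polynomial.eval_add, Polynomial.eval_C, Polynomial.eval_X]
      ring

theorem PencilGood.mono {r N M : ℕ} {x y : Fin r → ℂ} {f : (Fin r → ℂ) → ℂ}
    (h : PencilGood N x y f) (hNM : N ≤ M) : PencilGood M x y f := by
  obtain ⟨p, hp, h⟩ := h
  exact ⟨p, hp.trans hNM, h⟩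

theorem pencilGood_prod_eval {r N : ℕ} (x y : Fin r → ℂ) (f : Polynomial ℂ)
    (hf : f.natDegree ≤ N) : PencilGood N x y (fun z => ∏ j, f.eval (z j)) := by
  have key : ∀ z : Fin r → ℂ, ∏ j, f.eval (z j) =
      f.leadingCoeff ^ r * (f.roots.map (fun a => ∏ j, (z j - a))).prod := by
    intro z
    have hs := (IsAlgClosed.splits f).eq_prod_roots
    have : ∀ w : ℂ, f.eval w = f.leadingCoeff * (f.roots.map (fun a => w - a)).prod := by
      intro w
      conv_lhs => rw [hs]
      simp [Polynomial.eval_multiset_prod, Multiset.map_map]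
    simp_rw [this, Finset.prod_mul_distrib]
    congr 1
    · simp
    · induction f.roots using Multiset.induction_on with
      | empty => simp
      | cons a s ih => simp [Finset.prod_mul_distrib, ih]
  simp_rw [key]
  exact ((pencilGood_multiset x y f.roots).mono ((Polynomial.card_roots' f).trans hf)).const_mul _

/-- Ryser's formula for the permanent. -/
theorem ryser {r : ℕ} (M : Fin r → Fin r → ℂ) :
    ∑ σ : Equiv.Perm (Fin r), ∏ j, M (σ j) j =
      ∑ S : Finset (Fin r), (-1) ^ (Sᶜ).card * ∏ j, ∑ i ∈ S, M i j := by
  classical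
  have h1 : ∀ S : Finset (Fin r), ∏ j, ∑ i ∈ S, M i j =
      ∑ g : Fin r → Fin r, if (∀ j, g j ∈ S) then ∏ j, M (g j) j else 0 := by
    intro S
    rw [Finset.prod_univ_sum, ← Finset.sum_filter]
    refine Finset.sum_congr ?_ (fun _ _ => rfl)
    ext g; simp [Fintype.mem_piFinset]
  simp_rw [h1, Finset.mul_sum]
  rw [Finset.sum_comm]
  have h2 : ∀ g : Fin r → Fin r,
      ∑ S : Finset (Fin r), (-1 : ℂ) ^ (Sᶜ).card * (if (∀ j, g j ∈ S) then ∏ j, M (g j) j else 0)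
        = if Function.Bijective g then ∏ j, M (g j) j else 0 := by
    intro g
    have h3 : ∑ S : Finset (Fin r), (-1 : ℂ) ^ (Sᶜ).card *
          (if (∀ j, g j ∈ S) then ∏ j, M (g j) j else 0)
        = (∑ T ∈ ((Finset.univ.image g)ᶜ).powerset, (-1 : ℂ) ^ T.card) * ∏ j, M (g j) j := by
      rw [Finset.sum_mul]
      have : ((Finset.univ.image g)ᶜ).powerset =
          Finset.univ.filter (fun T : Finset (Fin r) => ∀ j, g j ∉ T) := by
        ext T
        simp only [Finset.mem_powerset, Finset.mem_filter, Finset.mem_univ, true_and,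
          Finset.subset_iff, Finset.mem_compl, Finset.mem_image, not_exists]
        constructor
        · intro h j hj; exact h hj j rfl
        · rintro h t ht j rfl; exact h j ht
      rw [this, Finset.sum_filter]
      refine Fintype.sum_equiv (Equiv.ofBijective _ compl_bijective) _ _ (fun S => ?_)
      simp
    rw [h3]
    have h4 : (∑ T ∈ ((Finset.univ.image g)ᶜ).powerset, (-1 : ℂ) ^ T.card) =
        if Function.Bijective g then 1 else 0 := by
      have := congrArg (Int.cast : ℤ → ℂ)
        (Finset.sum_powerset_neg_one_pow_card (x := (Finset.univ.image g)ᶜ))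
      push_cast at this
      rw [this]
      refine if_congr ?_ rfl rfl
      rw [Finset.compl_eq_empty_iff, ← Finite.surjective_iff_bijective,
        Finset.eq_univ_iff_forall]
      simp [Function.Surjective]
    rw [h4]; split_ifs <;> simp
  rw [Finset.sum_congr rfl (fun g _ => h2 g), ← Finset.sum_filter]
  refine Finset.sum_bij (fun σ _ => (σ : Fin r → Fin r)) ?_ ?_ ?_ ?_
  · intro σ _; exact Finset.mem_filter.2 ⟨Finset.mem_univ _, σ.bijective⟩
  · intro σ _ τ _ h; exact Equiv.coe_fn_injective h
  · intro g hg
    exact ⟨Equiv.ofBijective g (Finset.mem_filter.1 hg).2, by simp, rfl⟩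
  · intro σ _; rfl

theorem pencilGood_symm {r N : ℕ} (x y : Fin r → ℂ) (P : MvPolynomial (Fin r) ℂ)
    (hPsym : P.IsSymmetric) (hPdeg : ∀ i : Fin r, P.degreeOf i ≤ N) :
    PencilGood N x y (fun z => MvPolynomial.eval z P) := by
  have key : ∀ z : Fin r → ℂ, MvPolynomial.eval z P = ((r.factorial : ℂ))⁻¹ *
      ∑ d ∈ P.support, P.coeff d * ∑ S : Finset (Fin r), (-1) ^ (Sᶜ).card *
        ∏ j, (∑ i ∈ S, (Polynomial.X : Polynomial ℂ) ^ (d i)).eval (z j) := by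
    intro z
    have h1 : ∀ σ : Equiv.Perm (Fin r), MvPolynomial.eval z P =
        ∑ d ∈ P.support, P.coeff d * ∏ j, z j ^ d (σ j) := by
      intro σ
      conv_lhs => rw [← hPsym σ⁻¹, MvPolynomial.eval_rename, MvPolynomial.eval_eq']
      refine Finset.sum_congr rfl fun d _ => ?_
      congr 1
      refine (Fintype.prod_equiv σ _ _ (fun j => ?_)).symm
      simp
    rw [eq_inv_mul_iff_mul_eq₀ (by exact_mod_cast r.factorial_ne_zero)]
    have h2 : ∑ σ : Equiv.Perm (Fin r), MvPolynomial.eval z P =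
      ∑ σ : Equiv.Perm (Fin r), ∑ d ∈ P.support, P.coeff d * ∏ j, z j ^ d (σ j) :=
      Finset.sum_congr rfl fun σ _ => h1 σ
    rw [Finset.sum_const, Finset.card_univ, Fintype.card_perm, Fintype.card_fin,
      nsmul_eq_mul] at h2
    rw [h2, Finset.sum_comm]
    refine Finset.sum_congr rfl fun d _ => ?_
    rw [← Finset.mul_sum]
    congr 1
    rw [ryser (fun i j => z j ^ d i)]
    simp [Polynomial.eval_finsetSum]
  simp_rw [key]
  refine (PencilGood.sum _ fun d hd => (PencilGood.sum _ fun S _ =>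
    (pencilGood_prod_eval x y _ ?_).const_mul _).const_mul _).const_mul _
  refine Polynomial.natDegree_sum_le_of_forall_le _ _ fun i _ => ?_
  rw [Polynomial.natDegree_X_pow]
  exact (MvPolynomial.le_degreeOf_of_mem_support i hd).trans (hPdeg i)

/-- Partial fractions in one variable. -/
theorem one_var_pf {ι : Type*} [Fintype ι] [DecidableEq ι] (p : Polynomial ℂ)
    (hp : p.natDegree ≤ Fintype.card ι) (A B t : ι → ℂ) (hA : ∀ i, A i ≠ 0)
    (hroot : ∀ i, A i * t i + B i = 0) (ht : Function.Injective t) :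
    ∃ c : ℂ, ∀ s : ℂ, (∀ i, A i * s + B i ≠ 0) →
      p.eval s / ∏ i, (A i * s + B i) = c + ∑ k, p.eval (t k) /
        (∏ j ∈ Finset.univ.erase k, (A j * t k + B j)) * (1 / (A k * s + B k)) := by
  set D := Lagrange.nodal Finset.univ t with hD
  have hDm : D.Monic := Lagrange.nodal_monic
  have hdeg : (p %ₘ D).degree < (Finset.univ : Finset ι).card := by
    have := Polynomial.degree_modByMonic_lt p hDm
    rwa [hD, Lagrange.degree_nodal] at this
  have hq : p /ₘ D = Polynomial.C ((p /ₘ D).coeff 0) := by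
    apply Polynomial.eq_C_of_natDegree_le_zero
    rw [Polynomial.natDegree_divByMonic _ hDm, hD, Lagrange.natDegree_nodal]
    simp [hp]
  have hi := Lagrange.eq_interpolate (f := p %ₘ D) (v := t) (s := Finset.univ) ht.injOn hdeg
  have hev : ∀ k, (p %ₘ D).eval (t k) = p.eval (t k) := by
    intro k
    conv_rhs => rw [← Polynomial.modByMonic_add_div p D]
    simp [hD, Lagrange.eval_nodal_at_node]
  have hAB : ∀ i s, A i * s + B i = A i * (s - t i) := fun i s => by
    linear_combination hroot i
  refine ⟨(p /ₘ D).coeff 0 / ∏ i, A i, fun s hs => ?_⟩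
  have hst : ∀ i, s - t i ≠ 0 := fun i h => hs i (by rw [hAB, h, mul_zero])
  have e1 : p.eval s = (p %ₘ D).eval s + (∏ i, (s - t i)) * (p /ₘ D).coeff 0 := by
    conv_lhs => rw [← Polynomial.modByMonic_add_div p D]
    rw [Polynomial.eval_add, Polynomial.eval_mul, hq]
    simp [hD, Lagrange.eval_nodal]
  have e2 : (p %ₘ D).eval s = ∑ k, p.eval (t k) *
      ∏ j ∈ Finset.univ.erase k, ((s - t j) / (t k - t j)) := by
    conv_lhs => rw [hi]
    rw [Lagrange.interpolate_apply, Polynomial.eval_finsetSum]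
    refine Finset.sum_congr rfl fun k _ => ?_
    rw [Polynomial.eval_mul, Polynomial.eval_C, hev, Lagrange.basis, Polynomial.eval_prod]
    congr 1
    refine Finset.prod_congr rfl fun j _ => ?_
    simp [Lagrange.basisDivisor, div_eq_inv_mul]
  have hPA : ∏ i, A i ≠ 0 := Finset.prod_ne_zero_iff.2 fun i _ => hA i
  have hPs : ∏ i, (s - t i) ≠ 0 := Finset.prod_ne_zero_iff.2 fun i _ => hst i
  simp_rw [hAB, e1, e2]
  rw [Finset.prod_mul_distrib, add_div, add_comm, Finset.sum_div]
  congr 1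
  · field_simp
  · refine Finset.sum_congr rfl fun k _ => ?_
    have hE : ∏ j ∈ Finset.univ.erase k, (t k - t j) ≠ 0 :=
      Finset.prod_ne_zero_iff.2 fun j hj h =>
        (Finset.mem_erase.1 hj).1 (ht (sub_eq_zero.1 h)).symm
    have hEA : ∏ j ∈ Finset.univ.erase k, A j ≠ 0 :=
      Finset.prod_ne_zero_iff.2 fun j _ => hA j
    have hEs : ∏ j ∈ Finset.univ.erase k, (s - t j) ≠ 0 :=
      Finset.prod_ne_zero_iff.2 fun j _ => hst j
    rw [← Finset.mul_prod_erase _ A (Finset.mem_univ k),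
      ← Finset.mul_prod_erase _ (fun i => s - t i) (Finset.mem_univ k),
      Finset.prod_div_distrib, Finset.prod_mul_distrib]
    have := hA k
    have := hst k
    field_simp

theorem prod_vecCons' {r : ℕ} (hr : 1 ≤ r) (c : ℂ) (v : Fin (r - 1) → ℂ) (f : ℂ → ℂ) :
    ∏ j, f (vecCons' (r := r) c v j) = f c * ∏ m, f (v m) := by
  obtain ⟨q, rfl⟩ : ∃ q, r = q + 1 := ⟨r - 1, by omega⟩
  rw [Fin.prod_univ_succ]
  simp [vecCons']

theorem hasDerivAt_prod_sub {r : ℕ} (x : Fin r → ℂ) (b : ℂ) (h : ∀ j, x j ≠ b) :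
    HasDerivAt (fun u => ∏ j, (u - x j)) (-(∏ j, (b - x j)) * ∑ j, 1 / (x j - b)) b := by
  have := HasDerivAt.fun_finsetProd (u := Finset.univ) (f := fun j u => u - x j)
    (f' := fun _ => 1) (x := b) (fun j _ => (hasDerivAt_id b).sub_const (x j))
  refine this.congr_deriv ?_
  symm
  rw [Finset.mul_sum]
  refine Finset.sum_congr rfl fun j _ => ?_
  rw [← Finset.mul_prod_erase _ _ (Finset.mem_univ j)]
  have : x j - b ≠ 0 := sub_ne_zero.2 (h j)
  simp only [smul_eq_mul]
  field_simp
  ring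

/-- Equation (2.9): the partial fraction identity (gfd) for factored
denominators. -/
theorem factored_partial_fraction
    (r n : ℕ) (hr : 1 ≤ r)
    (P : MvPolynomial (Fin r) ℂ) (hPsym : P.IsSymmetric)
    (hPdeg : ∀ i : Fin r, P.degreeOf i ≤ n + 1)
    (b : Fin (n + 1) → ℂ) (hb : Function.Injective b)
    (x y : Fin r → ℂ)
    (hQ : ∀ k, (∏ m, (x m - b k)) ≠ ∏ m, (y m - b k))
    (hxb : ∀ (m : Fin r) (j : Fin (n + 1)), x m ≠ b j)
    (hyb : ∀ (m : Fin r) (j : Fin (n + 1)), y m ≠ b j)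
    (b' : Fin (n + 1) → Fin (r - 1) → ℂ)
    (hpoly : ∀ k, ∀ u : ℂ,
      ((∏ m, (y m - b k)) - ∏ m, (x m - b k))
          * ((u - b k) * ∏ m : Fin (r - 1), (u - b' k m))
        = (∏ m, (y m - b k)) * ∏ j, (u - x j)
            - (∏ m, (x m - b k)) * ∏ j, (u - y j))
    (hb' : ∀ k (m : Fin (r - 1)) (j : Fin (n + 1)), b' k m ≠ b j) :
    eval x P / ∏ j, ∏ m, (x m - b j)
        - eval y P / ∏ j, ∏ m, (y m - b j)
      = ∑ k, (eval (vecCons' (b k) (b' k)) P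
            / ((∏ j ∈ Finset.univ.erase k, (b k - b j))
                * ∏ j, ∏ m : Fin (r - 1), (b' k m - b j)))
          * ((∑ j, 1 / (x j - b k)) - ∑ j, 1 / (y j - b k)) := by
  set Qx : Fin (n + 1) → ℂ := fun k => ∏ m, (x m - b k) with hQx
  set Qy : Fin (n + 1) → ℂ := fun k => ∏ m, (y m - b k) with hQy
  have hA : ∀ k, Qx k - Qy k ≠ 0 := fun k => sub_ne_zero.2 (hQ k)
  have hx0 : ∀ k, Qx k ≠ 0 := fun k =>
    Finset.prod_ne_zero_iff.2 fun m _ => sub_ne_zero.2 (hxb m k)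
  have hy0 : ∀ k, Qy k ≠ 0 := fun k =>
    Finset.prod_ne_zero_iff.2 fun m _ => sub_ne_zero.2 (hyb m k)
  have hpoly' : ∀ k, ∀ u : ℂ, (Qy k - Qx k) * ((u - b k) * ∏ m : Fin (r - 1), (u - b' k m))
        = Qy k * ∏ j, (u - x j) - Qx k * ∏ j, (u - y j) := hpoly
  obtain ⟨p, hp, hpe⟩ := pencilGood_symm x y P hPsym hPdeg
  simp only at hpe
  set t : Fin (n + 1) → ℂ := fun k => - Qy k / (Qx k - Qy k) with ht
  have hroot : ∀ k, (Qx k - Qy k) * t k + Qy k = 0 := fun k => by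
    have := hA k
    simp only [ht]; field_simp; ring
  set w : Fin (n + 1) → Fin r → ℂ := fun k => vecCons' (b k) (b' k) with hw
  have hwt : ∀ k, ∀ u : ℂ, ∏ j, (u - w k j) =
      t k * ∏ j, (u - x j) + (1 - t k) * ∏ j, (u - y j) := by
    intro k u
    have h1 := hpoly' k u
    have h2 : ∏ j, (u - w k j) = (u - b k) * ∏ m : Fin (r - 1), (u - b' k m) :=
      prod_vecCons' hr (b k) (b' k) (fun z => u - z)
    rw [← h2] at h1
    apply mul_left_cancel₀ (hA k)
    linear_combination (-1) * h1 - (∏ j, (u - x j) - ∏ j, (u - y j)) * hroot k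
  -- values of the linear forms at the nodes
  have hL : ∀ k j, (Qx j - Qy j) * t k + Qy j =
      (b k - b j) * ∏ m : Fin (r - 1), (b' k m - b j) := by
    intro k j
    have h2 : ∏ i, (w k i - b j) = (b k - b j) * ∏ m : Fin (r - 1), (b' k m - b j) :=
      prod_vecCons' hr (b k) (b' k) (fun z => z - b j)
    rw [← h2, prod_flip, hwt k (b j)]
    have e1 : Qx j = (-1) ^ r * ∏ i, (b j - x i) := prod_flip x (b j)
    have e2 : Qy j = (-1) ^ r * ∏ i, (b j - y i) := prod_flip y (b j)
    rw [e1, e2]; ring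
  have hL0 : ∀ k j, j ≠ k → (Qx j - Qy j) * t k + Qy j ≠ 0 := by
    intro k j hjk
    rw [hL]
    exact mul_ne_zero (sub_ne_zero.2 fun h => hjk (hb h).symm)
      (Finset.prod_ne_zero_iff.2 fun m _ => sub_ne_zero.2 (hb' k m j))
  have htinj : Function.Injective t := by
    intro k j hkj
    by_contra hne
    exact hL0 k j (Ne.symm hne) (by rw [hkj]; exact hroot j)
  obtain ⟨c, hc⟩ := one_var_pf p (by simpa using hp) (fun k => Qx k - Qy k) Qy t hA hroot htinj
  have c1 := hc 1 (fun i => by simpa using hx0 i)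
  have c0 := hc 0 (fun i => by simpa using hy0 i)
  simp only [mul_one, mul_zero, zero_add, sub_add_cancel] at c1 c0
  rw [hpe 1 x (fun u => by ring), hpe 0 y (fun u => by ring)]
  change _ / ∏ j, Qx j - _ / ∏ j, Qy j = _
  rw [c1, c0, add_sub_add_left_eq_sub, ← Finset.sum_sub_distrib]
  refine Finset.sum_congr rfl fun k _ => ?_
  have hPw : eval (w k) P = p.eval (t k) := hpe (t k) (w k) (hwt k)
  change _ = eval (w k) P / _ * _
  rw [hPw]
  -- derivative identity at `b k`
  have hder : (Qy k - Qx k) * ∏ m : Fin (r - 1), (b k - b' k m) =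
      Qy k * (-(∏ j, (b k - x j)) * ∑ j, 1 / (x j - b k)) -
        Qx k * (-(∏ j, (b k - y j)) * ∑ j, 1 / (y j - b k)) := by
    have d1 := ((hasDerivAt_prod_sub x (b k) (fun j => hxb j k)).const_mul (Qy k)).sub
      ((hasDerivAt_prod_sub y (b k) (fun j => hyb j k)).const_mul (Qx k))
    have d2 := (((hasDerivAt_id (b k)).sub_const (b k)).mul
      (hasDerivAt_prod_sub (b' k) (b k) (fun j => hb' k j k))).const_mul (Qy k - Qx k)
    have hfun : (fun u : ℂ => (Qy k - Qx k) * ((u - b k) * ∏ m : Fin (r - 1), (u - b' k m)))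
        = fun u => Qy k * ∏ j, (u - x j) - Qx k * ∏ j, (u - y j) := funext (hpoly' k)
    have d3 : HasDerivAt (fun u : ℂ => (Qy k - Qx k) *
        ((u - b k) * ∏ m : Fin (r - 1), (u - b' k m))) _ (b k) := d2
    rw [hfun] at d3
    have := d3.unique d1
    simpa using this
  have f1 : Qx k = (-1) ^ r * ∏ i, (b k - x i) := prod_flip x (b k)
  have f2 : Qy k = (-1) ^ r * ∏ i, (b k - y i) := prod_flip y (b k)
  have f3 : ∏ m : Fin (r - 1), (b' k m - b k) = (-1) ^ (r - 1) * ∏ m, (b k - b' k m) :=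
    prod_flip (b' k) (b k)
  have hB0 : ∏ m : Fin (r - 1), (b' k m - b k) ≠ 0 :=
    Finset.prod_ne_zero_iff.2 fun m _ => sub_ne_zero.2 (hb' k m k)
  have hs : ((-1 : ℂ)) ^ r = - (-1) ^ (r - 1) := by
    conv_lhs => rw [← Nat.sub_add_cancel hr]
    rw [pow_succ]; ring
  have hsum : (Qy k - Qx k) * ∏ m : Fin (r - 1), (b' k m - b k) =
      Qx k * Qy k * ((∑ j, 1 / (x j - b k)) - ∑ j, 1 / (y j - b k)) := by
    rw [f3]
    have g1 : (-1 : ℂ) ^ (r - 1) * ∏ i, (b k - x i) = - Qx k := by rw [f1, hs]; ring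
    have g2 : (-1 : ℂ) ^ (r - 1) * ∏ i, (b k - y i) = - Qy k := by rw [f2, hs]; ring
    linear_combination (-1 : ℂ) ^ (r - 1) * hder
      - Qy k * (∑ j, 1 / (x j - b k)) * g1 + Qx k * (∑ j, 1 / (y j - b k)) * g2
  have hS : (∑ j, 1 / (x j - b k)) - ∑ j, 1 / (y j - b k) =
      (∏ m : Fin (r - 1), (b' k m - b k)) * (1 / Qx k - 1 / Qy k) := by
    have := hx0 k
    have := hy0 k
    apply mul_left_cancel₀ (mul_ne_zero (hx0 k) (hy0 k))
    rw [← hsum]; field_simp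
  rw [hS]
  simp_rw [hL]
  rw [Finset.prod_mul_distrib, ← Finset.mul_prod_erase _
    (fun j => ∏ m : Fin (r - 1), (b' k m - b j)) (Finset.mem_univ k), ← mul_sub]
  have hE1 : ∏ j ∈ Finset.univ.erase k, (b k - b j) ≠ 0 :=
    Finset.prod_ne_zero_iff.2 fun j hj h =>
      (Finset.mem_erase.1 hj).1 (hb (sub_eq_zero.1 h)).symm
  have hE2 : ∏ j ∈ Finset.univ.erase k, ∏ m : Fin (r - 1), (b' k m - b j) ≠ 0 :=
    Finset.prod_ne_zero_iff.2 fun j _ =>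
      Finset.prod_ne_zero_iff.2 fun m _ => sub_ne_zero.2 (hb' k m j)
  have := hx0 k
  have := hy0 k
  field_simp
end

section
/- Let a, λ, x₁, x₂ ∈ ℂ with Re(a+λ) > 0, and suppose that x₁, x₂ and λ are not nonpositive integers and that for every integer k ≥ 0 the number λ − (λ−x₁)(λ−x₂)/(λ+k) is not a nonpositive integer. Then the series ∑_{k=0}^{∞} [ (−1)^k / k! ] · [ Γ( λ − (λ−x₁)(λ−x₂)/(λ+k) ) / Γ( λ − (λ−x₁)(λ−x₂)/(λ+k) + a − k ) ] · ( 1/(x₁+k) + 1/(x₂+k) − 1/(λ+k) ) converges and its sum equals Γ(x₁)Γ(x₂)/Γ(x₁+x₂+a). -/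
open Finset Filter Topology Complex

noncomputable def bsW (n : ℕ) (z : ℂ) : ℂ := ∏ j ∈ range n, (1 + z / ((j : ℂ) + 1))
noncomputable def bsh (n : ℕ) : ℝ := ∑ j ∈ range n, 1 / ((j : ℝ) + 1)
noncomputable def bsP (s : ℂ) (n : ℕ) : ℂ := ∏ j ∈ range (n + 1), (s + (j : ℂ))

lemma bsh_ge (n : ℕ) : Real.log ((n : ℝ) + 1) ≤ bsh n := by
  have := log_add_one_le_harmonic n
  simpa [bsh, harmonic, Nat.cast_add, one_div] using this

lemma bsh_le (n : ℕ) : bsh n ≤ 1 + Real.log n := by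
  have := harmonic_le_one_add_log n
  simpa [bsh, harmonic, one_div] using this

lemma bsh_mono : Monotone bsh := by
  apply monotone_nat_of_le_succ
  intro n
  rw [bsh, bsh, sum_range_succ]
  have : (0:ℝ) ≤ 1 / ((n : ℝ) + 1) := by positivity
  linarith

lemma bs_norm_le (w : ℂ) : ‖1 + w‖ ≤ Real.exp (w.re + ‖w‖ ^ 2 / 2) := by
  have h1 : ‖1 + w‖ ^ 2 = 1 + (2 * w.re + ‖w‖ ^ 2) := by
    rw [← normSq_eq_norm_sq, ← normSq_eq_norm_sq, normSq_apply, normSq_apply]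
    simp
    ring
  have h2 : ‖1 + w‖ ^ 2 ≤ (Real.exp (w.re + ‖w‖ ^ 2 / 2)) ^ 2 := by
    rw [h1, ← Real.exp_nat_mul]
    have := Real.add_one_le_exp (2 * w.re + ‖w‖ ^ 2)
    have e : ((2:ℕ):ℝ) * (w.re + ‖w‖ ^ 2 / 2) = 2 * w.re + ‖w‖ ^ 2 := by push_cast; ring
    rw [e]; linarith
  exact le_of_sq_le_sq h2 (Real.exp_pos _).le

noncomputable def bsS : ℝ := ∑' j : ℕ, 1 / ((j : ℝ) + 1) ^ 2

lemma bs_sumsq (n : ℕ) : ∑ j ∈ range n, 1 / ((j : ℝ) + 1) ^ 2 ≤ bsS := by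
  have hs : Summable (fun j : ℕ => 1 / ((j : ℝ) + 1) ^ 2) := by
    have := (summable_nat_add_iff 1).mpr (Real.summable_one_div_nat_pow.mpr (le_refl 2))
    simpa using this
  exact hs.sum_le_tsum _ (fun i _ => by positivity)

lemma bsW_le (R : ℝ) (n : ℕ) (z : ℂ) (hz : ‖z‖ ≤ R) :
    ‖bsW n z‖ ≤ Real.exp (z.re * bsh n + R ^ 2 * bsS) := by
  have h1 : ‖bsW n z‖ ≤ ∏ j ∈ range n, Real.exp (z.re * (1 / ((j : ℝ) + 1)) + R ^ 2 * (1 / ((j : ℝ) + 1) ^ 2)) := by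
    rw [bsW, norm_prod]
    apply prod_le_prod (fun _ _ => norm_nonneg _)
    intro j _
    refine (bs_norm_le _).trans (Real.exp_le_exp.mpr ?_)
    have e1 : (z / ((j : ℂ) + 1)).re = z.re * (1 / ((j : ℝ) + 1)) := by
      have : z / ((j : ℂ) + 1) = z / (((j : ℝ) + 1 : ℝ) : ℂ) := by push_cast; rfl
      rw [this, div_ofReal_re]; ring
    have e2 : ‖z / ((j : ℂ) + 1)‖ = ‖z‖ / ((j : ℝ) + 1) := by
      have : z / ((j : ℂ) + 1) = z / (((j : ℝ) + 1 : ℝ) : ℂ) := by push_cast; rfl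
      rw [this, norm_div, norm_real, Real.norm_of_nonneg (by positivity)]
    rw [e1, e2, div_pow]
    have : ‖z‖ ^ 2 ≤ R ^ 2 := pow_le_pow_left₀ (norm_nonneg _) hz 2
    have h3 : ‖z‖ ^ 2 / ((j : ℝ) + 1) ^ 2 ≤ R ^ 2 * (1 / ((j : ℝ) + 1) ^ 2) := by
      rw [mul_one_div]; gcongr
    have : 0 ≤ ‖z‖ ^ 2 / ((j : ℝ) + 1) ^ 2 := by positivity
    linarith
  refine h1.trans ?_
  rw [← Real.exp_sum, Real.exp_le_exp, sum_add_distrib, ← mul_sum, ← mul_sum, ← bsh]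
  have := mul_le_mul_of_nonneg_left (bs_sumsq n) (sq_nonneg R)
  linarith

lemma bs_inv_le (w : ℂ) (hw : ‖w‖ ≤ 1 / 2) : ‖1 + w‖⁻¹ ≤ Real.exp (-w.re + 3 * ‖w‖ ^ 2) := by
  have h0 : 0 ≤ ‖w‖ := norm_nonneg w
  have h1 := bs_norm_le (-w)
  have h2 : ‖1 + w‖ * ‖1 + -w‖ ≥ 1 - ‖w‖ ^ 2 := by
    rw [← norm_mul]
    have : (1 + w) * (1 + -w) = 1 - w ^ 2 := by ring
    rw [this]
    have := norm_sub_norm_le (1 : ℂ) (w ^ 2)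
    rw [norm_one, norm_pow] at this
    exact this
  have h3 : ‖w‖ ^ 2 ≤ 1 / 4 := by nlinarith
  have h4 : 1 ≤ (1 - ‖w‖ ^ 2) * Real.exp (2 * ‖w‖ ^ 2) := by
    have := Real.add_one_le_exp (2 * ‖w‖ ^ 2)
    nlinarith [sq_nonneg (‖w‖), sq_nonneg (‖w‖ ^ 2)]
  have hpos : 0 < ‖1 + w‖ := by
    by_contra hc
    have : ‖1 + w‖ = 0 := le_antisymm (not_lt.mp hc) (norm_nonneg _)
    rw [this] at h2; nlinarith
  rw [inv_le_iff_one_le_mul₀ hpos]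
  calc (1:ℝ) ≤ (1 - ‖w‖ ^ 2) * Real.exp (2 * ‖w‖ ^ 2) := h4
    _ ≤ (‖1 + w‖ * ‖1 + -w‖) * Real.exp (2 * ‖w‖ ^ 2) := by gcongr
    _ ≤ (‖1 + w‖ * Real.exp ((-w).re + ‖-w‖ ^ 2 / 2)) * Real.exp (2 * ‖w‖ ^ 2) := by gcongr
    _ = Real.exp (-w.re + (5 / 2) * ‖w‖ ^ 2) * ‖1 + w‖ := by
      rw [mul_assoc, ← Real.exp_add, norm_neg, neg_re, mul_comm]; ring_nf
    _ ≤ _ := by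
      gcongr; norm_num

lemma bs_factor (lam : ℂ) (hlam : ∀ m : ℕ, lam ≠ -(m : ℂ)) :
    ∃ C : ℝ, ∀ᶠ z in 𝓝 lam, ∀ j : ℕ,
      ‖1 + z / ((j : ℂ) + 1)‖⁻¹ ≤ Real.exp (-(z.re * (1 / ((j : ℝ) + 1))) + C * (1 / ((j : ℝ) + 1) ^ 2)) := by
  set R := ‖lam‖ + 1 with hR
  obtain ⟨J, hJ⟩ := exists_nat_ge (2 * R)
  set f : ℕ → ℂ → ℝ := fun j z => ‖1 + z / ((j : ℂ) + 1)‖⁻¹ * Real.exp (z.re * (1 / ((j : ℝ) + 1))) with hf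
  have hf0 : ∀ j z, 0 ≤ f j z := fun j z => by positivity
  set C2 := ∑ j ∈ range J, (f j lam + 1) * ((j : ℝ) + 1) ^ 2 with hC2
  have hC20 : 0 ≤ C2 := sum_nonneg (fun j _ => mul_nonneg (by linarith [hf0 j lam]) (sq_nonneg _))
  refine ⟨3 * R ^ 2 + C2, ?_⟩
  have hz : ∀ᶠ z in 𝓝 lam, ‖z‖ ≤ R := by
    have : Tendsto (fun z : ℂ => ‖z‖) (𝓝 lam) (𝓝 ‖lam‖) := continuous_norm.tendsto lam
    exact (this.eventually (gt_mem_nhds (by linarith : ‖lam‖ < R))).mono (fun z hz => le_of_lt hz)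
  have hsm : ∀ᶠ z in 𝓝 lam, ∀ j ∈ range J, f j z ≤ f j lam + 1 := by
    rw [Filter.eventually_all_finset]
    intro j _
    have hne : 1 + lam / ((j : ℂ) + 1) ≠ 0 := by
      intro h
      have hj : (j : ℂ) + 1 ≠ 0 := Nat.cast_add_one_ne_zero j
      apply hlam (j + 1)
      field_simp at h
      push_cast
      linear_combination h
    have hc : ContinuousAt (f j) lam := by
      apply ContinuousAt.mul
      · apply ContinuousAt.inv₀
        · fun_prop
        · exact norm_ne_zero_iff.mpr hne
      · have := Complex.continuous_re
        fun_prop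
    exact (hc.eventually (gt_mem_nhds (by linarith : f j lam < f j lam + 1))).mono (fun z hz => le_of_lt hz)
  filter_upwards [hz, hsm] with z h1 h2 j
  have hjp : (0:ℝ) < (j:ℝ) + 1 := by positivity
  by_cases hj : j < J
  · have h3 := h2 j (mem_range.mpr hj)
    have h4 : f j lam + 1 ≤ (3 * R ^ 2 + C2) * (1 / ((j : ℝ) + 1) ^ 2) := by
      rw [mul_one_div, le_div_iff₀ (by positivity)]
      have := single_le_sum (f := fun j : ℕ => (f j lam + 1) * ((j : ℝ) + 1) ^ 2)
        (fun j _ => mul_nonneg (by linarith [hf0 j lam]) (sq_nonneg _)) (mem_range.mpr hj)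
      have h5 : (f j lam + 1) * ((j : ℝ) + 1) ^ 2 ≤ C2 := this
      nlinarith [sq_nonneg R]
    have h5 : f j z ≤ Real.exp ((3 * R ^ 2 + C2) * (1 / ((j : ℝ) + 1) ^ 2)) := by
      have := Real.add_one_le_exp ((3 * R ^ 2 + C2) * (1 / ((j : ℝ) + 1) ^ 2))
      linarith
    rw [Real.exp_add, Real.exp_neg, ← div_eq_inv_mul, le_div_iff₀ (Real.exp_pos _)]
    exact h5
  · have hjJ : (J : ℝ) ≤ j := by exact_mod_cast not_lt.mp hj
    have e0 : z / ((j : ℂ) + 1) = z / (((j : ℝ) + 1 : ℝ) : ℂ) := by push_cast; rfl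
    have e1 : (z / ((j : ℂ) + 1)).re = z.re * (1 / ((j : ℝ) + 1)) := by
      rw [e0, div_ofReal_re]; ring
    have e2 : ‖z / ((j : ℂ) + 1)‖ = ‖z‖ / ((j : ℝ) + 1) := by
      rw [e0, norm_div, norm_real, Real.norm_of_nonneg (by positivity)]
    have h3 := bs_inv_le (z / ((j : ℂ) + 1)) (by
      rw [e2, div_le_iff₀ hjp]; linarith)
    refine h3.trans (Real.exp_le_exp.mpr ?_)
    rw [e1, e2, div_pow]
    have : ‖z‖ ^ 2 ≤ R ^ 2 := pow_le_pow_left₀ (norm_nonneg _) h1 2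
    have h5 : ‖z‖ ^ 2 / ((j : ℝ) + 1) ^ 2 ≤ R ^ 2 * (1 / ((j : ℝ) + 1) ^ 2) := by
      rw [mul_one_div]; gcongr
    have h6 : 0 ≤ C2 * (1 / ((j : ℝ) + 1) ^ 2) := by positivity
    linarith

lemma bsW_inv_le (lam : ℂ) (hlam : ∀ m : ℕ, lam ≠ -(m : ℂ)) :
    ∃ C : ℝ, ∀ᶠ z in 𝓝 lam, ∀ n : ℕ,
      ‖(bsW n z)⁻¹‖ ≤ Real.exp (-(z.re * bsh n) + C) := by
  obtain ⟨C, hC⟩ := bs_factor lam hlam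
  refine ⟨|C| * bsS, ?_⟩
  filter_upwards [hC] with z hz n
  have h1 : ‖(bsW n z)⁻¹‖ ≤ ∏ j ∈ range n, Real.exp (-(z.re * (1 / ((j : ℝ) + 1))) + C * (1 / ((j : ℝ) + 1) ^ 2)) := by
    rw [bsW, norm_inv, norm_prod, ← prod_inv_distrib]
    exact prod_le_prod (fun _ _ => by positivity) (fun j _ => hz j)
  refine h1.trans ?_
  rw [← Real.exp_sum, Real.exp_le_exp, sum_add_distrib, sum_neg_distrib, ← mul_sum, ← mul_sum, ← bsh]
  have h2 := mul_le_mul_of_nonneg_left (bs_sumsq n) (abs_nonneg C)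
  have h3 : C * ∑ j ∈ range n, 1 / ((j : ℝ) + 1) ^ 2 ≤ |C| * ∑ j ∈ range n, 1 / ((j : ℝ) + 1) ^ 2 :=
    mul_le_mul_of_nonneg_right (le_abs_self C) (sum_nonneg (fun _ _ => by positivity))
  linarith

lemma bsP_eq (s : ℂ) (n : ℕ) : bsP s n = s * n.factorial * bsW n s := by
  rw [bsP, prod_range_succ', bsW, ← prod_range_add_one_eq_factorial]
  push_cast
  rw [add_zero, mul_comm, mul_assoc, ← prod_mul_distrib]
  congr 1
  apply prod_congr rfl
  intro j _
  have hj : (j : ℂ) + 1 ≠ 0 := Nat.cast_add_one_ne_zero j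
  field_simp
  ring

lemma bsP_shift (w : ℂ) (n k : ℕ) (hk : k ≤ n) :
    bsP (w - k) n = (-1) ^ k * k.factorial * bsW k (-w) * (w * (n - k).factorial * bsW (n - k) w) := by
  rw [← bsP_eq, bsP, bsP]
  have e : n + 1 = k + (n - k + 1) := by omega
  rw [e, prod_range_add]
  congr 1
  · rw [← prod_range_reflect, bsW, ← prod_range_add_one_eq_factorial]
    push_cast
    have : ((-1 : ℂ)) ^ k = ∏ j ∈ range k, (-1 : ℂ) := by simp
    rw [this, ← prod_mul_distrib, ← prod_mul_distrib]
    apply prod_congr rfl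
    intro j hj
    have hj' := mem_range.mp hj
    have hj : (j : ℂ) + 1 ≠ 0 := Nat.cast_add_one_ne_zero j
    have : ((k - 1 - j : ℕ) : ℂ) = k - 1 - j := by
      rw [Nat.sub_sub, Nat.cast_sub (by omega)]; push_cast; ring
    rw [this]
    field_simp
    ring
  · apply prod_congr rfl
    intro j _
    push_cast; ring

lemma bs_Gseq (s : ℂ) (n : ℕ) (hn : n ≠ 0) :
    bsP s n = (n : ℂ) ^ s * n.factorial * (GammaSeq s n)⁻¹ := by
  rw [GammaSeq, inv_div, ← bsP, mul_div_cancel₀]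
  apply mul_ne_zero
  · rw [Ne, cpow_eq_zero_iff]; simp [hn]
  · exact_mod_cast n.factorial_ne_zero

lemma bs_Gseq_inv (s : ℂ) : Tendsto (fun n => (GammaSeq s n)⁻¹) atTop (𝓝 (Gamma s)⁻¹) := by
  by_cases h : ∀ m : ℕ, s ≠ -(m : ℂ)
  · exact (GammaSeq_tendsto_Gamma s).inv₀ (Gamma_ne_zero h)
  · push Not at h
    obtain ⟨m, rfl⟩ := h
    rw [Gamma_neg_nat_eq_zero, inv_zero]
    apply tendsto_const_nhds.congr'
    filter_upwards [eventually_ge_atTop m] with n hn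
    have : ∏ j ∈ range (n + 1), (-(m : ℂ) + j) = 0 :=
      prod_eq_zero (mem_range.mpr (by omega : m < n + 1)) (by ring)
    rw [GammaSeq, this]; simp

lemma bs_desc (k : ℕ) : Tendsto (fun n : ℕ => (n.factorial : ℂ) / ((n - k).factorial * (n : ℂ) ^ k)) atTop (𝓝 1) := by
  induction k with
  | zero =>
    apply tendsto_const_nhds.congr
    intro n
    have : (n.factorial : ℂ) ≠ 0 := by exact_mod_cast n.factorial_ne_zero
    simp [this]
  | succ k ih =>
    have h1 : Tendsto (fun n : ℕ => ((n : ℂ) - k) / n) atTop (𝓝 1) := by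
      have h2 : Tendsto (fun n : ℕ => 1 - (k : ℂ) / n) atTop (𝓝 (1 - 0)) :=
        tendsto_const_nhds.sub (tendsto_const_div_atTop_nhds_zero_nat (k : ℂ))
      rw [sub_zero] at h2
      apply h2.congr'
      filter_upwards [eventually_gt_atTop 0] with n hn
      have : (n : ℂ) ≠ 0 := by exact_mod_cast hn.ne'
      field_simp
    have h3 := ih.mul h1
    rw [mul_one] at h3
    apply h3.congr'
    filter_upwards [eventually_gt_atTop k] with n hn
    have hn0 : (n : ℂ) ≠ 0 := by
      have : n ≠ 0 := by omega
      exact_mod_cast this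
    obtain ⟨d, rfl⟩ : ∃ d, n = k + d + 1 := ⟨n - k - 1, by omega⟩
    have e1 : k + d + 1 - k = d + 1 := by omega
    have e2 : k + d + 1 - (k + 1) = d := by omega
    have hd : (d.factorial : ℂ) ≠ 0 := by exact_mod_cast d.factorial_ne_zero
    have hd1 : (d : ℂ) + 1 ≠ 0 := Nat.cast_add_one_ne_zero d
    rw [e1, e2, Nat.factorial_succ d]
    push_cast at hn0 ⊢
    field_simp
    ring

lemma bs_lagrange (s : Finset ℕ) (u v : ℕ → ℂ) (hv : Set.InjOn v s) (S : ℂ) :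
    ∏ j ∈ s, (S - u j) = ∏ j ∈ s, (S - v j)
      + ∑ k ∈ s, (∏ j ∈ s, (v k - u j)) * ∏ j ∈ s.erase k, ((S - v j) / (v k - v j)) := by
  have hd : (Lagrange.nodal s u - Lagrange.nodal s v).degree < (#s : WithBot ℕ) := by
    have := Polynomial.degree_sub_lt_left (p := Lagrange.nodal s u) (q := Lagrange.nodal s v)
      (by rw [Lagrange.degree_nodal, Lagrange.degree_nodal]) Lagrange.nodal_monic.ne_zero
      (by rw [Lagrange.nodal_monic.leadingCoeff, Lagrange.nodal_monic.leadingCoeff])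
    rwa [Lagrange.degree_nodal] at this
  have h := congrArg (Polynomial.eval S) (Lagrange.eq_interpolate hv hd)
  rw [Lagrange.interpolate_apply, Polynomial.eval_sub, Lagrange.eval_nodal, Lagrange.eval_nodal,
    Polynomial.eval_finsetSum] at h
  rw [← sub_eq_iff_eq_add', h]
  apply sum_congr rfl
  intro k hk
  rw [Polynomial.eval_mul, Polynomial.eval_C, Polynomial.eval_sub, Lagrange.eval_nodal_at_node hk,
    sub_zero, Lagrange.eval_nodal, Lagrange.basis, Polynomial.eval_prod]
  congr 1
  apply prod_congr rfl
  intro j _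
  simp [Lagrange.basisDivisor]
  ring

lemma bs_prod_sub (n k : ℕ) (hk : k ≤ n) :
    ∏ j ∈ (range (n + 1)).erase k, ((j : ℂ) - k) = (-1) ^ k * k.factorial * (n - k).factorial := by
  have e : (range (n + 1)).erase k = range k ∪ Ico (k + 1) (n + 1) := by
    ext j; simp; omega
  rw [e, prod_union, prod_Ico_eq_prod_range]
  · congr 1
    · rw [← prod_range_reflect, ← prod_range_add_one_eq_factorial]
      push_cast
      have : ((-1 : ℂ)) ^ k = ∏ j ∈ range k, (-1 : ℂ) := by simp
      rw [this, ← prod_mul_distrib]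
      apply prod_congr rfl
      intro j hj
      have hj' := mem_range.mp hj
      have : ((k - 1 - j : ℕ) : ℂ) = k - 1 - j := by
        rw [Nat.sub_sub, Nat.cast_sub (by omega)]; push_cast; ring
      rw [this]
      ring
    · rw [← prod_range_add_one_eq_factorial]
      have : n + 1 - (k + 1) = n - k := by omega
      rw [this, Nat.cast_prod]
      apply prod_congr rfl
      intro j _
      push_cast; ring
  · rw [disjoint_left]; intro j; simp; omega

lemma bs_finite (a lam x₁ x₂ : ℂ)
    (hx₁ : ∀ m : ℕ, x₁ ≠ -(m : ℂ))
    (hx₂ : ∀ m : ℕ, x₂ ≠ -(m : ℂ))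
    (hlam : ∀ m : ℕ, lam ≠ -(m : ℂ))
    (ε : ℕ → ℂ) (hε : ∀ k : ℕ, ε k = lam - (lam - x₁) * (lam - x₂) / (lam + k))
    (heps : ∀ k : ℕ, ∀ m : ℕ, ε k ≠ -(m : ℂ)) (n : ℕ) :
    bsP (x₁ + x₂ + a) n / (bsP x₁ n * bsP x₂ n) = 1 / bsP lam n
      + ∑ k ∈ range (n + 1), bsP (ε k + a - k) n
        / ((-1) ^ k * k.factorial * (n - k).factorial * bsP (ε k) n)
        * (1 / (x₁ + k) + 1 / (x₂ + k) - 1 / (lam + k)) := by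
  have nz : ∀ x : ℂ, (∀ m : ℕ, x ≠ -(m : ℂ)) → ∀ k : ℕ, x + k ≠ 0 := fun x hx k h =>
    hx k (eq_neg_of_add_eq_zero_left h)
  have nzP : ∀ x : ℂ, (∀ m : ℕ, x ≠ -(m : ℂ)) → bsP x n ≠ 0 := fun x hx =>
    prod_ne_zero_iff.mpr (fun k _ => nz x hx k)
  have key1 : ∀ j : ℕ, (lam + j) * (x₁ + x₂ - (ε j - j)) = (x₁ + j) * (x₂ + j) := by
    intro j
    rw [hε]
    have := nz lam hlam j
    field_simp
    ring
  have key2 : ∀ j k : ℕ, (lam + j) * ((ε k - k) - (ε j - j)) = (j - k) * (ε k + j) := by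
    intro j k
    rw [hε, hε]
    have := nz lam hlam j
    have := nz lam hlam k
    field_simp
    ring
  have hinj : Set.InjOn (fun j : ℕ => ε j - (j : ℂ)) (range (n + 1) : Finset ℕ) := by
    intro k _ j _ h
    have h1 := key2 j k
    have h : ε k - (k : ℂ) = ε j - j := h
    rw [h, sub_self, mul_zero] at h1
    rcases mul_eq_zero.mp h1.symm with h2 | h2
    · exact_mod_cast (sub_eq_zero.mp h2).symm
    · exact absurd h2 (nz _ (heps k) j)
  have hL := bs_lagrange (range (n + 1)) (fun j => -(a + j)) (fun j => ε j - (j : ℂ)) hinj (x₁ + x₂)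
  have hQ : bsP lam n * ∏ j ∈ range (n + 1), (x₁ + x₂ - (ε j - j)) = bsP x₁ n * bsP x₂ n := by
    rw [bsP, bsP, bsP, ← prod_mul_distrib, ← prod_mul_distrib]
    exact prod_congr rfl (fun j _ => key1 j)
  have hP : bsP (x₁ + x₂ + a) n = ∏ j ∈ range (n + 1), (x₁ + x₂ - -(a + j)) :=
    prod_congr rfl (fun j _ => by ring)
  have hl0 := nzP lam hlam
  have hq0 : bsP x₁ n * bsP x₂ n ≠ 0 := mul_ne_zero (nzP _ hx₁) (nzP _ hx₂)
  rw [div_eq_iff hq0, add_mul, hP, hL, sum_mul]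
  congr 1
  · rw [← hQ]; field_simp
  · apply sum_congr rfl
    intro k hk
    have hkn : k ≤ n := by have := mem_range.mp hk; omega
    have hP2 : bsP (ε k + a - k) n = ∏ j ∈ range (n + 1), (ε k - k - -(a + j)) :=
      prod_congr rfl (fun j _ => by ring)
    rw [← hP2, prod_div_distrib]
    have h1 := nz _ hx₁ k
    have h2 := nz _ hx₂ k
    have h3 := nz _ hlam k
    have hr : 1 / (x₁ + k) + 1 / (x₂ + k) - 1 / (lam + k) = (ε k + k) / ((x₁ + k) * (x₂ + k)) := by
      rw [hε]; field_simp; ring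
    have hA : (∏ j ∈ (range (n + 1)).erase k, (lam + j)) * (∏ j ∈ (range (n + 1)).erase k, (x₁ + x₂ - (ε j - j)))
        * ((x₁ + k) * (x₂ + k)) = bsP x₁ n * bsP x₂ n := by
      rw [← key1 k, ← hQ, bsP, ← mul_prod_erase _ _ hk, ← mul_prod_erase _ (fun j : ℕ => x₁ + x₂ - (ε j - j)) hk]
      ring
    have hB : (∏ j ∈ (range (n + 1)).erase k, (lam + j)) * (∏ j ∈ (range (n + 1)).erase k, (ε k - k - (ε j - j)))
        * (ε k + k) = (-1) ^ k * k.factorial * (n - k).factorial * bsP (ε k) n := by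
      rw [← prod_mul_distrib, prod_congr rfl (fun j _ => key2 j k), prod_mul_distrib, bs_prod_sub n k hkn,
        bsP, ← mul_prod_erase (range (n+1)) _ hk]
      ring
    have hB0 : (-1) ^ k * (k.factorial : ℂ) * (n - k).factorial * bsP (ε k) n ≠ 0 := by
      have h1 : (k.factorial : ℂ) ≠ 0 := by exact_mod_cast k.factorial_ne_zero
      have h2 : ((n-k).factorial : ℂ) ≠ 0 := by exact_mod_cast (n-k).factorial_ne_zero
      have h3 := nzP _ (heps k)
      exact mul_ne_zero (mul_ne_zero (mul_ne_zero (pow_ne_zero _ (by norm_num)) h1) h2) h3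
    rw [hr, ← hA, ← hB]
    rw [← hB] at hB0
    have g1 := left_ne_zero_of_mul (left_ne_zero_of_mul hB0)
    have g2 := right_ne_zero_of_mul (left_ne_zero_of_mul hB0)
    have g3 := right_ne_zero_of_mul hB0
    field_simp

lemma bs_term_lim (a e r : ℂ) (k : ℕ) (he : ∀ m : ℕ, e ≠ -(m : ℂ)) :
    Tendsto (fun n : ℕ => (n : ℂ) ^ (-a) * n.factorial * (bsP (e + a - k) n
        / ((-1) ^ k * k.factorial * (n - k).factorial * bsP e n) * r)) atTop
      (𝓝 (((-1 : ℂ) ^ k / (k.factorial : ℂ)) * (Gamma e / Gamma (e + a - k)) * r)) := by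
  have h1 := ((bs_desc k).mul (((GammaSeq_tendsto_Gamma e).mul (bs_Gseq_inv (e + a - k))).const_mul
    ((-1 : ℂ) ^ k / (k.factorial : ℂ)))).mul_const r
  rw [one_mul, ← div_eq_mul_inv] at h1
  apply h1.congr'
  filter_upwards [eventually_gt_atTop 0] with n hn
  have hn0 : (n : ℂ) ≠ 0 := by exact_mod_cast hn.ne'
  rw [bs_Gseq _ n hn.ne', bs_Gseq _ n hn.ne', cpow_sub _ _ hn0, cpow_add _ _ hn0, cpow_neg, cpow_natCast]
  have hX : (n : ℂ) ^ e ≠ 0 := by rw [Ne, cpow_eq_zero_iff]; simp [hn0]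
  have hA : (n : ℂ) ^ a ≠ 0 := by rw [Ne, cpow_eq_zero_iff]; simp [hn0]
  have hf : (n.factorial : ℂ) ≠ 0 := by exact_mod_cast n.factorial_ne_zero
  have hf1 : (k.factorial : ℂ) ≠ 0 := by exact_mod_cast k.factorial_ne_zero
  have hf2 : ((n - k).factorial : ℂ) ≠ 0 := by exact_mod_cast (n - k).factorial_ne_zero
  have hG : GammaSeq e n ≠ 0 := by
    rw [GammaSeq]
    refine div_ne_zero (mul_ne_zero hX hf) (prod_ne_zero_iff.mpr (fun j _ h => he j (eq_neg_of_add_eq_zero_left h)))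
  have hm : ((-1 : ℂ) ^ k) * (-1) ^ k = 1 := by rw [← mul_pow]; simp
  have hm0 : ((-1 : ℂ) ^ k) ≠ 0 := pow_ne_zero _ (by norm_num)
  have hm1 : ((-1 : ℂ) ^ k)⁻¹ = (-1) ^ k := inv_eq_of_mul_eq_one_left hm
  generalize (GammaSeq (e + a - k) n)⁻¹ = g
  generalize (-1 : ℂ) ^ k = m at *
  rw [mul_assoc m, mul_assoc m, mul_comm m, ← div_div _ _ m, div_eq_mul_inv _ m, hm1]
  field_simp

lemma bs_term_eq (a e r : ℂ) (n k : ℕ) (hk : k ≤ n) :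
    (n : ℂ) ^ (-a) * n.factorial * (bsP (e + a - k) n
        / ((-1) ^ k * k.factorial * (n - k).factorial * bsP e n) * r)
    = (n : ℂ) ^ (-a) * bsW k (-(e + a)) * (e + a) * bsW (n - k) (e + a) * e⁻¹ * (bsW n e)⁻¹ * r := by
  rw [bsP_shift _ n k hk, bsP_eq]
  have hf : (n.factorial : ℂ) ≠ 0 := by exact_mod_cast n.factorial_ne_zero
  have hf1 : (k.factorial : ℂ) ≠ 0 := by exact_mod_cast k.factorial_ne_zero
  have hf2 : ((n - k).factorial : ℂ) ≠ 0 := by exact_mod_cast (n - k).factorial_ne_zero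
  have hm0 : ((-1 : ℂ) ^ k) ≠ 0 := pow_ne_zero _ (by norm_num)
  generalize (-1 : ℂ) ^ k = m at *
  rw [div_eq_mul_inv]
  simp only [mul_inv]
  generalize e⁻¹ = eI
  generalize (bsW n e)⁻¹ = eW
  field_simp

lemma bs_term_bound (a e r : ℂ) (R C B δ : ℝ) (n k : ℕ) (hk : k ≤ n) (hn : 0 < n)
    (hR : ‖e + a‖ ≤ R) (hB : ‖e⁻¹‖ ≤ B) (hδ : δ ≤ (e + a).re) (hδ0 : 0 ≤ δ)
    (hC : ‖(bsW n e)⁻¹‖ ≤ Real.exp (-(e.re * bsh n) + C))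
    (hr : ‖r‖ ≤ 2 / ((k : ℝ) + 1)) :
    ‖(n : ℂ) ^ (-a) * n.factorial * (bsP (e + a - k) n
        / ((-1) ^ k * k.factorial * (n - k).factorial * bsP e n) * r)‖
    ≤ (Real.exp (|a.re| + 2 * (R ^ 2 * bsS) + C) * R * B * 2) * (1 / |(k : ℝ) + 1| ^ (1 + δ)) := by
  rw [bs_term_eq a e r n k hk]
  simp only [norm_mul]
  have h1 : ‖(n : ℂ) ^ (-a)‖ ≤ Real.exp (-(a.re * bsh n) + |a.re|) := by
    rw [norm_natCast_cpow_of_pos hn, neg_re, Real.rpow_def_of_pos (by exact_mod_cast hn), Real.exp_le_exp]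
    have u1 := bsh_le n
    have u2 : Real.log n ≤ bsh n := by
      refine le_trans (Real.log_le_log (by exact_mod_cast hn) (by linarith)) (bsh_ge n)
    have u3 : a.re * (bsh n - Real.log n) ≤ |a.re| * 1 :=
      mul_le_mul (le_abs_self _) (by linarith) (by linarith) (abs_nonneg _)
    linarith
  have h2 := bsW_le R k (-(e + a)) (by rwa [norm_neg])
  have h3 := bsW_le R (n - k) (e + a) hR
  have hR0 : 0 ≤ R := (norm_nonneg _).trans hR
  have hB0 : 0 ≤ B := (norm_nonneg _).trans hB
  have hk0 : (0:ℝ) < (k:ℝ) + 1 := by positivity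
  calc _ ≤ Real.exp (-(a.re * bsh n) + |a.re|) * Real.exp ((-(e + a)).re * bsh k + R ^ 2 * bsS) * R
        * Real.exp ((e + a).re * bsh (n - k) + R ^ 2 * bsS) * B * Real.exp (-(e.re * bsh n) + C)
        * (2 / ((k : ℝ) + 1)) := by gcongr
    _ = Real.exp ((-(a.re * bsh n) + |a.re|) + ((-(e + a)).re * bsh k + R ^ 2 * bsS) +
         ((e + a).re * bsh (n - k) + R ^ 2 * bsS) + (-(e.re * bsh n) + C)) * R * B * (2 / ((k : ℝ) + 1)) := by
      simp only [Real.exp_add]; ring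
    _ ≤ Real.exp ((|a.re| + 2 * (R ^ 2 * bsS) + C) + -(δ * Real.log ((k : ℝ) + 1))) * R * B * (2 / ((k : ℝ) + 1)) := by
      gcongr ?_ * R * B * _
      rw [Real.exp_le_exp]
      have v1 : bsh (n - k) ≤ bsh n := bsh_mono (Nat.sub_le n k)
      have v2 := bsh_ge k
      have v3 : 0 ≤ Real.log ((k : ℝ) + 1) := Real.log_nonneg (by linarith [(k.cast_nonneg : (0:ℝ) ≤ k)])
      have v4 : 0 ≤ (e + a).re * (bsh n - bsh (n - k)) := mul_nonneg (by linarith) (by linarith)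
      have v5 : δ * Real.log ((k : ℝ) + 1) ≤ (e + a).re * bsh k := mul_le_mul hδ v2 v3 (by linarith)
      rw [neg_re]
      have v6 : (e + a).re * bsh n = e.re * bsh n + a.re * bsh n := by rw [add_re]; ring
      linarith
    _ = _ := by
      rw [abs_of_pos hk0, Real.rpow_add hk0, Real.rpow_one, Real.exp_add, Real.rpow_def_of_pos hk0 δ, Real.exp_neg,
        mul_comm δ]
      field_simp

lemma bs_ratio (x : ℂ) : Tendsto (fun k : ℕ => 1 / (x + k) * ((k : ℂ) + 1)) atTop (𝓝 1) := by
  have h1 := tendsto_natCast_div_add_atTop (𝕜 := ℂ) x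
  have h2 : Tendsto (fun k : ℕ => 1 / (x + k)) atTop (𝓝 0) := by
    have h3 := h1.mul (tendsto_const_div_atTop_nhds_zero_nat (1 : ℂ))
    rw [mul_zero] at h3
    apply h3.congr'
    filter_upwards [eventually_gt_atTop 0] with n hn
    have hn0 : (n : ℂ) ≠ 0 := by exact_mod_cast hn.ne'
    rw [add_comm x]
    field_simp
  have h3 := h1.add h2
  rw [add_zero] at h3
  apply h3.congr
  intro n
  rw [add_comm x]; ring

/-- Corollary 3.1: symmetric partial fraction expansion of the beta function. -/
theorem beta_symmetric_expansion (a lam x₁ x₂ : ℂ)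
    (ha : 0 < (a + lam).re)
    (hx₁ : ∀ m : ℕ, x₁ ≠ -(m : ℂ))
    (hx₂ : ∀ m : ℕ, x₂ ≠ -(m : ℂ))
    (hlam : ∀ m : ℕ, lam ≠ -(m : ℂ))
    (heps : ∀ k : ℕ, ∀ m : ℕ,
      lam - (lam - x₁) * (lam - x₂) / (lam + k) ≠ -(m : ℂ)) :
    Tendsto (fun N : ℕ => ∑ k ∈ Finset.range N,
        ((-1 : ℂ) ^ k / (k.factorial : ℂ))
        * (Complex.Gamma (lam - (lam - x₁) * (lam - x₂) / (lam + k))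
            / Complex.Gamma
                (lam - (lam - x₁) * (lam - x₂) / (lam + k) + a - k))
        * (1 / (x₁ + k) + 1 / (x₂ + k) - 1 / (lam + k)))
      atTop
      (𝓝 (Complex.Gamma x₁ * Complex.Gamma x₂
            / Complex.Gamma (x₁ + x₂ + a))) := by
  obtain ⟨ε, hε⟩ : ∃ ε : ℕ → ℂ, ∀ k : ℕ, ε k = lam - (lam - x₁) * (lam - x₂) / (lam + k) :=
    ⟨_, fun _ => rfl⟩
  simp only [← hε] at heps ⊢
  set r : ℕ → ℂ := fun k => 1 / (x₁ + k) + 1 / (x₂ + k) - 1 / (lam + k) with hr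
  set t : ℕ → ℂ := fun k => ((-1 : ℂ) ^ k / (k.factorial : ℂ)) * (Gamma (ε k) / Gamma (ε k + a - k)) * r k
    with ht
  set T : ℕ → ℕ → ℂ := fun n k => (n : ℂ) ^ (-a) * n.factorial * (bsP (ε k + a - k) n
        / ((-1) ^ k * k.factorial * (n - k).factorial * bsP (ε k) n) * r k) with hT
  have hlim : ∀ k, Tendsto (fun n => T n k) atTop (𝓝 (t k)) := fun k =>
    bs_term_lim a (ε k) (r k) k (heps k)
  -- eventual facts in k
  have hεl : Tendsto ε atTop (𝓝 lam) := by
    have h1 : Tendsto (fun k : ℕ => ((k : ℂ) + 1)⁻¹) atTop (𝓝 0) := by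
      have := tendsto_one_div_add_atTop_nhds_zero_nat (𝕜 := ℂ)
      simpa using this
    have h2 := (bs_ratio lam).mul h1
    have h3 := (h2.const_mul ((lam - x₁) * (lam - x₂))).const_sub lam
    simp only [mul_zero, sub_zero] at h3
    apply h3.congr
    intro k
    have hk : (k : ℂ) + 1 ≠ 0 := Nat.cast_add_one_ne_zero k
    rw [hε, mul_assoc (1 / _), mul_inv_cancel₀ hk]; ring
  have hrl : ∀ᶠ k in atTop, ‖r k‖ ≤ 2 / ((k : ℝ) + 1) := by
    have h1 := (((bs_ratio x₁).add (bs_ratio x₂)).sub (bs_ratio lam)).norm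
    have h2 : ‖(1 : ℂ) + 1 - 1‖ < 2 := by norm_num
    filter_upwards [h1.eventually (gt_mem_nhds h2)] with k hk
    rw [le_div_iff₀ (by positivity)]
    have e : r k * ((k : ℂ) + 1) = 1 / (x₁ + k) * ((k : ℂ) + 1) + 1 / (x₂ + k) * ((k : ℂ) + 1)
        - 1 / (lam + k) * ((k : ℂ) + 1) := by rw [hr]; ring
    rw [← e, norm_mul] at hk
    have e2 : ‖(k : ℂ) + 1‖ = (k : ℝ) + 1 := by
      have : (k : ℂ) + 1 = (((k : ℝ) + 1 : ℝ) : ℂ) := by push_cast; rfl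
      rw [this, norm_real, Real.norm_of_nonneg (by positivity)]
    rw [e2] at hk
    exact hk.le
  have hl0 : lam ≠ 0 := by simpa using hlam 0
  obtain ⟨C, hC⟩ := bsW_inv_le lam hlam
  have hC' := hεl.eventually hC
  set δ := (a + lam).re / 2 with hδ
  have hδ0 : 0 < δ := by positivity
  have hre : ∀ᶠ k in atTop, δ ≤ (ε k + a).re := by
    have h1 : Tendsto (fun k => (ε k + a).re) atTop (𝓝 (lam + a).re) :=
      (continuous_re.tendsto _).comp (hεl.add_const a)
    have h2 : δ < (lam + a).re := by rw [add_comm lam]; linarith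
    exact (h1.eventually (lt_mem_nhds h2)).mono (fun _ h => le_of_lt h)
  have hRk : ∀ᶠ k in atTop, ‖ε k + a‖ ≤ ‖lam + a‖ + 1 :=
    ((hεl.add_const a).norm.eventually (gt_mem_nhds (lt_add_one _))).mono (fun _ h => le_of_lt h)
  have hBk : ∀ᶠ k in atTop, ‖(ε k)⁻¹‖ ≤ ‖lam⁻¹‖ + 1 :=
    ((hεl.inv₀ hl0).norm.eventually (gt_mem_nhds (lt_add_one _))).mono (fun _ h => le_of_lt h)
  obtain ⟨K, hK⟩ := eventually_atTop.mp (hrl.and (hC'.and (hre.and (hRk.and hBk))))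
  set D := Real.exp (|a.re| + 2 * ((‖lam + a‖ + 1) ^ 2 * bsS) + C) * (‖lam + a‖ + 1) * (‖lam⁻¹‖ + 1) * 2 with hD
  set bound : ℕ → ℝ := fun k => if k < K then ‖t k‖ + 1 else D * (1 / |(k : ℝ) + 1| ^ (1 + δ)) with hbound
  have hsb : Summable bound := by
    have h1 : Summable (fun k : ℕ => D * (1 / |(k : ℝ) + 1| ^ (1 + δ))) :=
      ((Real.summable_one_div_nat_add_rpow 1 (1 + δ)).mpr (by linarith)).mul_left D
    apply h1.congr_cofinite
    rw [Nat.cofinite_eq_atTop]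
    filter_upwards [eventually_ge_atTop K] with k hk
    simp [hbound, not_lt.mpr hk]
  set f : ℕ → ℕ → ℂ := fun n k => if k ∈ range (n + 1) then T n k else 0 with hf
  have hflim : ∀ k, Tendsto (fun n => f n k) atTop (𝓝 (t k)) := by
    intro k
    apply (hlim k).congr'
    filter_upwards [eventually_ge_atTop k] with n hn
    have : k ∈ range (n + 1) := mem_range.mpr (by omega)
    simp only [hf, if_pos this]
  have hfb : ∀ᶠ n in atTop, ∀ k, ‖f n k‖ ≤ bound k := by
    have h1 : ∀ᶠ n in atTop, ∀ k ∈ range K, ‖f n k‖ ≤ ‖t k‖ + 1 := by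
      rw [Filter.eventually_all_finset]
      intro k _
      exact ((hflim k).norm.eventually (gt_mem_nhds (lt_add_one _))).mono (fun _ h => le_of_lt h)
    filter_upwards [h1, eventually_gt_atTop 0] with n h1 hn k
    by_cases hk : k < K
    · simp only [hbound, if_pos hk]
      exact h1 k (mem_range.mpr hk)
    · simp only [hbound, if_neg hk]
      by_cases hkn : k ∈ range (n + 1)
      · simp only [hf, if_pos hkn]
        obtain ⟨g1, g2, g3, g4, g5⟩ := hK k (not_lt.mp hk)
        exact bs_term_bound a (ε k) (r k) _ C _ δ n k (by have := mem_range.mp hkn; omega) hn g4 g5 g3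
          hδ0.le (g2 n) g1
      · simp only [hf, if_neg hkn, norm_zero]
        positivity
  have hmain := tendsto_tsum_of_dominated_convergence hsb hflim hfb
  have hst : Summable t := by
    apply Summable.of_norm_bounded hsb
    intro k
    exact le_of_tendsto (hflim k).norm (hfb.mono (fun n h => h k))
  have hsum : ∀ n, ∑' k, f n k = ∑ k ∈ range (n + 1), T n k := by
    intro n
    rw [tsum_eq_sum (s := range (n + 1))]
    · exact sum_congr rfl (fun k hk => by simp only [hf, if_pos hk])
    · intro k hk; simp only [hf, if_neg hk]
  have hF : Tendsto (fun n => ∑' k, f n k) atTop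
      (𝓝 (Gamma x₁ * Gamma x₂ / Gamma (x₁ + x₂ + a))) := by
    have h1 := ((GammaSeq_tendsto_Gamma x₁).mul (GammaSeq_tendsto_Gamma x₂)).mul (bs_Gseq_inv (x₁ + x₂ + a))
    have h2 : Tendsto (fun n : ℕ => (n : ℂ) ^ (-(a + lam))) atTop (𝓝 0) := by
      rw [tendsto_zero_iff_norm_tendsto_zero]
      have h3 := (tendsto_rpow_neg_atTop ha).comp (tendsto_natCast_atTop_atTop (R := ℝ))
      apply h3.congr'
      filter_upwards [eventually_gt_atTop 0] with n hn
      rw [norm_natCast_cpow_of_pos hn, neg_re]; rfl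
    have h4 := h1.sub (h2.mul (GammaSeq_tendsto_Gamma lam))
    rw [zero_mul, sub_zero, ← div_eq_mul_inv] at h4
    apply h4.congr'
    filter_upwards [eventually_gt_atTop 0] with n hn
    have hn0 : (n : ℂ) ≠ 0 := by exact_mod_cast hn.ne'
    have hcp : ∀ s : ℂ, (n : ℂ) ^ s ≠ 0 := by intro s; rw [Ne, cpow_eq_zero_iff]; simp [hn0]
    have hfa : (n.factorial : ℂ) ≠ 0 := by exact_mod_cast n.factorial_ne_zero
    have hfin := bs_finite a lam x₁ x₂ hx₁ hx₂ hlam ε hε heps n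
    rw [hsum, hT]
    simp only
    rw [← mul_sum, ← sub_eq_iff_eq_add'.mpr hfin, bs_Gseq _ n hn.ne', bs_Gseq _ n hn.ne', bs_Gseq _ n hn.ne',
      bs_Gseq _ n hn.ne', neg_add, cpow_add _ _ hn0, cpow_add _ _ hn0, cpow_add _ _ hn0, cpow_neg, cpow_neg]
    have hG : ∀ e : ℂ, (∀ m : ℕ, e ≠ -(m : ℂ)) → GammaSeq e n ≠ 0 := by
      intro e he
      rw [GammaSeq]
      exact div_ne_zero (mul_ne_zero (hcp e) hfa)
        (prod_ne_zero_iff.mpr (fun j _ h => he j (eq_neg_of_add_eq_zero_left h)))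
    have g1 := hG _ hx₁
    have g2 := hG _ hx₂
    have g3 := hG _ hlam
    have c1 := hcp x₁
    have c2 := hcp x₂
    have c3 := hcp lam
    have c4 := hcp a
    generalize (GammaSeq (x₁ + x₂ + a) n)⁻¹ = g
    field_simp
  rw [← tendsto_nhds_unique hmain hF]
  exact hst.hasSum.tendsto_sum_nat
end

section
/- Let a ∈ ℤ, and let λ, x₁, x₂ ∈ ℂ with Re(a+λ) > 0, such that x₁, x₂ and λ are not nonpositive integers and for every integer k ≥ 0 the number λ − (λ−x₁)(λ−x₂)/(λ+k) is not a nonpositive integer. Then the series ∑_{k=0}^{∞} [ (−1)^a ( 1 − λ + (λ−x₁)(λ−x₂)/(λ+k) )_{k−a} / k! ] · ( 1/(x₁+k) + 1/(x₂+k) − 1/(λ+k) ) converges and its sum equals Γ(x₁)Γ(x₂)/Γ(x₁+x₂+a). -/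
open Finset Filter Topology Complex

/-- The generalized Pochhammer symbol `(z)_m` for integer `m`:
`(z)_m = z(z+1)⋯(z+m-1)` for `m ≥ 0` and
`(z)_m = 1/((z-1)(z-2)⋯(z+m))` for `m < 0`. -/
noncomputable def gpoch (z : ℂ) (m : ℤ) : ℂ :=
  if 0 ≤ m then ∏ j ∈ Finset.range m.toNat, (z + j)
  else (∏ j ∈ Finset.range (-m).toNat, (z - 1 - j))⁻¹

/-- rising product -/
noncomputable def rp (z : ℂ) (n : ℕ) : ℂ := ∏ j ∈ Finset.range n, (z + j)

lemma rp_add (z : ℂ) (m n : ℕ) : rp z (m + n) = rp z m * rp (z + m) n := by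
  unfold rp
  rw [Finset.prod_range_add]
  congr 1
  refine Finset.prod_congr rfl fun j _ => ?_
  push_cast; ring

lemma fact_rp (m n : ℕ) : ((m + n).factorial : ℂ) = m.factorial * rp (m + 1) n := by
  induction n with
  | zero => simp [rp]
  | succ n ih =>
    rw [← add_assoc, Nat.factorial_succ, rp_add]
    push_cast
    rw [ih]
    simp [rp]; ring

lemma rp_ne_zero {z : ℂ} (hz : ∀ m : ℕ, z ≠ -(m : ℂ)) (n : ℕ) : rp z n ≠ 0 := by
  unfold rp
  rw [Finset.prod_ne_zero_iff]
  intro j _ h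
  exact hz j (eq_neg_of_add_eq_zero_left h)

lemma tendsto_lin (z : ℂ) : Tendsto (fun N : ℕ => (z + N) / (N : ℂ)) atTop (𝓝 1) := by
  have h : Tendsto (fun N : ℕ => z / (N : ℂ) + 1) atTop (𝓝 (0 + 1)) :=
    (tendsto_const_div_atTop_nhds_zero_nat z).add_const 1
  rw [zero_add] at h
  refine h.congr' ?_
  filter_upwards [eventually_gt_atTop 0] with N hN
  have : (N : ℂ) ≠ 0 := by exact_mod_cast hN.ne'
  field_simp

lemma tendsto_rp (z : ℂ) (n : ℕ) :
    Tendsto (fun N : ℕ => rp (z + N) n / (N : ℂ) ^ n) atTop (𝓝 1) := by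
  have h := tendsto_finsetProd (Finset.range n)
    (fun (j : ℕ) (_ : j ∈ Finset.range n) => tendsto_lin (z + j))
  simp only [Finset.prod_const_one] at h
  refine h.congr fun N => ?_
  rw [Finset.prod_div_distrib, Finset.prod_const, Finset.card_range]
  congr 1
  refine Finset.prod_congr rfl fun j _ => by ring

lemma tendsto_rp_ratio (z w : ℂ) (n : ℕ) :
    Tendsto (fun N : ℕ => rp (z + N) n / rp (w + N) n) atTop (𝓝 1) := by
  have h := (tendsto_rp z n).div (tendsto_rp w n) one_ne_zero
  rw [div_one] at h
  refine h.congr' ?_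
  filter_upwards [eventually_gt_atTop 0] with N hN
  have : (N : ℂ) ≠ 0 := by exact_mod_cast hN.ne'
  simp only [Pi.div_apply]
  rw [div_div_div_cancel_right₀ (pow_ne_zero _ this)]

/-- `(N - a)!` against `N! N^{-a}` for `a = p - q`. -/
lemma tendsto_fac (p q : ℕ) :
    Tendsto (fun N : ℕ => ((N + q - p).factorial : ℂ) * (N : ℂ) ^ p
      / (N.factorial * (N : ℂ) ^ q)) atTop (𝓝 1) := by
  have h := (tendsto_rp (1 - p) q).div (tendsto_rp (1 - p) p) one_ne_zero
  rw [div_one] at h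
  refine h.congr' ?_
  filter_upwards [eventually_gt_atTop 0, eventually_ge_atTop p] with N hN hp
  have h0 : (N : ℂ) ≠ 0 := by exact_mod_cast hN.ne'
  obtain ⟨M, rfl⟩ := Nat.exists_eq_add_of_le' hp
  have e1 : M + p + q - p = M + q := by omega
  rw [e1, fact_rp M q, fact_rp M p]
  have e2 : (1 - p + ((M + p : ℕ) : ℂ)) = M + 1 := by push_cast; ring
  simp only [Pi.div_apply, e2]
  have hM : (M.factorial : ℂ) ≠ 0 := by exact_mod_cast M.factorial_ne_zero
  have hr : rp (M + 1) p ≠ 0 := by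
    apply rp_ne_zero
    intro m hm
    have : ((M + 1 + m : ℕ) : ℂ) = 0 := by push_cast; rw [hm]; ring
    norm_cast at this
    omega
  field_simp

lemma gammaSeq_rp (s : ℂ) (N : ℕ) :
    GammaSeq s N = (N : ℂ) ^ s * N.factorial / rp s (N + 1) := rfl

lemma tendsto_inv_gammaSeq (s : ℂ) :
    Tendsto (fun N : ℕ => (GammaSeq s N)⁻¹) atTop (𝓝 (Gamma s)⁻¹) := by
  by_cases h : Gamma s = 0
  · obtain ⟨m, hm⟩ := (Gamma_eq_zero_iff s).1 h
    rw [h, inv_zero]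
    refine tendsto_const_nhds.congr' ?_
    filter_upwards [eventually_ge_atTop m] with N hN
    have : rp s (N + 1) = 0 := by
      unfold rp
      refine Finset.prod_eq_zero (i := m) (by simp; omega) (by rw [hm]; ring)
    rw [gammaSeq_rp, this]; simp
  · exact (GammaSeq_tendsto_Gamma s).inv₀ h

lemma tendsto_F (a : ℤ) (p q : ℕ) (hpq : a = p - q) (x₁ x₂ : ℂ) :
    Tendsto (fun N : ℕ => ((N + q - p).factorial : ℂ) * rp (x₁ + x₂ + a) (N + 1)
      / (rp x₁ (N + 1) * rp x₂ (N + 1))) atTop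
      (𝓝 (Gamma x₁ * Gamma x₂ / Gamma (x₁ + x₂ + a))) := by
  have h := (((GammaSeq_tendsto_Gamma x₁).mul (GammaSeq_tendsto_Gamma x₂)).mul
    (tendsto_inv_gammaSeq (x₁ + x₂ + a))).mul (tendsto_fac p q)
  rw [mul_one, ← div_eq_mul_inv] at h
  refine h.congr' ?_
  filter_upwards [eventually_gt_atTop 0] with N hN
  have h0 : (N : ℂ) ≠ 0 := by exact_mod_cast hN.ne'
  have hM : (N.factorial : ℂ) ≠ 0 := by exact_mod_cast N.factorial_ne_zero
  have e : (N : ℂ) ^ (x₁ + x₂ + a) * (N : ℂ) ^ q = (N : ℂ) ^ x₁ * (N : ℂ) ^ x₂ * (N : ℂ) ^ p := by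
    rw [← cpow_natCast, ← cpow_natCast, ← cpow_add _ _ h0, ← cpow_add _ _ h0, ← cpow_add _ _ h0]
    congr 1
    rw [hpq]; push_cast; ring
  have e1 : (N : ℂ) ^ (x₁ + x₂ + a) ≠ 0 := by simp [cpow_eq_zero_iff, h0]
  rw [gammaSeq_rp, gammaSeq_rp, gammaSeq_rp, inv_div]
  have hq : (N : ℂ) ^ q ≠ 0 := pow_ne_zero _ h0
  rw [div_mul_div_comm, div_mul_div_comm, div_mul_div_comm]
  rw [show (N : ℂ) ^ x₁ * N.factorial * ((N : ℂ) ^ x₂ * N.factorial) * rp (x₁ + x₂ + a) (N + 1)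
    * (((N + q - p).factorial : ℂ) * (N : ℂ) ^ p)
    = (((N + q - p).factorial : ℂ) * rp (x₁ + x₂ + a) (N + 1)) *
      (((N : ℂ) ^ x₁ * (N : ℂ) ^ x₂ * (N : ℂ) ^ p) * (N.factorial * N.factorial)) by ring, ← e,
    show rp x₁ (N + 1) * rp x₂ (N + 1) * ((N : ℂ) ^ (x₁ + x₂ + a) * N.factorial)
      * (N.factorial * (N : ℂ) ^ q) = (rp x₁ (N + 1) * rp x₂ (N + 1)) *
      ((N : ℂ) ^ (x₁ + x₂ + a) * (N : ℂ) ^ q * (N.factorial * N.factorial)) by ring]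
  rw [mul_div_mul_right]
  positivity

lemma tendsto_c (a : ℤ) (p q : ℕ) (hpq : a = p - q) (lam : ℂ) (ha : 0 < ((a : ℂ) + lam).re) :
    Tendsto (fun N : ℕ => ((N + q - p).factorial : ℂ) / rp lam (N + 1)) atTop (𝓝 0) := by
  have h1 : Tendsto (fun N : ℕ => (N : ℂ) ^ (-((a : ℂ) + lam))) atTop (𝓝 0) := by
    rw [tendsto_zero_iff_norm_tendsto_zero]
    have := (tendsto_rpow_neg_atTop ha).comp tendsto_natCast_atTop_atTop
    refine this.congr' ?_
    filter_upwards [eventually_gt_atTop 0] with N hN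
    rw [norm_natCast_cpow_of_pos hN]; simp
  have h := ((GammaSeq_tendsto_Gamma lam).mul (tendsto_fac p q)).mul h1
  rw [mul_zero] at h
  refine h.congr' ?_
  filter_upwards [eventually_gt_atTop 0] with N hN
  have h0 : (N : ℂ) ≠ 0 := by exact_mod_cast hN.ne'
  have hM : (N.factorial : ℂ) ≠ 0 := by exact_mod_cast N.factorial_ne_zero
  have e : (N : ℂ) ^ lam * (N : ℂ) ^ p * (N : ℂ) ^ (-((a : ℂ) + lam)) = (N : ℂ) ^ q := by
    rw [← cpow_natCast, ← cpow_natCast, ← cpow_add _ _ h0, ← cpow_add _ _ h0]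
    congr 1
    rw [hpq]; push_cast; ring
  have hq : (N : ℂ) ^ q ≠ 0 := pow_ne_zero _ h0
  rw [gammaSeq_rp, div_mul_div_comm, div_mul_eq_mul_div,
    show (N : ℂ) ^ lam * N.factorial * (((N + q - p).factorial : ℂ) * (N : ℂ) ^ p)
      * (N : ℂ) ^ (-((a : ℂ) + lam)) = ((N + q - p).factorial : ℂ) *
      (((N : ℂ) ^ lam * (N : ℂ) ^ p * (N : ℂ) ^ (-((a : ℂ) + lam))) * N.factorial) by ring, e,
    mul_comm (N.factorial : ℂ), mul_div_mul_right]
  positivity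

lemma prod_erase_sub (N k : ℕ) (hk : k ≤ N) :
    ∏ j ∈ (Finset.range (N + 1)).erase k, ((j : ℂ) - k)
      = (-1) ^ k * k.factorial * (N - k).factorial := by
  obtain ⟨M, rfl⟩ := Nat.exists_eq_add_of_le hk
  have h0 : ∏ j ∈ Finset.range k, ((j : ℂ) - k) = (-1) ^ k * k.factorial := by
    rw [← Finset.prod_range_reflect, ← Finset.prod_range_add_one_eq_factorial]
    push_cast
    rw [← Finset.card_range k, ← Finset.prod_const, Finset.card_range, ← Finset.prod_mul_distrib]
    refine Finset.prod_congr rfl fun j hj => ?_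
    have : j + 1 ≤ k := by simpa using hj
    rw [Nat.sub_sub, Nat.cast_sub (by omega)]
    push_cast; ring
  have h1 : (Finset.range (k + M + 1)).erase k
      = Finset.range k ∪ (Finset.range M).image (fun j => k + 1 + j) := by
    ext j
    simp only [Finset.mem_erase, Finset.mem_range, Finset.mem_union, Finset.mem_image]
    constructor
    · intro h
      rcases lt_or_ge j k with h' | h'
      · exact Or.inl h'
      · exact Or.inr ⟨j - (k + 1), by omega, by omega⟩
    · rintro (h | ⟨i, hi, rfl⟩) <;> omega
  rw [h1, Finset.prod_union, Finset.prod_image, h0]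
  · congr 1
    rw [Nat.add_sub_cancel_left, ← Finset.prod_range_add_one_eq_factorial]
    push_cast
    refine Finset.prod_congr rfl fun j hj => by ring
  · intro i _ j _ h
    simpa using h
  · rw [Finset.disjoint_left]
    intro j hj hj'
    simp only [Finset.mem_range, Finset.mem_image] at hj hj'
    obtain ⟨i, _, rfl⟩ := hj'
    omega

open Polynomial in
lemma lagrange_pf (s : Finset ℕ) (v β : ℕ → ℂ) (hv : Set.InjOn v s) (t : ℂ)
    (ht : ∀ i ∈ s, t ≠ v i) :
    ∏ j ∈ s, (t + β j) = (∏ j ∈ s, (t - v j)) *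
      (1 + ∑ k ∈ s, (∏ j ∈ s.erase k, (v k - v j))⁻¹ * (t - v k)⁻¹ * ∏ j ∈ s, (v k + β j)) := by
  set Q : ℂ[X] := Lagrange.nodal s v
  set P : ℂ[X] := Lagrange.nodal s (fun j => - β j) with hP
  have hdeg : (P - Q).degree < (#s : ℕ) := by
    have := Polynomial.degree_sub_lt_left (p := P) (q := Q)
      (by rw [Lagrange.degree_nodal, Lagrange.degree_nodal])
      Lagrange.nodal_ne_zero
      (by rw [Lagrange.nodal_monic.leadingCoeff, Lagrange.nodal_monic.leadingCoeff])
    rwa [Lagrange.degree_nodal] at this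
  have h := Lagrange.eq_interpolate_of_eval_eq (r := fun i => ∏ j ∈ s, (v i + β j)) hv hdeg (by
    intro i hi
    rw [eval_sub, Lagrange.eval_nodal_at_node hi, hP, Lagrange.eval_nodal]
    simp)
  have h2 := congrArg (Polynomial.eval t) h
  rw [Lagrange.eval_interpolate_not_at_node _ ht, eval_sub, hP, Lagrange.eval_nodal,
    Lagrange.eval_nodal] at h2
  simp only [sub_neg_eq_add, Lagrange.nodalWeight, Finset.prod_inv_distrib] at h2
  rw [mul_add, ← h2]; ring

/-- approximate coefficients -/
noncomputable def cA (a : ℤ) (p q : ℕ) (e : ℂ) (N k : ℕ) : ℂ :=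
  (-1) ^ k * (N + q - p).factorial / (k.factorial * (N - k).factorial)
    * (rp (e - k + a) (N + 1) / rp e (N + 1))

lemma finite_expansion (a : ℤ) (p q : ℕ) (lam x₁ x₂ : ℂ)
    (hx₁ : ∀ m : ℕ, x₁ ≠ -(m : ℂ))
    (hx₂ : ∀ m : ℕ, x₂ ≠ -(m : ℂ))
    (hlam : ∀ m : ℕ, lam ≠ -(m : ℂ))
    (heps : ∀ k : ℕ, ∀ m : ℕ,
      lam - (lam - x₁) * (lam - x₂) / (lam + k) ≠ -(m : ℂ)) (N : ℕ) :
    ((N + q - p).factorial : ℂ) * rp (x₁ + x₂ + a) (N + 1)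
      / (rp x₁ (N + 1) * rp x₂ (N + 1)) =
    ((N + q - p).factorial : ℂ) / rp lam (N + 1) +
    ∑ k ∈ Finset.range (N + 1),
      cA a p q (lam - (lam - x₁) * (lam - x₂) / (lam + k)) N k
        * (1 / (x₁ + k) + 1 / (x₂ + k) - 1 / (lam + k)) := by
  have nz : ∀ {z : ℂ}, (∀ m : ℕ, z ≠ -(m : ℂ)) → ∀ k : ℕ, z + k ≠ 0 := by
    intro z hz k h
    exact hz k (eq_neg_of_add_eq_zero_left h)
  set P := (lam - x₁) * (lam - x₂) with hPdef
  set t := x₁ + x₂ - 2 * lam with ht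
  let v : ℕ → ℂ := fun k => -(lam + k) - P / (lam + k)
  have hL := nz hlam
  have h1 := nz hx₁
  have h2 := nz hx₂
  have h3 := fun k => nz (heps k)
  have ev : ∀ j k : ℕ, (lam + j) * (v k - v j) = ((j : ℂ) - k) * (lam - P / (lam + k) + j) := by
    intro j k
    have := hL j
    have := hL k
    simp only [v]
    field_simp
    ring
  have et : ∀ j : ℕ, (lam + j) * (t - v j) = (x₁ + j) * (x₂ + j) := by
    intro j
    have := hL j
    simp only [v, ht, hPdef]
    field_simp
    ring
  have htv : ∀ j : ℕ, t - v j ≠ 0 := by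
    intro j h
    have := et j
    rw [h, mul_zero] at this
    exact mul_ne_zero (h1 j) (h2 j) this.symm
  have hinj : Set.InjOn v (Finset.range (N + 1)) := by
    intro j _ k _ hjk
    have := ev j k
    rw [hjk, sub_self, mul_zero] at this
    rcases mul_eq_zero.1 this.symm with h | h
    · exact_mod_cast sub_eq_zero.1 h
    · exact absurd h (h3 k j)
  have key := lagrange_pf (Finset.range (N + 1)) v (fun j => 2 * lam + a + j) hinj t
    (fun i _ => sub_ne_zero.1 (htv i))
  have e1 : rp (x₁ + x₂ + a) (N + 1) = ∏ j ∈ Finset.range (N + 1), (t + (2 * lam + a + j)) :=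
    Finset.prod_congr rfl fun j _ => by rw [ht]; ring
  have e2 : rp x₁ (N + 1) * rp x₂ (N + 1)
      = rp lam (N + 1) * ∏ j ∈ Finset.range (N + 1), (t - v j) := by
    unfold rp
    rw [← Finset.prod_mul_distrib, ← Finset.prod_mul_distrib]
    exact Finset.prod_congr rfl fun j _ => (et j).symm
  have hQ : ∏ j ∈ Finset.range (N + 1), (t - v j) ≠ 0 :=
    Finset.prod_ne_zero_iff.2 fun j _ => htv j
  have hrl : rp lam (N + 1) ≠ 0 := rp_ne_zero hlam _
  rw [e1, e2, key]
  have e3 : ∀ X : ℂ, ((N + q - p).factorial : ℂ) * ((∏ j ∈ Finset.range (N + 1), (t - v j)) * (1 + X))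
      / (rp lam (N + 1) * ∏ j ∈ Finset.range (N + 1), (t - v j))
      = ((N + q - p).factorial : ℂ) / rp lam (N + 1)
        + ((N + q - p).factorial : ℂ) / rp lam (N + 1) * X := by
    intro X
    field_simp
  rw [e3, Finset.mul_sum]
  congr 1
  refine Finset.sum_congr rfl fun k hk => ?_
  have hkN : k ≤ N := by simp at hk; omega
  set ε := lam - P / (lam + k) with hε
  have e4 : ∏ j ∈ Finset.range (N + 1), (v k + (2 * lam + a + j)) = rp (ε - k + a) (N + 1) := by
    refine Finset.prod_congr rfl fun j _ => ?_
    simp only [v, hε]; ring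
  have e5 : rp lam (N + 1) * (∏ j ∈ (Finset.range (N + 1)).erase k, (v k - v j)) * (ε + k)
      = (lam + k) * ((-1) ^ k * k.factorial * (N - k).factorial) * rp ε (N + 1) := by
    unfold rp
    rw [← Finset.mul_prod_erase _ (fun j : ℕ => lam + (j : ℂ)) hk,
      ← Finset.mul_prod_erase _ (fun j : ℕ => ε + (j : ℂ)) hk, ← prod_erase_sub N k hkN]
    have : (∏ j ∈ (Finset.range (N + 1)).erase k, (lam + (j : ℂ)))
        * ∏ j ∈ (Finset.range (N + 1)).erase k, (v k - v j)
        = (∏ j ∈ (Finset.range (N + 1)).erase k, ((j : ℂ) - k))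
          * ∏ j ∈ (Finset.range (N + 1)).erase k, (ε + (j : ℂ)) := by
      rw [← Finset.prod_mul_distrib, ← Finset.prod_mul_distrib]
      exact Finset.prod_congr rfl fun j _ => ev j k
    linear_combination (lam + k) * (ε + k) * this
  have hre : rp ε (N + 1) ≠ 0 := rp_ne_zero (heps k) _
  have hek : ε + k ≠ 0 := h3 k k
  have e6 : 1 / (x₁ + k) + 1 / (x₂ + k) - 1 / (lam + k) = (ε + k) / (lam + k) * (t - v k)⁻¹ := by
    have hx := et k
    have h1' := h1 k
    have h2' := h2 k
    have hL' := hL k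
    rw [show (t - v k)⁻¹ = (lam + k) / ((x₁ + k) * (x₂ + k)) by
      rw [← hx]; have := htv k; field_simp]
    simp only [hε, hPdef]
    field_simp
    ring
  have hf1 : (k.factorial : ℂ) ≠ 0 := by exact_mod_cast k.factorial_ne_zero
  have hf2 : ((N - k).factorial : ℂ) ≠ 0 := by exact_mod_cast (N - k).factorial_ne_zero
  have hE : (∏ j ∈ (Finset.range (N + 1)).erase k, (v k - v j)) ≠ 0 := by
    intro h0
    rw [h0, mul_zero, zero_mul] at e5
    have := hL k
    exact (mul_ne_zero (mul_ne_zero this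
      (mul_ne_zero (mul_ne_zero (pow_ne_zero _ (by norm_num)) hf1) hf2)) hre) e5.symm
  rw [e4, e6, cA]
  generalize (∏ j ∈ (Finset.range (N + 1)).erase k, (v k - v j)) = E at *
  have hL' := hL k
  have htk := htv k
  have hs : ((-1 : ℂ) ^ k) * (-1) ^ k = 1 := by rw [← mul_pow]; simp
  have e7 : (rp lam (N + 1) * E)⁻¹ = (ε + k) / ((lam + k) * ((-1) ^ k * k.factorial * (N - k).factorial) * rp ε (N + 1)) := by
    rw [← e5]; field_simp
  have e8 : ((-1 : ℂ) ^ k)⁻¹ = (-1) ^ k := by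
    rw [← inv_pow]; norm_num
  calc _ = ((N + q - p).factorial : ℂ) * (rp lam (N + 1) * E)⁻¹ * (t - v k)⁻¹ * rp (ε - k + a) (N + 1) := by
        rw [mul_inv]; ring
    _ = _ := by
        rw [e7]
        simp only [div_eq_mul_inv, mul_inv, e8]
        ring

lemma gpoch_of_nonneg (z : ℂ) (n : ℕ) : gpoch z n = rp z n := by
  simp [gpoch, rp]

lemma rp_reflect (e : ℂ) (n : ℕ) : rp (1 - e) n = (-1) ^ n * rp (e - n) n := by
  unfold rp
  rw [← Finset.prod_range_reflect, ← Finset.card_range n, ← Finset.prod_const, Finset.card_range,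
    ← Finset.prod_mul_distrib]
  refine Finset.prod_congr rfl fun j hj => ?_
  have : j + 1 ≤ n := by simpa using hj
  rw [Nat.sub_sub, Nat.cast_sub (by omega)]
  push_cast; ring

lemma neg_one_zpow_eq {a b : ℤ} (h : Even (a - b)) : (-1 : ℂ) ^ a = (-1) ^ b := by
  have : a = b + (a - b) := by ring
  rw [this, zpow_add₀ (by norm_num), h.neg_one_zpow, mul_one]

lemma coef_nonneg (a : ℤ) (e : ℂ) (k n : ℕ) (hn : (k : ℤ) = a + n) :
    (-1 : ℂ) ^ a * gpoch (1 - e) ((k : ℤ) - a) = (-1) ^ k * rp (e - n) n := by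
  rw [show (k : ℤ) - a = (n : ℤ) by omega, gpoch_of_nonneg, rp_reflect, ← mul_assoc]
  congr 1
  rw [← zpow_natCast, ← zpow_natCast, ← zpow_add₀ (by norm_num), hn]

lemma coef_neg (a : ℤ) (e : ℂ) (k n : ℕ) (hn : (k : ℤ) + n = a) (h0 : 0 < n) :
    (-1 : ℂ) ^ a * gpoch (1 - e) ((k : ℤ) - a) = (-1) ^ k * (rp e n)⁻¹ := by
  have h1 : ¬ (0 ≤ (k : ℤ) - a) := by omega
  rw [gpoch, if_neg h1, show (-((k : ℤ) - a)).toNat = n by omega]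
  have : ∏ j ∈ Finset.range n, (1 - e - 1 - (j : ℂ)) = (-1) ^ n * rp e n := by
    unfold rp
    rw [← Finset.card_range n, ← Finset.prod_const, Finset.card_range,
      ← Finset.prod_mul_distrib]
    exact Finset.prod_congr rfl fun j hj => by ring
  rw [this, mul_inv, ← mul_assoc, ← inv_pow, show (-1 : ℂ)⁻¹ = -1 by norm_num]
  congr 1
  rw [← zpow_natCast, ← zpow_natCast, ← zpow_add₀ (by norm_num)]
  exact neg_one_zpow_eq ⟨n, by omega⟩

lemma cA_eq (a : ℤ) (p q : ℕ) (hpq : a = p - q) (e : ℂ) (he : ∀ m : ℕ, e ≠ -(m : ℂ))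
    (N k n : ℕ) (hk : k ≤ N) (hn : (k : ℤ) = a + n)
    (hne : rp (e - n + (N + 1)) n ≠ 0) :
    cA a p q e N k = ((-1 : ℂ) ^ a * gpoch (1 - e) ((k : ℤ) - a) / k.factorial)
      * (rp (((N - k : ℕ) : ℂ) + 1) n / rp (e - n + (N + 1)) n) := by
  rw [coef_nonneg a e k n hn, cA]
  have e1 : N + q - p = (N - k) + n := by omega
  rw [e1, fact_rp]
  have e2 : e - k + a = e - n := by
    have : (k : ℂ) = a + n := by exact_mod_cast congrArg (Int.cast : ℤ → ℂ) hn
    rw [this]; ring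
  have hf1 : (k.factorial : ℂ) ≠ 0 := by exact_mod_cast k.factorial_ne_zero
  have hf2 : ((N - k).factorial : ℂ) ≠ 0 := by exact_mod_cast (N - k).factorial_ne_zero
  have hr := rp_ne_zero he (N + 1)
  have e3 : rp (e - n) (N + 1) * rp (e - n + (N + 1)) n = rp (e - n) n * rp e (N + 1) := by
    have h1 := rp_add (e - n) (N + 1) n
    have h2 := rp_add (e - n) n (N + 1)
    rw [add_comm, h2] at h1
    rw [sub_add_cancel] at h1
    rw [h1]; push_cast; rfl
  have e4 : rp (e - n) (N + 1) / rp e (N + 1) = rp (e - n) n / rp (e - n + (N + 1)) n := by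
    rw [div_eq_div_iff hr hne, e3]
  rw [e2, e4]
  field_simp

lemma tendsto_cA (a : ℤ) (p q : ℕ) (hpq : a = p - q) (e : ℂ) (he : ∀ m : ℕ, e ≠ -(m : ℂ))
    (k : ℕ) :
    Tendsto (fun N => cA a p q e N k) atTop
      (𝓝 ((-1 : ℂ) ^ a * gpoch (1 - e) ((k : ℤ) - a) / k.factorial)) := by
  rcases le_or_gt a k with h | h
  · obtain ⟨n, hn⟩ := Int.exists_add_of_le h
    have hl := (tendsto_rp_ratio (1 - k) (e - n + 1) n).const_mul
      ((-1 : ℂ) ^ a * gpoch (1 - e) ((k : ℤ) - a) / k.factorial)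
    rw [mul_one] at hl
    refine hl.congr' ?_
    filter_upwards [eventually_ge_atTop k, eventually_ge_atTop n] with N hN hN'
    rw [cA_eq a p q hpq e he N k n hN hn]
    · rw [Nat.cast_sub hN]
      congr 3
      · ring
      · ring
    · apply rp_ne_zero
      intro m hm
      apply he (N - n + 1 + m)
      push_cast [Nat.cast_sub hN']
      linear_combination hm
  · obtain ⟨n, hn⟩ := Int.exists_add_of_le h.le
    have h0 : 0 < n := by omega
    rw [coef_neg a e k n hn.symm h0]
    have hl := (tendsto_rp_ratio (e + 1) (q - p + 1) n).const_mul
      ((-1 : ℂ) ^ k * (rp e n)⁻¹ / k.factorial)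
    rw [mul_one] at hl
    refine hl.congr' ?_
    filter_upwards [eventually_ge_atTop k, eventually_ge_atTop p] with N hN hN'
    rw [cA]
    have e1 : N - k = (N + q - p) + n := by omega
    have e2 : e - k + a = e + n := by
      rw [hn]; push_cast; ring
    have hf1 : (k.factorial : ℂ) ≠ 0 := by exact_mod_cast k.factorial_ne_zero
    have hf2 : ((N + q - p).factorial : ℂ) ≠ 0 := by exact_mod_cast (N + q - p).factorial_ne_zero
    have hr := rp_ne_zero he (N + 1)
    have hr2 := rp_ne_zero he n
    have e3 : rp e n * rp (e + n) (N + 1) = rp e (N + 1) * rp (e + 1 + N) n := by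
      rw [← rp_add, add_comm, rp_add]
      congr 2
      push_cast; ring
    have e4 : rp (e + n) (N + 1) / rp e (N + 1) = rp (e + 1 + N) n / rp e n := by
      rw [div_eq_div_iff hr hr2]; linear_combination e3
    have e5 : ((N + q - p : ℕ) : ℂ) + 1 = (q - p + 1) + N := by
      rw [Nat.cast_sub (by omega)]; push_cast; ring
    rw [e1, fact_rp, e2, e4, e5]
    have hr3 : rp ((q - p + 1 : ℂ) + N) n ≠ 0 := by
      rw [← e5]
      apply rp_ne_zero
      intro m hm
      have : ((N + q - p + 1 + m : ℕ) : ℂ) = 0 := by push_cast; rw [hm]; ring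
      norm_cast at this
      omega
    field_simp

lemma norm_rp_ge (d : ℂ) (hd : 0 < d.re) (m n : ℕ) :
    ‖rp ((m : ℂ) + 1) n‖ ≤ ‖rp (d + m + 1) n‖ := by
  unfold rp
  rw [norm_prod, norm_prod]
  refine Finset.prod_le_prod (fun _ _ => norm_nonneg _) fun j _ => ?_
  have h1 : ‖(m : ℂ) + 1 + j‖ = (m + 1 + j : ℝ) := by
    rw [show (m : ℂ) + 1 + j = ((m + 1 + j : ℕ) : ℂ) by push_cast; ring, Complex.norm_natCast]
    push_cast; ring
  rw [h1]
  refine le_trans ?_ (Complex.re_le_norm _)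
  simp
  linarith

lemma cA_bound (a : ℤ) (p q : ℕ) (hpq : a = p - q) (e : ℂ) (he : ∀ m : ℕ, e ≠ -(m : ℂ))
    (N k : ℕ) (hk : k ≤ N) (hak : a ≤ k) (hre : 0 < (e + a).re) :
    ‖cA a p q e N k‖ ≤ ‖(-1 : ℂ) ^ a * gpoch (1 - e) ((k : ℤ) - a) / k.factorial‖ := by
  obtain ⟨n, hn⟩ := Int.exists_add_of_le hak
  have h := norm_rp_ge (e + a) hre (N - k) n
  have e1 : e + a + ((N - k : ℕ) : ℂ) + 1 = e - n + (N + 1) := by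
    have : (k : ℂ) = a + n := by exact_mod_cast congrArg (Int.cast : ℤ → ℂ) hn
    rw [Nat.cast_sub hk, this]; ring
  rw [e1] at h
  have h0 : rp (((N - k : ℕ) : ℂ) + 1) n ≠ 0 := by
    apply rp_ne_zero
    intro m hm
    have : ((N - k + 1 + m : ℕ) : ℂ) = 0 := by push_cast; rw [hm]; ring
    norm_cast at this
    omega
  have hpos : 0 < ‖rp (e - n + (N + 1)) n‖ := (norm_pos_iff.2 h0).trans_le h
  rw [cA_eq a p q hpq e he N k n hk hn (norm_pos_iff.1 hpos), norm_mul]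
  refine mul_le_of_le_one_right (norm_nonneg _) ?_
  rw [norm_div]
  exact (div_le_one hpos).2 h

lemma summable_tele (v : ℕ → ℝ) (hv : ∀ k, 0 ≤ v k) (θ : ℝ) (hθ : 0 < θ) (K : ℕ)
    (h : ∀ k ≥ K, v k - v (k + 1) = θ * (v k / (k + 1))) :
    Summable (fun k : ℕ => v k / (k + 1)) := by
  rw [← summable_nat_add_iff K]
  refine summable_of_sum_range_le (c := v K / θ) (fun n => ?_) (fun n => ?_)
  · have := hv (n + K); positivity
  · have : θ * ∑ i ∈ Finset.range n, v (i + K) / (((i + K : ℕ) : ℝ) + 1) = v K - v (n + K) := by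
      rw [Finset.mul_sum]
      induction n with
      | zero => simp
      | succ n ih =>
        rw [Finset.sum_range_succ, ih, ← h (n + K) (by omega),
          show n + 1 + K = n + K + 1 by ring]
        ring
    rw [le_div_iff₀ hθ, mul_comm, this]
    linarith [hv (n + K)]

lemma summable_coef (a : ℤ) (lam : ℂ) (e : ℕ → ℂ) (ha : 0 < ((a : ℂ) + lam).re)
    (he : Tendsto e atTop (𝓝 lam)) :
    Summable (fun k : ℕ => ‖(-1 : ℂ) ^ a * gpoch (1 - e k) ((k : ℤ) - a) / k.factorial‖
      / ((k : ℝ) + 1)) := by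
  simp only [add_re, intCast_re] at ha
  set η : ℝ := ((a : ℝ) + lam.re) / 2 with hη
  have hη0 : 0 < η := by rw [hη]; linarith
  set ρ : ℝ := 1 - lam.re + η with hρ
  set W : ℝ := ‖1 - lam‖ + 1 with hW
  obtain ⟨J, hJ⟩ := exists_nat_gt ((W ^ 2 / (η / 2)) + |ρ| + W)
  have hW0 : 0 < W := by positivity
  have hJ1 : |ρ| + W < J := by
    have : 0 ≤ W ^ 2 / (η / 2) := by positivity
    linarith
  have hw : Tendsto (fun k => 1 - e k) atTop (𝓝 (1 - lam)) := he.const_sub 1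
  have ev1 : ∀ᶠ k in atTop, ‖1 - e k‖ ≤ W :=
    (hw.norm.eventually_lt_const (by rw [hW]; linarith : ‖1 - lam‖ < W)).mono fun _ h => h.le
  have ev2 : ∀ᶠ k in atTop, (1 - e k).re < ρ - η / 2 := by
    refine ((Complex.continuous_re.tendsto _).comp hw).eventually_lt_const ?_
    simp only [sub_re, one_re, hρ]; linarith
  set g : ℕ → ℝ := fun j => if j < J then W + J else j + ρ with hg
  have hg0 : ∀ j, 0 ≤ g j := by
    intro j
    simp only [hg]
    split_ifs with hj
    · positivity
    · have : (J : ℝ) ≤ j := by exact_mod_cast not_lt.1 hj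
      linarith [neg_abs_le ρ]
  have hgb : ∀ w : ℂ, ‖w‖ ≤ W → w.re < ρ - η / 2 → ∀ j : ℕ, ‖w + j‖ ≤ g j := by
    intro w h1 h2 j
    simp only [hg]
    split_ifs with hj
    · refine (norm_add_le _ _).trans ?_
      rw [Complex.norm_natCast]
      have : (j : ℝ) ≤ J := by exact_mod_cast hj.le
      linarith
    · have hj' : (J : ℝ) ≤ j := by exact_mod_cast not_lt.1 hj
      have hjr : 0 ≤ (j : ℝ) + ρ := by linarith [neg_abs_le ρ]
      refine le_of_sq_le_sq ?_ hjr
      rw [Complex.sq_norm, Complex.normSq_apply]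
      simp only [add_re, natCast_re, add_im, natCast_im, add_zero]
      have him : w.im * w.im ≤ W ^ 2 := by
        have := Complex.abs_im_le_norm w
        have h3 : |w.im| ≤ W := this.trans h1
        nlinarith [abs_nonneg w.im, abs_mul_abs_self w.im]
      have hre : -W ≤ w.re := by
        have := Complex.abs_re_le_norm w
        linarith [neg_abs_le w.re]
      have h4 : W ^ 2 ≤ (η / 2) * (2 * j + ρ + w.re) := by
        have : W ^ 2 / (η / 2) ≤ 2 * j + ρ + w.re := by
          linarith [neg_abs_le ρ, abs_nonneg ρ]
        rw [div_le_iff₀ (by positivity)] at this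
        linarith
      have h5 : 0 ≤ 2 * j + ρ + w.re := by linarith [neg_abs_le ρ, abs_nonneg ρ]
      nlinarith [mul_le_mul_of_nonneg_right (show η / 2 ≤ ρ - w.re by linarith) h5]
  set v : ℕ → ℝ := fun k => (∏ j ∈ Finset.range ((k : ℤ) - a).toNat, g j) / k.factorial with hv
  have hv0 : ∀ k, 0 ≤ v k := fun k =>
    div_nonneg (Finset.prod_nonneg fun j _ => hg0 j) (by positivity)
  have hs : Summable (fun k : ℕ => v k / (k + 1)) := by
    refine summable_tele v hv0 η hη0 (J + a.toNat) fun k hk => ?_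
    have e1 : (((k + 1 : ℕ) : ℤ) - a).toNat = ((k : ℤ) - a).toNat + 1 := by omega
    have e2 : ¬ (((k : ℤ) - a).toNat < J) := by omega
    have e3 : ((((k : ℤ) - a).toNat : ℕ) : ℝ) = k - a := by
      have : ((((k : ℤ) - a).toNat : ℕ) : ℤ) = k - a := by omega
      exact_mod_cast congrArg (Int.cast : ℤ → ℝ) this
    simp only [hv]
    rw [e1, Finset.prod_range_succ, Nat.factorial_succ]
    have e4 : g ((k : ℤ) - a).toNat = k - a + ρ := by
      simp only [hg]; rw [if_neg e2, e3]
    rw [e4]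
    have : (k.factorial : ℝ) ≠ 0 := by positivity
    have h1 : (k : ℝ) + 1 ≠ 0 := by positivity
    push_cast
    field_simp
    rw [hρ, hη]; ring
  refine Summable.of_norm_bounded_eventually_nat hs ?_
  filter_upwards [ev1, ev2, eventually_ge_atTop a.toNat] with k h1 h2 h3
  rw [Real.norm_of_nonneg (by positivity)]
  refine div_le_div_of_nonneg_right ?_ (by positivity)
  rw [norm_div, norm_mul, norm_zpow, norm_neg, norm_one, one_zpow, one_mul, Complex.norm_natCast]
  refine div_le_div_of_nonneg_right ?_ (by positivity)
  rw [gpoch, if_pos (by omega), norm_prod]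
  exact Finset.prod_le_prod (fun _ _ => norm_nonneg _) fun j _ => hgb _ h1 h2 j

lemma tendsto_inv_shift (z : ℂ) :
    Tendsto (fun k : ℕ => ((k : ℂ) + 1) * (1 / (z + k))) atTop (𝓝 1) := by
  have h := (tendsto_lin 1).div (tendsto_lin z) one_ne_zero
  rw [div_one] at h
  refine h.congr' ?_
  filter_upwards [eventually_gt_atTop 0] with N hN
  have : (N : ℂ) ≠ 0 := by exact_mod_cast hN.ne'
  simp only [Pi.div_apply]
  rw [div_div_div_cancel_right₀ this]; ring

/-- Saha–Sinha expansion of the beta function for integer shift `a`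
(equation after Corollary 3.1). -/
theorem beta_symmetric_expansion_int (a : ℤ) (lam x₁ x₂ : ℂ)
    (ha : 0 < ((a : ℂ) + lam).re)
    (hx₁ : ∀ m : ℕ, x₁ ≠ -(m : ℂ))
    (hx₂ : ∀ m : ℕ, x₂ ≠ -(m : ℂ))
    (hlam : ∀ m : ℕ, lam ≠ -(m : ℂ))
    (heps : ∀ k : ℕ, ∀ m : ℕ,
      lam - (lam - x₁) * (lam - x₂) / (lam + k) ≠ -(m : ℂ)) :
    Tendsto (fun N : ℕ => ∑ k ∈ Finset.range N,
        ((-1 : ℂ) ^ a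
            * gpoch (1 - lam + (lam - x₁) * (lam - x₂) / (lam + k))
                ((k : ℤ) - a)
            / (k.factorial : ℂ))
        * (1 / (x₁ + k) + 1 / (x₂ + k) - 1 / (lam + k)))
      atTop
      (𝓝 (Complex.Gamma x₁ * Complex.Gamma x₂
            / Complex.Gamma (x₁ + x₂ + a))) := by
  obtain ⟨p, q, hpq⟩ : ∃ p q : ℕ, a = (p : ℤ) - q := ⟨a.toNat, (-a).toNat, by omega⟩
  set e : ℕ → ℂ := fun k => lam - (lam - x₁) * (lam - x₂) / (lam + k) with he
  have e1 : ∀ k : ℕ, 1 - lam + (lam - x₁) * (lam - x₂) / (lam + k) = 1 - e k := by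
    intro k; simp only [he]; ring
  simp only [e1]
  set r : ℕ → ℂ := fun k => 1 / (x₁ + k) + 1 / (x₂ + k) - 1 / (lam + k) with hr
  set A : ℕ → ℂ := fun k => (-1 : ℂ) ^ a * gpoch (1 - e k) ((k : ℤ) - a) / k.factorial with hA
  have hlim : Tendsto e atTop (𝓝 lam) := by
    have h0 : Tendsto (fun k : ℕ => (lam - x₁) * (lam - x₂) / (lam + k)) atTop (𝓝 0) := by
      have h := (tendsto_const_div_atTop_nhds_zero_nat ((lam - x₁) * (lam - x₂))).div
        (tendsto_lin lam) one_ne_zero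
      rw [zero_div] at h
      refine h.congr' ?_
      filter_upwards [eventually_gt_atTop 0] with N hN
      have : (N : ℂ) ≠ 0 := by exact_mod_cast hN.ne'
      simp only [Pi.div_apply]
      rw [div_div_div_cancel_right₀ this]
    simpa using h0.const_sub lam
  have hsum : Summable (fun k => ‖A k * r k‖) := by
    have hs := (summable_coef a lam e ha hlim).mul_left 2
    refine Summable.of_norm_bounded_eventually_nat hs ?_
    have h1 : Tendsto (fun k : ℕ => ((k : ℂ) + 1) * r k) atTop (𝓝 1) := by
      have := ((tendsto_inv_shift x₁).add (tendsto_inv_shift x₂)).sub (tendsto_inv_shift lam)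
      rw [add_sub_cancel_right] at this
      refine this.congr fun k => ?_
      simp only [hr]; ring
    have h2 := h1.norm.eventually_lt_const (show ‖(1 : ℂ)‖ < 2 by simp)
    filter_upwards [h2] with k hk
    rw [norm_norm, norm_mul]
    have hk1 : ‖(k : ℂ) + 1‖ = k + 1 := by
      rw [show (k : ℂ) + 1 = ((k + 1 : ℕ) : ℂ) by push_cast; ring, Complex.norm_natCast]
      push_cast; ring
    rw [norm_mul, hk1] at hk
    have hkp : (0 : ℝ) < k + 1 := by positivity
    have h3 : ‖r k‖ ≤ 2 / (k + 1) := by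
      rw [le_div_iff₀ hkp]; linarith
    calc ‖A k‖ * ‖r k‖ ≤ ‖A k‖ * (2 / (k + 1)) := mul_le_mul_of_nonneg_left h3 (norm_nonneg _)
      _ = 2 * (‖A k‖ / (k + 1)) := by ring
  have hS := (hsum.of_norm).hasSum.tendsto_sum_nat
  suffices hval : ∑' k, A k * r k = Gamma x₁ * Gamma x₂ / Gamma (x₁ + x₂ + a) by
    rw [hval] at hS; exact hS
  set f : ℕ → ℕ → ℂ := fun N k => if k < N + 1 then cA a p q (e k) N k * r k else 0 with hf
  have hfl : ∀ k, Tendsto (fun N => f N k) atTop (𝓝 (A k * r k)) := by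
    intro k
    refine ((tendsto_cA a p q hpq (e k) (heps k) k).mul_const (r k)).congr' ?_
    filter_upwards [eventually_ge_atTop k] with N hN
    simp only [hf]; rw [if_pos (by omega)]
  have hev : ∀ᶠ k : ℕ in atTop, 0 < (e k + a).re := by
    have h := (Complex.continuous_re.tendsto _).comp (hlim.add_const (a : ℂ))
    refine h.eventually_const_lt ?_
    rw [add_comm]; exact ha
  obtain ⟨K, hK⟩ := eventually_atTop.1 (hev.and (eventually_ge_atTop a.toNat))
  have hT := tendsto_tsum_of_dominated_convergence (𝓕 := atTop) (f := f)
    (g := fun k => A k * r k)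
    (bound := fun k => ‖A k * r k‖ + if k < K then 1 else 0)
    (hsum.add (summable_of_ne_finset_zero (s := Finset.range K)
      (fun k hk => if_neg (by simpa using hk)))) hfl (by
      have h1 : ∀ᶠ N in atTop, ∀ k ∈ Finset.range K, ‖f N k‖ ≤ ‖A k * r k‖ + 1 := by
        rw [Filter.eventually_all_finset]
        intro k _
        exact ((hfl k).norm.eventually_lt_const (lt_add_one _)).mono fun _ h => h.le
      filter_upwards [h1] with N hN k
      by_cases hk : k < K
      · rw [if_pos hk]; exact hN k (by simpa using hk)
      · rw [if_neg hk, add_zero]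
        simp only [hf]
        split_ifs with hkN
        · rw [norm_mul, norm_mul]
          obtain ⟨h2, h3⟩ := hK k (not_lt.1 hk)
          exact mul_le_mul_of_nonneg_right
            (cA_bound a p q hpq (e k) (heps k) N k (by omega) (by omega) h2) (norm_nonneg _)
        · rw [norm_zero]; positivity)
  have hF := (tendsto_F a p q hpq x₁ x₂).sub (tendsto_c a p q hpq lam ha)
  rw [sub_zero] at hF
  refine tendsto_nhds_unique hT (hF.congr fun N => ?_)
  rw [finite_expansion a p q lam x₁ x₂ hx₁ hx₂ hlam heps N, add_sub_cancel_left,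
    tsum_eq_sum (s := Finset.range (N + 1)) (fun k hk => if_neg (by simpa using hk))]
  refine Finset.sum_congr rfl fun k hk => ?_
  exact (if_pos (by simpa using hk)).symm
end

section
/- Let m, n, a be integers with m ≥ 0, n ≥ 0 and m + n + a ≥ 0, and let λ ∈ ℂ with Re(λ) > −a, such that λ is not a nonpositive integer and for every integer k ≥ 0 the number λ − (λ−1/2−m)(λ−1/2−n)/(λ+k) is not a nonpositive integer. Then π = [ (−1)^a (m+n+a)! 2^{m+n} / ( (2m−1)!! (2n−1)!! ) ] · ∑_{k=0}^{∞} (1/k!) · ( 1 − λ + (λ − 1/2 − m)(λ − 1/2 − n)/(λ+k) )_{k−a} · ( 2/(2m+2k+1) + 2/(2n+2k+1) − 1/(λ+k) ), with the series on the right converging. -/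
open Finset Filter Topology Complex

lemma prod_erase (k d : ℕ) :
    ∏ j ∈ (range (k + d + 1)).erase k, ((j:ℂ) - k) = (-1)^k * k.factorial * d.factorial := by
  induction d with
  | zero =>
    rw [Nat.add_zero, range_add_one, erase_insert (by simp)]
    rw [← prod_range_reflect]
    simp only [Nat.factorial_zero, Nat.cast_one, mul_one]
    rw [← prod_range_add_one_eq_factorial, Nat.cast_prod]
    have hc : (-1:ℂ)^k = ∏ _j ∈ range k, (-1:ℂ) := by simp
    rw [hc, ← prod_mul_distrib]
    apply prod_congr rfl
    intro j hj
    have := mem_range.1 hj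
    rw [Nat.cast_sub (by omega), Nat.cast_sub (by omega)]
    push_cast; ring
  | succ d ih =>
    rw [show k + (d+1) + 1 = (k + d + 1) + 1 by ring, range_add_one,
      erase_insert_of_ne (by omega), prod_insert (by simp), ih, Nat.factorial_succ]
    push_cast; ring

lemma pf (x y lam a : ℂ) (N : ℕ) (Y : ℕ → ℂ)
    (hY : ∀ k, Y k = lam - (lam - x) * (lam - y) / (lam + k))
    (hx : ∀ j : ℕ, x + j ≠ 0) (hy : ∀ j : ℕ, y + j ≠ 0) (hl : ∀ j : ℕ, lam + j ≠ 0)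
    (hYj : ∀ k j : ℕ, Y k + j ≠ 0) :
    (∏ j ∈ range (N+1), (x + y + a + j)) / (∏ j ∈ range (N+1), ((x + j) * (y + j)))
     = 1 / (∏ j ∈ range (N+1), (lam + j)) + ∑ k ∈ range (N+1),
      (∏ j ∈ range (N+1), (Y k - k + a + j)) /
        ((∏ j ∈ (range (N+1)).erase k, ((j:ℂ) - k)) * ∏ j ∈ range (N+1), (Y k + j))
        * (1/(x+k) + 1/(y+k) - 1/(lam+k)) := by
  set s := range (N+1) with hs
  set v : ℕ → ℂ := fun k => Y k - k with hv
  have hvv : ∀ k j, v k - v j = ((j:ℂ) - k) * (Y k + j) / (lam + j) := by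
    intro k j
    have h1 := hl k
    have h2 := hl j
    simp only [hv, hY]
    field_simp
    ring
  have hsv : ∀ k : ℕ, (x + y) - v k = (x + k) * (y + k) / (lam + k) := by
    intro k
    have h1 := hl k
    simp only [hv, hY]
    field_simp
    ring
  have hinj : Set.InjOn v s := by
    intro i _ j _ hij
    by_contra hne
    have h := hvv i j
    rw [hij, sub_self] at h
    have h3 : ((j:ℂ) - i) ≠ 0 := sub_ne_zero.2 (fun h => hne (by exact_mod_cast h.symm))
    exact (div_ne_zero (mul_ne_zero h3 (hYj i j)) (hl j)) h.symm
  set P : Polynomial ℂ := ∏ j ∈ s, (Polynomial.X + Polynomial.C (a + j)) with hP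
  have hPm : P.Monic := Polynomial.monic_prod_of_monic _ _ (fun j _ => Polynomial.monic_X_add_C _)
  have hPd : P.degree = s.card := by
    rw [hP, Polynomial.degree_prod]
    simp only [Polynomial.degree_X_add_C]
    simp
  have hPe : ∀ z, P.eval z = ∏ j ∈ s, (z + a + j) := by
    intro z
    rw [hP, Polynomial.eval_prod]
    apply prod_congr rfl
    intros; simp; ring
  have hdeg : (P - Lagrange.nodal s v).degree < s.card := by
    rw [← hPd]
    apply Polynomial.degree_sub_lt_left
    · rw [hPd, Lagrange.degree_nodal]
    · exact hPm.ne_zero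
    · rw [hPm, (Lagrange.nodal_monic)]
  have hinterp := Lagrange.eq_interpolate_of_eval_eq (r := fun i => P.eval (v i)) (s := s) (v := v)
    hinj hdeg (by
      intro i hi
      simp [Lagrange.eval_nodal_at_node hi])
  have hne : ∀ i ∈ s, x + y ≠ v i := by
    intro i _ h
    have h2 := hsv i
    rw [h, sub_self] at h2
    exact div_ne_zero (mul_ne_zero (hx i) (hy i)) (hl i) h2.symm
  have he := congrArg (Polynomial.eval (x+y)) hinterp
  rw [Lagrange.eval_interpolate_not_at_node _ hne] at he
  rw [Polynomial.eval_sub, hPe, Lagrange.eval_nodal] at he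
  have hL : ∏ j ∈ s, (lam + j) ≠ 0 := prod_ne_zero_iff.2 (fun j _ => hl j)
  have hXY : ∏ j ∈ s, ((x + j) * (y + j)) ≠ 0 :=
    prod_ne_zero_iff.2 (fun j _ => mul_ne_zero (hx j) (hy j))
  have hnod : ∏ i ∈ s, (x + y - v i) = (∏ j ∈ s, ((x + j) * (y + j))) / ∏ j ∈ s, (lam + j) := by
    rw [← prod_div_distrib]
    exact prod_congr rfl (fun i _ => hsv i)
  rw [hnod] at he
  have he2 := eq_add_of_sub_eq he
  rw [he2, add_div, add_comm]
  congr 1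
  · field_simp
  · rw [mul_comm, mul_div_assoc, div_right_comm, div_self hXY, Finset.sum_mul]
    apply sum_congr rfl
    intro k hk
    rw [hPe, hsv]
    have hw : Lagrange.nodalWeight s v k * (∏ j ∈ s, (lam + j))⁻¹ * (Y k + k)⁻¹ * (lam + k)
        = ((∏ j ∈ s.erase k, ((j:ℂ) - k)) * ∏ j ∈ s, (Y k + j))⁻¹ := by
      rw [Lagrange.nodalWeight, ← mul_prod_erase s (fun j => lam + (j:ℂ)) hk,
        ← mul_prod_erase s (fun j => Y k + (j:ℂ)) hk]
      have : ∏ j ∈ s.erase k, (v k - v j)⁻¹ = (∏ j ∈ s.erase k, (lam + j)) /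
         ((∏ j ∈ s.erase k, ((j:ℂ) - k)) * ∏ j ∈ s.erase k, (Y k + j)) := by
        rw [← prod_mul_distrib, ← prod_div_distrib]
        apply prod_congr rfl
        intro j _
        rw [hvv, inv_div]
      rw [this]
      have h1 : ∏ j ∈ s.erase k, (lam + j) ≠ 0 := prod_ne_zero_iff.2 (fun j _ => hl j)
      have h2 := hl k
      field_simp
    have hw2 : (1/(x+k) + 1/(y+k) - 1/(lam+k)) = (Y k + k) / ((x+k)*(y+k)) := by
      have h1 := hl k
      have h2 := hx k
      have h3 := hy k
      rw [hY]
      field_simp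
      ring
    rw [div_eq_mul_inv (∏ j ∈ s, (Y k - k + a + j)), ← hw, hw2, inv_div]
    have h1 := hYj k k
    have h2 := hx k
    have h3 := hy k
    simp only [hv]
    field_simp

lemma tendsto_shift (z : ℂ) : Tendsto (fun N : ℕ => (z + N) / ((N:ℂ) + 1)) atTop (𝓝 1) := by
  have h : Tendsto (fun N : ℕ => (z - 1) * (1 / ((N:ℂ) + 1)) + 1) atTop (𝓝 ((z-1) * 0 + 1)) :=
    (tendsto_one_div_add_atTop_nhds_zero_nat.const_mul _).add_const _
  simp only [mul_zero, zero_add] at h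
  refine h.congr ?_
  intro N
  have : (N:ℂ) + 1 ≠ 0 := Nat.cast_add_one_ne_zero N
  field_simp
  ring

lemma tendsto_shift_inv (z : ℂ) : Tendsto (fun N : ℕ => ((N:ℂ) + 1) / (z + N)) atTop (𝓝 1) := by
  have := (tendsto_shift z).inv₀ one_ne_zero
  simpa using this

lemma eventually_ne (z : ℂ) : ∀ᶠ N : ℕ in atTop, z + N ≠ 0 := by
  filter_upwards [(tendsto_shift z).eventually_ne one_ne_zero] with N hN h
  simp [h] at hN

lemma fact_lim (k : ℕ) : Tendsto (fun N : ℕ => (N.factorial : ℂ) / ((N - k).factorial * ((N:ℂ)+1)^k))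
    atTop (𝓝 1) := by
  induction k with
  | zero =>
    refine tendsto_const_nhds.congr ?_
    intro N
    have : (N.factorial : ℂ) ≠ 0 := by exact_mod_cast N.factorial_ne_zero
    simp [this]
  | succ k ih =>
    have := ih.mul (tendsto_shift (-(k:ℂ)))
    rw [one_mul] at this
    refine this.congr' ?_
    filter_upwards [eventually_ge_atTop (k+1)] with N hN
    obtain ⟨d, rfl⟩ := Nat.exists_eq_add_of_le hN
    rw [show k + 1 + d - k = d + 1 by omega, show k + 1 + d - (k+1) = d by omega, Nat.factorial_succ d]
    have h1 : ((k + 1 + d : ℕ) : ℂ) + 1 ≠ 0 := Nat.cast_add_one_ne_zero _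
    have h2 : (d:ℂ) + 1 ≠ 0 := Nat.cast_add_one_ne_zero _
    have h3 : (d.factorial : ℂ) ≠ 0 := by exact_mod_cast d.factorial_ne_zero
    have h4 : -(k:ℂ) + ((k + 1 + d : ℕ) : ℂ) = d + 1 := by push_cast; ring
    rw [h4, pow_succ]
    push_cast at h1 ⊢
    field_simp

lemma gpoch_succ (z : ℂ) (p : ℕ) : gpoch z ((p:ℤ) + 1) = gpoch z p * (z + p) := by
  unfold gpoch
  rw [if_pos (by omega), if_pos (by omega)]
  rw [show ((p:ℤ)+1).toNat = p + 1 by omega, Int.toNat_natCast, prod_range_succ]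

lemma gpoch_pred (z : ℂ) (p : ℕ) : gpoch z (-(p:ℤ) - 1) = gpoch z (-p) * (z - 1 - p)⁻¹ := by
  unfold gpoch
  rw [if_neg (by omega)]
  rw [show (-(-(p:ℤ)-1)).toNat = p + 1 by omega, prod_range_succ, mul_inv]
  rcases Nat.eq_zero_or_pos p with rfl | hp
  · simp
  · rw [if_neg (by omega)]
    simp

lemma prod_shift (z : ℂ) (N : ℕ) :
    (∏ j ∈ range N, (z + j)) * (z + N) = z * ∏ j ∈ range N, (z + 1 + j) := by
  rw [← prod_range_succ, prod_range_succ', mul_comm]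
  simp only [Nat.cast_zero, add_zero]
  congr 1
  apply prod_congr rfl
  intros
  push_cast; ring

lemma ratio_lim (Y : ℂ) (hY : ∀ j : ℕ, Y + j ≠ 0) (p : ℤ) :
    Tendsto (fun N : ℕ => ((N:ℂ)+1)^p * (∏ j ∈ range (N+1), (Y - p + j)) / ∏ j ∈ range (N+1), (Y + j))
      atTop (𝓝 ((-1)^p * gpoch (1 - Y) p)) := by
  have hne : ∀ N, ∏ j ∈ range N, (Y + j) ≠ 0 := fun N => prod_ne_zero_iff.2 (fun j _ => hY j)
  induction p using Int.induction_on with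
  | zero =>
    have : (-1:ℂ)^(0:ℤ) * gpoch (1 - Y) 0 = 1 := by simp [gpoch]
    rw [this]
    refine tendsto_const_nhds.congr ?_
    intro N
    simp [div_self (hne _)]
  | succ p ih =>
    have h := (ih.mul_const (Y - p - 1)).mul (tendsto_shift_inv (Y - p))
    have e : (-1:ℂ)^((p:ℤ)+1) * gpoch (1 - Y) ((p:ℤ)+1)
        = (-1)^(p:ℤ) * gpoch (1 - Y) p * (Y - p - 1) * 1 := by
      rw [gpoch_succ, zpow_add₀ (by norm_num)]; simp; ring
    rw [e]
    refine h.congr' ?_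
    filter_upwards [eventually_ne (Y - p)] with N hN
    have h0 : (N:ℂ) + 1 ≠ 0 := Nat.cast_add_one_ne_zero _
    have hs := prod_shift (Y - p - 1) (N+1)
    simp only [sub_add_cancel] at hs
    have hs2 : ∏ j ∈ range (N+1), (Y - p - 1 + j) = (Y - p - 1) * (∏ j ∈ range (N+1), (Y - p + j)) / (Y - p + N) := by
      rw [eq_div_iff hN, ← hs]; push_cast; ring
    have e2 : ∀ j : ℕ, Y - (((p:ℤ)+1 : ℤ):ℂ) + j = Y - p - 1 + j := by intro j; push_cast; ring
    simp only [e2, hs2, zpow_add₀ h0, zpow_one, Int.cast_natCast]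
    have := hne (N+1)
    field_simp
  | pred p ih =>
    have hp : Y + p ≠ 0 := hY p
    have h := (ih.mul_const (Y + p)⁻¹).mul (tendsto_shift (Y + p + 1))
    have e : (-1:ℂ)^(-(p:ℤ)-1) * gpoch (1 - Y) (-(p:ℤ)-1)
        = (-1)^(-(p:ℤ)) * gpoch (1 - Y) (-p) * (Y + p)⁻¹ * 1 := by
      rw [gpoch_pred, zpow_sub₀ (by norm_num), show (1 - Y - 1 - p) = -(Y + p) by ring, inv_neg]; simp; ring
    rw [e]
    refine h.congr' ?_
    filter_upwards with N
    have h0 : (N:ℂ) + 1 ≠ 0 := Nat.cast_add_one_ne_zero _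
    have hs := prod_shift (Y + p) (N+1)
    have hs2 : ∏ j ∈ range (N+1), (Y + p + 1 + j) = (∏ j ∈ range (N+1), (Y + p + j)) * (Y + p + 1 + N) / (Y + p) := by
      rw [eq_div_iff hp, mul_comm, ← hs]; push_cast; ring
    have e2 : ∀ j : ℕ, Y - ((-(p:ℤ)-1 : ℤ):ℂ) + j = Y + p + 1 + j := by intro j; push_cast; ring
    have e3 : ∀ j : ℕ, Y - ((-(p:ℤ) : ℤ):ℂ) + j = Y + p + j := by intro j; push_cast; ring
    simp only [e2, e3, hs2, zpow_sub₀ h0, zpow_one]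
    have := hne (N+1)
    field_simp

lemma term_lim (Y : ℂ) (hY : ∀ j : ℕ, Y + j ≠ 0) (a : ℤ) (k : ℕ) :
    Tendsto (fun N : ℕ => (N.factorial : ℂ) * ((N:ℂ)+1)^(-a) *
      ((∏ j ∈ range (N+1), (Y - k + a + j)) /
        (((-1)^k * k.factorial * (N-k).factorial) * ∏ j ∈ range (N+1), (Y + j))))
      atTop (𝓝 ((-1)^a * (1 / (k.factorial : ℂ) * gpoch (1 - Y) ((k:ℤ) - a)))) := by
  have h := ((ratio_lim Y hY ((k:ℤ) - a)).mul (fact_lim k)).mul_const ((-1)^k / (k.factorial : ℂ))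
  have hk : (k.factorial : ℂ) ≠ 0 := by exact_mod_cast k.factorial_ne_zero
  have e : (-1:ℂ)^((k:ℤ) - a) * gpoch (1 - Y) ((k:ℤ) - a) * 1 * ((-1)^k / (k.factorial : ℂ))
     = (-1)^a * (1 / (k.factorial : ℂ) * gpoch (1 - Y) ((k:ℤ) - a)) := by
    have : (-1:ℂ)^((k:ℤ) - a) * (-1)^k = (-1)^a := by
      rw [← zpow_natCast, ← zpow_add₀ (by norm_num)]
      rcases Int.even_or_odd a with ha | ha
      · rw [ha.neg_one_zpow, Even.neg_one_zpow]
        rw [show (k:ℤ) - a + k = 2 * k - a by ring]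
        exact (even_two_mul _).sub ha
      · rw [ha.neg_one_zpow, Odd.neg_one_zpow]
        rw [show (k:ℤ) - a + k = 2 * k - a by ring]
        exact (even_two_mul _).sub_odd ha
    rw [← this]; ring
  rw [e] at h
  refine h.congr ?_
  intro N
  have h0 : (N:ℂ) + 1 ≠ 0 := Nat.cast_add_one_ne_zero _
  have h1 : ((-1:ℂ))^k * (-1)^k = 1 := by rw [← mul_pow]; simp
  have h2 : ((-1:ℂ))^k ≠ 0 := pow_ne_zero _ (by norm_num)
  have e2 : ∀ j : ℕ, Y - (((k:ℤ) - a : ℤ):ℂ) + j = Y - k + a + j := by intro j; push_cast; ring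
  have h3 : ∏ j ∈ range (N+1), (Y + j) ≠ 0 := prod_ne_zero_iff.2 (fun j _ => hY j)
  have h4 : ((N-k).factorial : ℂ) ≠ 0 := by exact_mod_cast (N-k).factorial_ne_zero
  simp only [e2]
  simp only [sub_eq_add_neg (k:ℤ) a, zpow_add₀ h0, zpow_natCast]
  field_simp
  linear_combination (N.factorial : ℂ) * (∏ j ∈ range (N+1), (Y - k + a + j)) * h1

lemma lhs_lim (x y : ℂ) (a : ℤ) (hx : ∀ j : ℕ, x + j ≠ 0) (hy : ∀ j : ℕ, y + j ≠ 0)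
    (hs : ∀ j : ℕ, x + y + a + j ≠ 0) :
    Tendsto (fun N : ℕ => (N.factorial : ℂ) * ((N:ℂ)+1)^(-a) *
     ((∏ j ∈ range (N+1), (x + y + a + j)) / (∏ j ∈ range (N+1), ((x + j) * (y + j))))) atTop
     (𝓝 (Gamma x * Gamma y / Gamma (x + y + a))) := by
  have hG : Gamma (x + y + a) ≠ 0 := Gamma_ne_zero (fun m h => hs m (by rw [h]; ring))
  have h := (((GammaSeq_tendsto_Gamma x).mul (GammaSeq_tendsto_Gamma y)).div
    (GammaSeq_tendsto_Gamma (x+y+a)) hG).mul ((tendsto_shift 0).zpow₀ a (Or.inl one_ne_zero))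
  rw [one_zpow, mul_one] at h
  refine h.congr' ?_
  filter_upwards [eventually_gt_atTop 0] with N hN
  have hN0 : (N:ℂ) ≠ 0 := by exact_mod_cast hN.ne'
  have h0 : (N:ℂ) + 1 ≠ 0 := Nat.cast_add_one_ne_zero _
  have hp : ∀ z : ℂ, (N:ℂ)^z ≠ 0 := fun z => by simp [cpow_eq_zero_iff, hN0]
  simp only [Pi.div_apply, GammaSeq, prod_mul_distrib, zero_add]
  rw [cpow_add _ _ hN0, cpow_add _ _ hN0, cpow_intCast, div_zpow, zpow_neg]
  have h1 := hp x
  have h2 := hp y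
  have h3 : (N.factorial : ℂ) ≠ 0 := by exact_mod_cast N.factorial_ne_zero
  have h4 : ∏ j ∈ range (N+1), (x + j) ≠ 0 := prod_ne_zero_iff.2 (fun j _ => hx j)
  have h5 : ∏ j ∈ range (N+1), (y + j) ≠ 0 := prod_ne_zero_iff.2 (fun j _ => hy j)
  have h6 : ∏ j ∈ range (N+1), (x + y + a + j) ≠ 0 := prod_ne_zero_iff.2 (fun j _ => hs j)
  have h7 : (N:ℂ)^a ≠ 0 := zpow_ne_zero _ hN0
  have h8 : ((N:ℂ)+1)^a ≠ 0 := zpow_ne_zero _ h0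
  field_simp

lemma const_lim (lam : ℂ) (a : ℤ) (hre : -(a:ℝ) < lam.re) :
    Tendsto (fun N : ℕ => (N.factorial : ℂ) * ((N:ℂ)+1)^(-a) * (1 / (∏ j ∈ range (N+1), (lam + j))))
      atTop (𝓝 0) := by
  have h1 : Tendsto (fun N : ℕ => (N:ℂ)^(-(lam + a))) atTop (𝓝 0) := by
    rw [tendsto_zero_iff_norm_tendsto_zero]
    have h := (tendsto_rpow_neg_atTop (y := lam.re + a) (by linarith)).comp
      (tendsto_natCast_atTop_atTop (R := ℝ))
    refine h.congr' ?_
    filter_upwards [eventually_gt_atTop 0] with N hN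
    rw [Complex.norm_natCast_cpow_of_pos hN]
    simp
  have h := (h1.mul (GammaSeq_tendsto_Gamma lam)).mul ((tendsto_shift 0).zpow₀ a (Or.inl one_ne_zero))
  rw [zero_mul, zero_mul] at h
  refine h.congr' ?_
  filter_upwards [eventually_gt_atTop 0] with N hN
  have hN0 : (N:ℂ) ≠ 0 := by exact_mod_cast hN.ne'
  have h0 : (N:ℂ) + 1 ≠ 0 := Nat.cast_add_one_ne_zero _
  have hp : ∀ z : ℂ, (N:ℂ)^z ≠ 0 := fun z => by simp [cpow_eq_zero_iff, hN0]
  simp only [GammaSeq, zero_add]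
  rw [cpow_neg, cpow_add _ _ hN0, cpow_intCast, div_zpow, zpow_neg]
  have h1 := hp lam
  have h7 : (N:ℂ)^a ≠ 0 := zpow_ne_zero _ hN0
  field_simp

lemma growth (s : ℝ) (hs : ∀ m : ℤ, s ≠ m) (h : ℕ → ℝ) (hpos : ∀ n, 0 < h n) (n0 : ℕ)
    (hrec : ∀ n ≥ n0, h (n+1) = h n * ((n:ℝ) + 1 + s)) :
    ∃ c C : ℝ, 0 < c ∧ 0 < C ∧ ∀ n : ℕ, c * (n.factorial * ((n:ℝ)+1)^s) ≤ h n ∧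
      h n ≤ C * (n.factorial * ((n:ℝ)+1)^s) := by
  set Q : ℕ → ℝ := fun n => ∏ j ∈ range (n+1), (s + j) with hQ
  have hsj : ∀ j : ℕ, s + j ≠ 0 := fun j hj => hs (-j) (by push_cast; linarith)
  have hQ0 : ∀ n, Q n ≠ 0 := fun n => prod_ne_zero_iff.2 (fun j _ => hsj j)
  have hh : ∀ n ≥ n0, h n = h n0 / Q n0 * Q n := by
    intro n hn
    induction n, hn using Nat.le_induction with
    | base => have := hQ0 n0; field_simp
    | succ n hn ih =>
      rw [hrec n hn, ih]
      simp only [hQ]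
      rw [prod_range_succ _ (n+1)]
      push_cast; ring
  have hd : ∀ n : ℕ, 0 < (n.factorial * ((n:ℝ)+1)^s) := fun n => by positivity
  set f : ℕ → ℝ := fun n => h n / (n.factorial * ((n:ℝ)+1)^s) with hf
  have hfpos : ∀ n, 0 < f n := fun n => div_pos (hpos n) (hd n)
  have hG : Real.Gamma s ≠ 0 := Real.Gamma_ne_zero (fun m hm => hs (-m) (by push_cast; exact hm))
  have h1 : Tendsto (fun n : ℕ => ((n:ℝ)/((n:ℝ)+1))^s) atTop (𝓝 1) := by
    have := (tendsto_natCast_div_add_atTop (1:ℝ)).rpow_const (p := s) (Or.inl one_ne_zero)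
    simpa using this
  have hlim : Tendsto f atTop (𝓝 (h n0 / Q n0 * (Real.Gamma s)⁻¹ * 1)) := by
    refine ((((Real.GammaSeq_tendsto_Gamma s).inv₀ hG).const_mul _).mul h1).congr' ?_
    filter_upwards [eventually_ge_atTop n0, eventually_gt_atTop 0] with n hn hn0
    have hn1 : (0:ℝ) < n := by exact_mod_cast hn0
    have e1 : (0:ℝ) < (n:ℝ)^s := by positivity
    have e2 : (0:ℝ) < ((n:ℝ)+1)^s := by positivity
    simp only [hf, hh n hn, Real.GammaSeq]
    rw [Real.div_rpow (by positivity) (by positivity)]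
    have := hQ0 n
    have h3 : ∏ j ∈ range (n+1), (s + j) = Q n := rfl
    rw [h3]
    field_simp
  have hL : h n0 / Q n0 * (Real.Gamma s)⁻¹ * 1 ≠ 0 := by
    have := hQ0 n0
    have := (hpos n0).ne'
    simp; tauto
  obtain ⟨C, hC⟩ := hlim.bddAbove_range
  obtain ⟨D, hD⟩ := (hlim.inv₀ hL).bddAbove_range
  have hC' : ∀ n, f n ≤ C := fun n => hC ⟨n, rfl⟩
  have hD' : ∀ n, (f n)⁻¹ ≤ D := fun n => hD ⟨n, rfl⟩
  have hDp : 0 < D := (inv_pos.2 (hfpos 0)).trans_le (hD' 0)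
  refine ⟨D⁻¹, C, inv_pos.2 hDp, (hfpos 0).trans_le (hC' 0), fun n => ⟨?_, ?_⟩⟩
  · rw [← le_div_iff₀ (hd n)]
    exact inv_le_of_inv_le₀ (hfpos n) (hD' n)
  · rw [← div_le_iff₀ (hd n)]
    exact hC' n

lemma comparators (Y : ℕ → ℂ) (lam : ℂ) (hY : Tendsto Y atTop (𝓝 lam)) (hl : ∀ j : ℕ, lam + j ≠ 0)
    (ρ : ℝ) (hρ : ρ < lam.re) : ∃ (κ e : ℕ → ℝ) (I0 K0 : ℕ), (∀ i, 0 < κ i) ∧ (∀ i, 1 ≤ e i) ∧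
      (∀ i ≥ I0, κ i = i + ρ ∧ e i = i - ρ) ∧
      ∀ k ≥ K0, ∀ i : ℕ, κ i ≤ ‖Y k + i‖ ∧ ‖Y k - i‖ ≤ e i := by
  obtain ⟨ρ', h1, h2⟩ := exists_between hρ
  set B := ‖lam‖ + 1 with hB
  have hBp : 0 < B := by positivity
  have hre : Tendsto (fun k => (Y k).re) atTop (𝓝 lam.re) :=
    (Complex.continuous_re.tendsto _).comp hY
  have ev1 : ∀ᶠ k in atTop, ρ' < (Y k).re := hre.eventually_const_lt h2
  have ev2 : ∀ᶠ k in atTop, ‖Y k‖ < B := hY.norm.eventually_lt_const (by linarith)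
  obtain ⟨I0, hI0⟩ := exists_nat_ge (|ρ| + 1 + |ρ| + B + B^2 / (ρ' - ρ))
  have hdd : 0 < ρ' - ρ := by linarith
  have hq : 0 < B^2/(ρ' - ρ) := by positivity
  have ev3 : ∀ᶠ k in atTop, ∀ i ∈ range I0, ‖lam + i‖/2 < ‖Y k + i‖ := by
    rw [eventually_all_finset]
    intro i _
    refine (hY.add_const (i:ℂ)).norm.eventually_const_lt ?_
    have := norm_pos_iff.2 (hl i)
    linarith
  obtain ⟨K0, hK0⟩ := eventually_atTop.1 (ev1.and (ev2.and ev3))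
  refine ⟨fun i => if i < I0 then ‖lam + i‖/2 else i + ρ, fun i => if i < I0 then B + I0 + 1 else i - ρ,
    I0, K0, ?_, ?_, ?_, ?_⟩
  · intro i
    dsimp only
    split_ifs with h
    · have := norm_pos_iff.2 (hl i)
      linarith
    · have : (I0:ℝ) ≤ i := by exact_mod_cast not_lt.1 h
      have := neg_abs_le ρ
      have := abs_nonneg ρ
      linarith
  · intro i
    dsimp only
    split_ifs with h
    · have : (0:ℝ) ≤ I0 := by positivity
      linarith
    · have : (I0:ℝ) ≤ i := by exact_mod_cast not_lt.1 h
      have := le_abs_self ρ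
      have := abs_nonneg ρ
      linarith
  · intro i hi
    simp [not_lt.2 hi]
  · intro k hk i
    obtain ⟨g1, g2, g3⟩ := hK0 k hk
    dsimp only
    split_ifs with h
    · refine ⟨(g3 i (mem_range.2 h)).le, ?_⟩
      have : (i:ℝ) ≤ I0 := by exact_mod_cast h.le
      have h4 := norm_sub_le (Y k) (i:ℂ)
      rw [Complex.norm_natCast] at h4
      linarith
    · have hi : (I0:ℝ) ≤ i := by exact_mod_cast not_lt.1 h
      have a1 := le_abs_self ρ
      have a2 := abs_nonneg ρ
      constructor
      · have := Complex.re_le_norm (Y k + i)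
        simp at this
        linarith
      · have hn : 0 ≤ (i:ℝ) - ρ := by linarith
        have hr : (Y k).re ≤ B := (Complex.re_le_norm _).trans g2.le
        have him : (Y k).im^2 ≤ B^2 := by
          rw [sq_le_sq]
          have := Complex.abs_im_le_norm (Y k)
          rw [abs_of_pos hBp]
          linarith
        refine (sq_le_sq₀ (norm_nonneg _) hn).1 ?_
        rw [← Complex.normSq_eq_norm_sq, Complex.normSq_apply]
        simp only [sub_re, natCast_re, sub_im, natCast_im, sub_zero]
        have key : B^2 ≤ ((Y k).re - ρ) * (2 * i - ρ - (Y k).re) := by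
          have : B^2 = (ρ' - ρ) * (B^2/(ρ' - ρ)) := by field_simp
          rw [this]
          apply mul_le_mul
          · linarith
          · linarith
          · exact hq.le
          · linarith
        nlinarith

lemma num_bound (Y : ℂ) (e : ℕ → ℝ) (he : ∀ i, 1 ≤ e i) (hY : ∀ i : ℕ, ‖Y - i‖ ≤ e i) (p : ℕ) :
    ∀ M : ℕ, ∏ j ∈ range M, ‖Y - p + j‖ ≤ (∏ i ∈ range p, e (i+1)) * ∏ i ∈ range (M - p), ‖Y + i‖ := by
  induction p with
  | zero => intro M; simp
  | succ p ih =>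
    intro M
    cases M with
    | zero =>
      simp only [range_zero, prod_empty, Nat.zero_sub, mul_one]
      have := prod_le_prod (s := range (p+1)) (f := fun _ => (1:ℝ)) (g := fun i => e (i+1))
        (fun i _ => zero_le_one) (fun i _ => he (i+1))
      simpa using this
    | succ M =>
      rw [prod_range_succ', prod_range_succ, Nat.add_sub_add_right]
      have h1 : ∏ j ∈ range M, ‖Y - ((p+1:ℕ):ℂ) + ((j+1:ℕ):ℂ)‖ = ∏ j ∈ range M, ‖Y - p + j‖ := by
        apply prod_congr rfl
        intro j _
        congr 1
        push_cast; ring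
      have h2 := hY (p+1)
      rw [h1]
      simp only [Nat.cast_zero, add_zero]
      have h3 := mul_le_mul (ih M) h2 (norm_nonneg _) (by
        apply mul_nonneg
        · exact prod_nonneg (fun i _ => zero_le_one.trans (he _))
        · exact prod_nonneg (fun i _ => norm_nonneg _))
      linarith

lemma ratio_bound (u κ : ℕ → ℝ) (hκ : ∀ i, 0 < κ i) (h : ∀ i, κ i ≤ u i) (q M : ℕ) (hq : q ≤ M) :
    (∏ i ∈ range q, u i) * ∏ i ∈ range M, κ i ≤ (∏ i ∈ range q, κ i) * ∏ i ∈ range M, u i := by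
  rw [← prod_range_mul_prod_Ico _ hq, ← prod_range_mul_prod_Ico u hq]
  have h1 : ∏ i ∈ Ico q M, κ i ≤ ∏ i ∈ Ico q M, u i :=
    prod_le_prod (fun i _ => (hκ i).le) (fun i _ => h i)
  have h2 : 0 ≤ ∏ i ∈ range q, κ i := prod_nonneg (fun i _ => (hκ i).le)
  have h3 : 0 ≤ ∏ i ∈ range q, u i := prod_nonneg (fun i _ => (hκ i).le.trans (h i))
  have := mul_le_mul_of_nonneg_left h1 (mul_nonneg h2 h3)
  linarith

lemma term_bound (Y : ℕ → ℂ) (lam : ℂ) (hY : Tendsto Y atTop (𝓝 lam)) (hl : ∀ j : ℕ, lam + j ≠ 0)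
    (a : ℤ) (σ : ℝ) (h0 : 0 < σ) (h1 : σ < 1) (hσ : σ - a < lam.re) :
    ∃ (C : ℝ) (K0 : ℕ), 0 < C ∧ ∀ k ≥ K0, ∀ N ≥ k, ‖(N.factorial : ℂ) * ((N:ℂ)+1)^(-a) *
      ((∏ j ∈ range (N+1), (Y k - k + a + j)) /
        (((-1)^k * k.factorial * (N-k).factorial) * ∏ j ∈ range (N+1), (Y k + j)))‖
      ≤ C * ((k:ℝ)+1)^(-σ) := by
  obtain ⟨κ, e, I0, K0, hκ, he, hI, hK⟩ := comparators Y lam hY hl (σ - a) hσ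
  have nonint : ∀ m : ℤ, σ ≠ m := by
    intro m hm
    rw [hm] at h0 h1
    have : 0 < m := by exact_mod_cast h0
    have : m < 1 := by exact_mod_cast h1
    omega
  obtain ⟨_, C1, _, hC1, hE⟩ := growth (-σ) (fun m hm => nonint (-m) (by push_cast; linarith))
    (fun n => ∏ i ∈ range ((n:ℤ) - a).toNat, e (i+1))
    (fun n => prod_pos (fun i _ => zero_lt_one.trans_le (he _))) (I0 + a.natAbs) (by
      intro n hn
      have : (((n+1:ℕ):ℤ) - a).toNat = ((n:ℤ)-a).toNat + 1 := by omega
      rw [this, prod_range_succ, (hI _ (by omega)).2]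
      congr 1
      have h3 : ((((n:ℤ)-a).toNat : ℕ) : ℤ) = n - a := by omega
      have h4 : ((((n:ℤ)-a).toNat : ℕ) : ℝ) = n - a := by exact_mod_cast h3
      push_cast
      rw [h4]; ring)
  obtain ⟨_, C2, _, hC2, hD⟩ := growth σ nonint
    (fun n => ∏ i ∈ range ((n:ℤ) + 1 + a).toNat, κ i)
    (fun n => prod_pos (fun i _ => hκ _)) (I0 + a.natAbs) (by
      intro n hn
      have : (((n+1:ℕ):ℤ) + 1 + a).toNat = ((n:ℤ) + 1 + a).toNat + 1 := by omega
      rw [this, prod_range_succ, (hI _ (by omega)).1]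
      congr 1
      have h3 : ((((n:ℤ) + 1 + a).toNat : ℕ) : ℤ) = n + 1 + a := by omega
      have h4 : ((((n:ℤ) + 1 + a).toNat : ℕ) : ℝ) = n + 1 + a := by exact_mod_cast h3
      rw [h4]; ring)
  obtain ⟨c, _, hc, _, hF⟩ := growth (σ - a) (fun m hm => nonint (m + a) (by push_cast; linarith))
    (fun n => ∏ i ∈ range (n+1), κ i)
    (fun n => prod_pos (fun i _ => hκ _)) I0 (by
      intro n hn
      rw [prod_range_succ _ (n+1), (hI _ (by omega)).1]
      push_cast; ring)
  refine ⟨C1 * C2 / c, K0 + a.natAbs, by positivity, ?_⟩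
  intro k hk N hN
  have hK' := hK k (by omega)
  set p := ((k:ℤ) - a).toNat with hp
  have hp3 : (p:ℤ) = k - a := by omega
  have hp4 : (p:ℂ) = k - a := by exact_mod_cast hp3
  have hA := num_bound (Y k) e he (fun i => (hK' i).2) p (N+1)
  have hR := ratio_bound (fun i => ‖Y k + i‖) κ hκ (fun i => (hK' i).1) (N+1-p) (N+1) (by omega)
  have hE' := (hE k).2
  have hD' := (hD (N-k)).2
  have hF' := (hF N).1
  have hq : (((N-k:ℕ):ℤ) + 1 + a).toNat = N + 1 - p := by omega
  simp only [hq, ← hp] at hE' hD' hF'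
  have hnorm : ‖(N.factorial : ℂ) * ((N:ℂ)+1)^(-a) *
      ((∏ j ∈ range (N+1), (Y k - k + a + j)) /
        (((-1)^k * k.factorial * (N-k).factorial) * ∏ j ∈ range (N+1), (Y k + j)))‖
      = (N.factorial : ℝ) * ((N:ℝ)+1)^(-(a:ℝ)) * ((∏ j ∈ range (N+1), ‖Y k - p + j‖) /
        ((k.factorial * (N-k).factorial) * ∏ j ∈ range (N+1), ‖Y k + j‖)) := by
    have e1 : ‖(N:ℂ)+1‖ = (N:ℝ)+1 := by
      have := Complex.norm_natCast (N+1)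
      push_cast at this
      exact this
    have e2 : ∀ j : ℕ, Y k - k + a + j = Y k - p + j := by intro j; rw [hp4]; ring
    have e3 : ((N:ℝ)+1)^(-(a:ℝ)) = ((N:ℝ)+1)^(-a) := by
      rw [← Real.rpow_intCast]; push_cast; rfl
    simp only [e2, e3]
    simp [e1, norm_prod]
  rw [hnorm]
  set A := ∏ j ∈ range (N+1), ‖Y k - p + j‖
  set Bq := ∏ i ∈ range (N+1-p), ‖Y k + i‖
  set B := ∏ i ∈ range (N+1), ‖Y k + i‖
  set Dq := ∏ i ∈ range (N+1-p), κ i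
  set DN := ∏ i ∈ range (N+1), κ i
  set E := ∏ i ∈ range p, e (i+1)
  have hBp : 0 < B := prod_pos (fun i _ => (hκ i).trans_le (hK' i).1)
  have hDNp : 0 < DN := prod_pos (fun i _ => hκ i)
  have hEp : 0 < E := prod_pos (fun i _ => zero_lt_one.trans_le (he _))
  have hDqp : 0 < Dq := prod_pos (fun i _ => hκ i)
  have hAB : A / B ≤ E * Dq / DN := by
    rw [div_le_div_iff₀ hBp hDNp]
    calc A * DN ≤ E * Bq * DN := by gcongr
      _ = E * (Bq * DN) := by ring
      _ ≤ E * (Dq * B) := by gcongr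
      _ = _ := by ring
  have fN : (0:ℝ) < N.factorial := by positivity
  have fk : (0:ℝ) < k.factorial := by positivity
  have fd : (0:ℝ) < (N-k).factorial := by positivity
  have pN : (0:ℝ) < (N:ℝ)+1 := by positivity
  have hdpos : (0:ℝ) < ((N-k:ℕ):ℝ) + 1 := by positivity
  have r1 : (((N-k:ℕ):ℝ)+1)^σ ≤ ((N:ℝ)+1)^σ := by
    apply Real.rpow_le_rpow hdpos.le _ h0.le
    have : ((N-k:ℕ):ℝ) ≤ N := by exact_mod_cast Nat.sub_le _ _
    linarith
  have r2 : ((N:ℝ)+1)^(σ - a) = ((N:ℝ)+1)^σ * ((N:ℝ)+1)^(-(a:ℝ)) := by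
    rw [← Real.rpow_add pN]; rfl
  have pa : 0 < ((N:ℝ)+1)^(-(a:ℝ)) := by positivity
  have ps : 0 < ((N:ℝ)+1)^σ := by positivity
  rw [r2] at hF'
  calc _ = (N.factorial : ℝ) * ((N:ℝ)+1)^(-(a:ℝ)) / (k.factorial * (N-k).factorial) * (A / B) := by
        field_simp
    _ ≤ (N.factorial : ℝ) * ((N:ℝ)+1)^(-(a:ℝ)) / (k.factorial * (N-k).factorial) * (E * Dq / DN) := by
        gcongr
    _ ≤ (N.factorial : ℝ) * ((N:ℝ)+1)^(-(a:ℝ)) / (k.factorial * (N-k).factorial) *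
      ((C1 * (k.factorial * ((k:ℝ)+1)^(-σ))) * (C2 * ((N-k).factorial * ((N:ℝ)+1)^σ)) /
        (c * (N.factorial * (((N:ℝ)+1)^σ * ((N:ℝ)+1)^(-(a:ℝ)))))) := by
        have hD2 : Dq ≤ C2 * ((N-k).factorial * ((N:ℝ)+1)^σ) := hD'.trans (by gcongr)
        gcongr
    _ = _ := by field_simp

lemma general (x y lam : ℂ) (a : ℤ) (hre : -(a : ℝ) < lam.re) (Y : ℕ → ℂ)
    (hY : ∀ k, Y k = lam - (lam - x) * (lam - y) / (lam + k))
    (hx : ∀ j : ℕ, x + j ≠ 0) (hy : ∀ j : ℕ, y + j ≠ 0) (hl : ∀ j : ℕ, lam + j ≠ 0)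
    (hs : ∀ j : ℕ, x + y + a + j ≠ 0)
    (hYj : ∀ k j : ℕ, Y k + j ≠ 0) :
    Tendsto (fun N : ℕ => ∑ k ∈ range N, (1 / (k.factorial : ℂ)) * gpoch (1 - Y k) ((k:ℤ) - a) *
      (1/(x+k) + 1/(y+k) - 1/(lam+k))) atTop (𝓝 ((-1)^a * (Gamma x * Gamma y / Gamma (x+y+a)))) := by
  have hinv : ∀ z : ℂ, Tendsto (fun k : ℕ => 1 / (z + k)) atTop (𝓝 0) := by
    intro z
    have h := (tendsto_shift_inv z).mul (tendsto_one_div_add_atTop_nhds_zero_nat (𝕜 := ℂ))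
    rw [one_mul] at h
    refine h.congr ?_
    intro k
    have : (k:ℂ) + 1 ≠ 0 := Nat.cast_add_one_ne_zero _
    field_simp
  have hYlim : Tendsto Y atTop (𝓝 lam) := by
    have h := ((hinv lam).const_mul ((lam - x) * (lam - y))).const_sub lam
    rw [mul_zero, sub_zero] at h
    refine h.congr ?_
    intro k
    rw [hY]; ring
  set w : ℕ → ℂ := fun k => 1/(x+k) + 1/(y+k) - 1/(lam+k) with hw
  have hwb : ∃ W : ℝ, 0 < W ∧ ∀ k : ℕ, ‖w k‖ ≤ W * ((k:ℝ)+1)⁻¹ := by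
    have h : Tendsto (fun k : ℕ => w k * ((k:ℂ)+1)) atTop (𝓝 (1 + 1 - 1)) := by
      refine (((tendsto_shift_inv x).add (tendsto_shift_inv y)).sub (tendsto_shift_inv lam)).congr ?_
      intro k
      simp only [hw]; ring
    obtain ⟨W, hW⟩ := h.norm.bddAbove_range
    refine ⟨max W 1, by positivity, fun k => ?_⟩
    have h2 : ‖w k * ((k:ℂ)+1)‖ ≤ W := hW ⟨k, rfl⟩
    have e1 : ‖(k:ℂ)+1‖ = (k:ℝ)+1 := by
      have := Complex.norm_natCast (k+1)
      push_cast at this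
      exact this
    rw [norm_mul, e1] at h2
    rw [← div_eq_mul_inv, le_div_iff₀ (by positivity)]
    exact h2.trans (le_max_left _ _)
  obtain ⟨W, hWp, hW⟩ := hwb
  obtain ⟨σ, hσ0, hσ⟩ := exists_between (show (0:ℝ) < min 1 (lam.re + a) from lt_min one_pos (by linarith))
  have hσ1 : σ < 1 := hσ.trans_le (min_le_left _ _)
  have hσ2 : σ - a < lam.re := by
    have := hσ.trans_le (min_le_right _ _)
    linarith
  obtain ⟨C, K0, hC, hbd⟩ := term_bound Y lam hYlim hl a σ hσ0 hσ1 hσ2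
  set T : ℕ → ℕ → ℂ := fun N k => (N.factorial : ℂ) * ((N:ℂ)+1)^(-a) *
      ((∏ j ∈ range (N+1), (Y k - k + a + j)) /
        (((-1)^k * k.factorial * (N-k).factorial) * ∏ j ∈ range (N+1), (Y k + j))) with hT
  set f : ℕ → ℕ → ℂ := fun N k => if k ≤ N then T N k * w k else 0 with hf
  set g : ℕ → ℂ := fun k => (-1)^a * ((1 / (k.factorial : ℂ)) * gpoch (1 - Y k) ((k:ℤ) - a) * w k) with hg
  have hfg : ∀ k, Tendsto (fun N => f N k) atTop (𝓝 (g k)) := by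
    intro k
    have h := (term_lim (Y k) (hYj k) a k).mul_const (w k)
    have e : (-1:ℂ)^a * (1 / (k.factorial : ℂ) * gpoch (1 - Y k) ((k:ℤ) - a)) * w k = g k := by
      simp only [hg]; ring
    rw [e] at h
    refine h.congr' ?_
    filter_upwards [eventually_ge_atTop k] with N hN
    simp only [hf, if_pos hN, hT]
  set bound : ℕ → ℝ := fun k => if k < K0 then ‖g k‖ + 1 else C * W * (((k+1:ℕ):ℝ)^(σ+1))⁻¹ with hbound
  have hbs : Summable bound := by
    have h1 : Summable (fun k : ℕ => C * W * (((k+1:ℕ):ℝ)^(σ+1))⁻¹) :=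
      ((summable_nat_add_iff 1).2 (Real.summable_nat_rpow_inv.2 (by linarith))).mul_left _
    rw [← summable_nat_add_iff K0]
    refine ((summable_nat_add_iff K0).2 h1).congr ?_
    intro k
    simp [hbound]
  have hfb : ∀ᶠ N in atTop, ∀ k, ‖f N k‖ ≤ bound k := by
    have h1 : ∀ᶠ N in atTop, ∀ k ∈ range K0, ‖f N k‖ < ‖g k‖ + 1 := by
      rw [eventually_all_finset]
      intro k _
      exact (hfg k).norm.eventually_lt_const (by linarith)
    filter_upwards [h1] with N hN k
    simp only [hbound]
    split_ifs with hk
    · exact (hN k (mem_range.2 hk)).le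
    · simp only [hf]
      split_ifs with hkN
      · rw [norm_mul]
        have b1 : ‖T N k‖ ≤ C * ((k:ℝ)+1)^(-σ) := hbd k (not_lt.1 hk) N hkN
        have b2 := hW k
        calc _ ≤ (C * ((k:ℝ)+1)^(-σ)) * (W * ((k:ℝ)+1)⁻¹) := by gcongr
          _ = _ := by
            have : (0:ℝ) < (k:ℝ)+1 := by positivity
            push_cast
            rw [Real.rpow_add this, Real.rpow_neg this.le, Real.rpow_one, mul_inv]
            ring
      · rw [norm_zero]; positivity
  have hgb : ∀ k, ‖g k‖ ≤ bound k := fun k =>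
    le_of_tendsto (hfg k).norm (hfb.mono (fun N hN => hN k))
  have hgs : Summable g := Summable.of_norm_bounded hbs hgb
  have hD := tendsto_tsum_of_dominated_convergence hbs hfg hfb
  have hsum : ∀ N, ∑' k, f N k = (N.factorial : ℂ) * ((N:ℂ)+1)^(-a) *
     ((∏ j ∈ range (N+1), (x + y + a + j)) / (∏ j ∈ range (N+1), ((x + j) * (y + j))))
     - (N.factorial : ℂ) * ((N:ℂ)+1)^(-a) * (1 / (∏ j ∈ range (N+1), (lam + j))) := by
    intro N
    rw [tsum_eq_sum (s := range (N+1)) (by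
      intro k hk
      simp only [hf]
      rw [if_neg]
      simp at hk; omega)]
    rw [pf x y lam a N Y hY hx hy hl hYj, mul_add, add_sub_cancel_left, mul_sum]
    apply sum_congr rfl
    intro k hk
    have hkN : k ≤ N := by simp at hk; omega
    obtain ⟨d, rfl⟩ := Nat.exists_eq_add_of_le hkN
    simp only [hf, if_pos hkN, hT]
    rw [prod_erase, Nat.add_sub_cancel_left]
    ring
  have hlim := ((lhs_lim x y a hx hy hs).sub (const_lim lam a hre)).congr (fun N => (hsum N).symm)
  rw [sub_zero] at hlim
  have hval := tendsto_nhds_unique hD hlim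
  have hts := (hgs.hasSum.tendsto_sum_nat).const_mul ((-1:ℂ)^a)
  rw [hval] at hts
  refine hts.congr ?_
  intro N
  have hone : (-1:ℂ)^a * (-1)^a = 1 := by rw [← mul_zpow]; simp
  rw [mul_sum]
  apply sum_congr rfl
  intro k _
  simp only [hg]
  linear_combination ((1 / (k.factorial : ℂ)) * gpoch (1 - Y k) ((k:ℤ) - a) * w k) * hone

lemma gamma_half (m : ℕ) : Gamma ((m:ℂ) + 1/2) * 2^m
    = (∏ j ∈ range m, (2 * (j:ℂ) + 1)) * Gamma (1/2) := by
  induction m with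
  | zero => simp
  | succ m ih =>
    have hne : (m:ℂ) + 1/2 ≠ 0 := by
      intro h
      have := congrArg Complex.re h
      simp at this
      have h2 : (0:ℝ) ≤ m := by positivity
      linarith
    rw [prod_range_succ, show ((m+1:ℕ):ℂ) + 1/2 = ((m:ℂ) + 1/2) + 1 by push_cast; ring,
      Complex.Gamma_add_one _ hne]
    linear_combination (2 * (m:ℂ) + 1) * ih

/-- The family of formulas for π from Section 3. The double factorial
`(2m-1)!!` is written as `∏_{j<m} (2j+1)`. -/
theorem pi_family (m n : ℕ) (a : ℤ) (hmna : 0 ≤ (m : ℤ) + n + a)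
    (lam : ℂ) (hre : -(a : ℝ) < lam.re)
    (hlam : ∀ j : ℕ, lam ≠ -(j : ℂ))
    (heps : ∀ k : ℕ, ∀ j : ℕ,
      lam - (lam - 1/2 - m) * (lam - 1/2 - n) / (lam + k) ≠ -(j : ℂ)) :
    ∃ S : ℂ,
      Tendsto (fun N : ℕ => ∑ k ∈ Finset.range N,
          (1 / (k.factorial : ℂ))
          * gpoch (1 - lam + (lam - 1/2 - m) * (lam - 1/2 - n) / (lam + k))
              ((k : ℤ) - a)
          * (2 / (2 * m + 2 * k + 1) + 2 / (2 * n + 2 * k + 1)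
              - 1 / (lam + k)))
        atTop (𝓝 S)
      ∧ (Real.pi : ℂ)
          = ((-1 : ℂ) ^ a * ((((m : ℤ) + n + a).toNat.factorial : ℂ))
              * 2 ^ (m + n)
              / ((∏ j ∈ Finset.range m, (2 * (j : ℂ) + 1))
                  * ∏ j ∈ Finset.range n, (2 * (j : ℂ) + 1)))
            * S := by
  have hhalf : ∀ m j : ℕ, (m:ℂ) + 1/2 + j ≠ 0 := by
    intro m j h
    have := congrArg Complex.re h
    simp at this
    have h2 : (0:ℝ) ≤ m := by positivity
    have h3 : (0:ℝ) ≤ j := by positivity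
    linarith
  obtain ⟨M, hM⟩ := Int.eq_ofNat_of_zero_le hmna
  have hMc : (m:ℂ) + n + a = M := by exact_mod_cast hM
  have hsum : (m:ℂ) + 1/2 + ((n:ℂ) + 1/2) + a = M + 1 := by linear_combination hMc
  have hG := general ((m:ℂ) + 1/2) ((n:ℂ) + 1/2) lam a hre
    (fun k => lam - (lam - ((m:ℂ) + 1/2)) * (lam - ((n:ℂ) + 1/2)) / (lam + k)) (fun k => rfl)
    (hhalf m) (hhalf n) (fun j h => hlam j (eq_neg_of_add_eq_zero_left h))
    (by
      intro j
      rw [hsum]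
      exact_mod_cast (by omega : M + 1 + j ≠ 0))
    (by
      intro k j h
      apply heps k j
      rw [← eq_neg_of_add_eq_zero_left h]
      ring)
  refine ⟨_, hG.congr ?_, ?_⟩
  · intro N
    apply sum_congr rfl
    intro k _
    have e1 : ∀ m : ℕ, 1 / ((m:ℂ) + 1/2 + k) = 2 / (2 * m + 2 * k + 1) := by
      intro m
      have h1 := hhalf m k
      have h2 : (2 * (m:ℂ) + 2 * k + 1) ≠ 0 := by
        intro h; apply h1; linear_combination h / 2
      rw [div_eq_div_iff h1 h2]; ring
    rw [e1, e1]
    congr 3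
    ring
  · rw [hsum, Complex.Gamma_nat_eq_factorial, hM, Int.toNat_natCast]
    have g1 := gamma_half m
    have g2 := gamma_half n
    have g3 : Gamma (1/2 : ℂ) * Gamma (1/2) = Real.pi := by
      rw [Complex.Gamma_one_half_eq, ← cpow_add _ _ (by exact_mod_cast Real.pi_ne_zero)]
      norm_num
    have hone : (-1:ℂ)^a * (-1)^a = 1 := by rw [← mul_zpow]; simp
    have hp : ∀ m : ℕ, ∏ j ∈ range m, (2 * (j:ℂ) + 1) ≠ 0 := by
      intro m
      apply prod_ne_zero_iff.2
      intro j _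
      exact_mod_cast (by omega : 2 * j + 1 ≠ 0)
    have h1 := hp m
    have h2 := hp n
    have h3 : (M.factorial : ℂ) ≠ 0 := by exact_mod_cast M.factorial_ne_zero
    set P := ∏ j ∈ range m, (2 * (j:ℂ) + 1)
    set R := ∏ j ∈ range n, (2 * (j:ℂ) + 1)
    have e : (-1:ℂ)^a * (M.factorial:ℂ) * 2^(m+n) / (P * R) *
        ((-1)^a * (Gamma ((m:ℂ)+1/2) * Gamma ((n:ℂ)+1/2) / (M.factorial:ℂ)))
        = ((-1)^a * (-1)^a) * ((Gamma ((m:ℂ)+1/2) * 2^m) * (Gamma ((n:ℂ)+1/2) * 2^n)) / (P * R) := by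
      rw [pow_add]
      generalize (-1:ℂ)^a = ε
      field_simp
    rw [e, g1, g2, hone, ← g3]
    field_simp
end

section
/- Let n ≥ 0 be an integer and let s, t, u, λ, x₁, x₂ ∈ ℂ. For each k ∈ {0,…,n} write ε_k = (λ−x₁)(λ−x₂)/(λ+k), and let c_k^+, c_k^− ∈ ℂ be any numbers satisfying c_k^+ + c_k^− = s + k and c_k^+ c_k^− = x₁x₂ + (s + k − x₁ − x₂)λ. Assume all the following denominators are nonzero: x₁+k, x₂+k, λ+k, s+k−x₁−x₂ for k ∈ {0,…,n}; (λ − ε_k + j), (s − λ + ε_k + k + j), (c_k^+ + j), (c_k^− + j) for k ∈ {0,…,n} and j ∈ {0,…,n}. Then (t−x₁)_n (t−x₂)_n (u+x₁+x₂)_n / ( (x₁)_{n+1} (x₂)_{n+1} (s−x₁−x₂)_{n+1} ) = ∑_{k=0}^{n} [ (−1)^k / (k!(n−k)!) ] · [ (t+k)_n (t − λ + ε_k)_n (u + λ − ε_k − k)_n / ( (λ − ε_k)_{n+1} (s − λ + ε_k + k)_{n+1} ) ] · ( 1/(x₁+k) + 1/(x₂+k) − 1/(λ+k) ) + ∑_{k=0}^{n}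 [ (−1)^k / (k!(n−k)!) ] · [ (t − c_k^+)_n (t − c_k^−)_n (u + s + k)_n / ( (c_k^+)_{n+1} (c_k^−)_{n+1} ) ] · 1/(s + k − x₁ − x₂). -/
open Finset

/-- The Pochhammer symbol `(z)_k = z(z+1)⋯(z+k-1)`, with `(z)_0 = 1`. -/
noncomputable def poch (z : ℂ) (k : ℕ) : ℂ := ∏ j ∈ Finset.range k, (z + j)

/-- Partial fractions for a product of linear factors `a i + b i * σ`. -/
lemma pf_general {ι : Type*} [DecidableEq ι] (S : Finset ι) (a b r : ι → ℂ) (σ : ℂ)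
    (N : Polynomial ℂ) (hN : N.degree < S.card)
    (hr : ∀ i ∈ S, a i + b i * r i = 0)
    (hne : ∀ i ∈ S, ∀ j ∈ S, j ≠ i → a j + b j * r i ≠ 0)
    (hσ : ∀ i ∈ S, a i + b i * σ ≠ 0) :
    N.eval σ / ∏ i ∈ S, (a i + b i * σ)
      = ∑ i ∈ S, N.eval (r i) / (∏ j ∈ S, if j = i then 1 else (a j + b j * r i))
          / (a i + b i * σ) := by
  have hinj : Set.InjOn r (S : Set ι) := by
    intro i hi j hj hij
    by_contra h
    apply hne i hi j hj (Ne.symm h)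
    rw [hij]; exact hr j hj
  have hb : ∀ i ∈ S, b i ≠ 0 := by
    intro i hi h
    have h1 := hr i hi
    have h2 := hσ i hi
    simp only [h, zero_mul] at h1 h2
    exact h2 h1
  have key := Lagrange.eq_interpolate_of_eval_eq (fun i => N.eval (r i)) hinj hN
    (fun i _ => rfl)
  have key2 := congrArg (Polynomial.eval σ) key
  rw [Lagrange.interpolate_apply, Polynomial.eval_finsetSum] at key2
  rw [key2, Finset.sum_div]
  refine Finset.sum_congr rfl fun i hi => ?_
  rw [Polynomial.eval_mul, Polynomial.eval_C, Lagrange.basis, Polynomial.eval_prod]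
  have e1 : (∏ j ∈ S, if j = i then (1:ℂ) else (a j + b j * r i))
      = ∏ j ∈ S.erase i, (a j + b j * r i) := by
    rw [← Finset.mul_prod_erase S _ hi, if_pos rfl, one_mul]
    exact Finset.prod_congr rfl fun j hj => if_neg (Finset.ne_of_mem_erase hj)
  have e2 : ∏ j ∈ S.erase i, Polynomial.eval σ (Lagrange.basisDivisor (r i) (r j))
      = (∏ j ∈ S.erase i, (a j + b j * σ)) / ∏ j ∈ S.erase i, (a j + b j * r i) := by
    rw [← Finset.prod_div_distrib]
    refine Finset.prod_congr rfl fun j hj => ?_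
    have hj' := Finset.mem_of_mem_erase hj
    have hji := Finset.ne_of_mem_erase hj
    have h0 := hr j hj'
    have h1 := hne i hi j hj' hji
    have h2 : r i - r j ≠ 0 := by
      intro h
      exact hji (hinj hj' hi (sub_eq_zero.mp h).symm)
    simp only [Lagrange.basisDivisor, Polynomial.eval_mul, Polynomial.eval_C,
      Polynomial.eval_sub, Polynomial.eval_X]
    rw [inv_mul_eq_div, div_eq_div_iff h2 h1]
    linear_combination (σ - r i) * h0
  rw [e1, e2, ← Finset.mul_prod_erase S _ hi]
  have n1 : ∏ j ∈ S.erase i, (a j + b j * σ) ≠ 0 :=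
    Finset.prod_ne_zero_iff.mpr fun j hj => hσ j (Finset.mem_of_mem_erase hj)
  have n2 : ∏ j ∈ S.erase i, (a j + b j * r i) ≠ 0 :=
    Finset.prod_ne_zero_iff.mpr fun j hj =>
      hne i hi j (Finset.mem_of_mem_erase hj) (Finset.ne_of_mem_erase hj)
  have n3 := hσ i hi
  generalize (∏ j ∈ S.erase i, (a j + b j * σ)) = A at *
  generalize (∏ j ∈ S.erase i, (a j + b j * r i)) = B at *
  generalize a i + b i * σ = D at *
  field_simp

lemma prod_diff_fact (m k : ℕ) :
    (∏ j ∈ Finset.range (k + m + 1), if j = k then (1:ℂ) else ((j:ℂ) - k))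
      = (-1) ^ k * (k.factorial * m.factorial) := by
  induction m with
  | zero =>
    rw [add_zero, Finset.prod_range_succ, if_pos rfl, mul_one, ← Finset.prod_range_reflect]
    have : ∀ j ∈ Finset.range k, (if k - 1 - j = k then (1:ℂ) else (((k - 1 - j : ℕ):ℂ) - k))
        = (-1) * ((j + 1 : ℕ) : ℂ) := by
      intro j hj
      have hj := Finset.mem_range.mp hj
      rw [if_neg (by omega)]
      have : k - 1 - j = k - (j + 1) := by omega
      rw [this, Nat.cast_sub (by omega)]
      ring
    rw [Finset.prod_congr rfl this, Finset.prod_mul_distrib, ← Nat.cast_prod,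
      Finset.prod_range_add_one_eq_factorial]
    simp
  | succ m ih =>
    rw [← add_assoc, Finset.prod_range_succ, ih, if_neg (by omega), Nat.factorial_succ]
    push_cast
    ring

lemma prod_diff_fact' (n k : ℕ) (h : k ≤ n) :
    (∏ j ∈ Finset.range (n + 1), if j = k then (1:ℂ) else ((j:ℂ) - k))
      = (-1) ^ k * (k.factorial * (n - k).factorial) := by
  obtain ⟨m, rfl⟩ := Nat.exists_eq_add_of_le h
  rw [prod_diff_fact, Nat.add_sub_cancel_left]

/-- The numerator polynomial. -/
noncomputable def numPoly (n : ℕ) (c t u lam : ℂ) : Polynomial ℂ :=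
  ∏ j ∈ Finset.range n,
    ((Polynomial.C (lam - (t + j)) * Polynomial.X + Polynomial.C ((t + j) ^ 2 + c)) *
      (Polynomial.C 1 * Polynomial.X + Polynomial.C (u + j)))

lemma numPoly_degree (n : ℕ) (c t u lam : ℂ) :
    (numPoly n c t u lam).degree < ((2 * n + 2 : ℕ) : WithBot ℕ) := by
  have h : (numPoly n c t u lam).natDegree ≤ n * 2 := by
    refine (Polynomial.natDegree_prod_le _ _).trans ?_
    refine (Finset.sum_le_card_nsmul _ _ 2 fun j _ => ?_).trans (by simp)
    exact Polynomial.natDegree_mul_le.trans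
      (add_le_add Polynomial.natDegree_linear_le Polynomial.natDegree_linear_le)
  refine Polynomial.degree_le_natDegree.trans_lt ?_
  exact_mod_cast (by omega : (numPoly n c t u lam).natDegree < 2 * n + 2)

lemma numPoly_eval (n : ℕ) (c t u lam y z σ : ℂ) (hσ : σ = y + z)
    (h : y * z = c + lam * σ) :
    (numPoly n c t u lam).eval σ = poch (t - y) n * poch (t - z) n * poch (u + σ) n := by
  simp only [numPoly, poch, Polynomial.eval_prod, ← Finset.prod_mul_distrib]
  refine Finset.prod_congr rfl fun j _ => ?_
  simp only [Polynomial.eval_mul, Polynomial.eval_add, Polynomial.eval_C, Polynomial.eval_X]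
  subst hσ
  linear_combination (-(y + z + u + j)) * h

/-- Equation (4.2): finite asymmetric partial fraction expansion related to
closed string amplitudes. -/
theorem closed_finite_asymmetric (n : ℕ) (s t u lam x₁ x₂ : ℂ)
    (cp cm : ℕ → ℂ)
    (hc : ∀ k : ℕ, k ≤ n → cp k + cm k = s + k
      ∧ cp k * cm k = x₁ * x₂ + (s + k - x₁ - x₂) * lam)
    (hx₁ : ∀ k : ℕ, k ≤ n → x₁ + k ≠ 0)
    (hx₂ : ∀ k : ℕ, k ≤ n → x₂ + k ≠ 0)
    (hlam : ∀ k : ℕ, k ≤ n → lam + k ≠ 0)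
    (hs : ∀ k : ℕ, k ≤ n → s + k - x₁ - x₂ ≠ 0)
    (hden₁ : ∀ k : ℕ, k ≤ n → ∀ j : ℕ, j ≤ n →
      lam - (lam - x₁) * (lam - x₂) / (lam + k) + j ≠ 0)
    (hden₂ : ∀ k : ℕ, k ≤ n → ∀ j : ℕ, j ≤ n →
      s - lam + (lam - x₁) * (lam - x₂) / (lam + k) + k + j ≠ 0)
    (hden₃ : ∀ k : ℕ, k ≤ n → ∀ j : ℕ, j ≤ n → cp k + j ≠ 0)
    (hden₄ : ∀ k : ℕ, k ≤ n → ∀ j : ℕ, j ≤ n → cm k + j ≠ 0) :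
    poch (t - x₁) n * poch (t - x₂) n * poch (u + x₁ + x₂) n
        / (poch x₁ (n + 1) * poch x₂ (n + 1) * poch (s - x₁ - x₂) (n + 1))
      = (∑ k ∈ Finset.range (n + 1),
          ((-1 : ℂ) ^ k / ((k.factorial : ℂ) * ((n - k).factorial : ℂ)))
          * (poch (t + k) n
              * poch (t - lam + (lam - x₁) * (lam - x₂) / (lam + k)) n
              * poch (u + lam - (lam - x₁) * (lam - x₂) / (lam + k) - k) n
            / (poch (lam - (lam - x₁) * (lam - x₂) / (lam + k)) (n + 1)
              * poch (s - lam + (lam - x₁) * (lam - x₂) / (lam + k) + k)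
                  (n + 1)))
          * (1 / (x₁ + k) + 1 / (x₂ + k) - 1 / (lam + k)))
        + ∑ k ∈ Finset.range (n + 1),
          ((-1 : ℂ) ^ k / ((k.factorial : ℂ) * ((n - k).factorial : ℂ)))
          * (poch (t - cp k) n * poch (t - cm k) n * poch (u + s + k) n
            / (poch (cp k) (n + 1) * poch (cm k) (n + 1)))
          * (1 / (s + k - x₁ - x₂)) := by
  classical
  set c : ℂ := x₁ * x₂ - lam * (x₁ + x₂) with hcdef
  set e : ℕ → ℂ := fun k => (lam - x₁) * (lam - x₂) / (lam + k) with he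
  have hek : ∀ k ≤ n, e k * (lam + k) = (lam - x₁) * (lam - x₂) := fun k hk =>
    div_mul_cancel₀ _ (hlam k hk)
  let S : Finset (ℕ ⊕ ℕ) := (range (n + 1)).disjSum (range (n + 1))
  let a : ℕ ⊕ ℕ → ℂ := Sum.elim (fun j => c + (j:ℂ) ^ 2) (fun j => s + j)
  let b : ℕ ⊕ ℕ → ℂ := Sum.elim (fun j => lam + j) (fun _ => -1)
  let r : ℕ ⊕ ℕ → ℂ := Sum.elim (fun k => lam - e k - k) (fun k => s + k)
  have hcard : S.card = 2 * n + 2 := by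
    simp only [S, Finset.card_disjSum, Finset.card_range]; ring
  have D1 : ∀ (j : ℕ) (σ y z : ℂ), σ = y + z → y * z = c + lam * σ →
      a (Sum.inl j) + b (Sum.inl j) * σ = (y + j) * (z + j) := by
    intro j σ y z h1 h2
    simp only [a, b, Sum.elim_inl]
    subst h1
    linear_combination -h2
  have D2 : ∀ (j : ℕ) (σ : ℂ), a (Sum.inr j) + b (Sum.inr j) * σ = s + j - σ := by
    intro j σ
    simp only [a, b, Sum.elim_inr]
    ring
  have P0 : x₁ * x₂ = c + lam * (x₁ + x₂) := by rw [hcdef]; ring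
  have P1 : ∀ k ≤ n, (-(k:ℂ)) * (lam - e k) = c + lam * (lam - e k - k) := by
    intro k hk
    rw [hcdef]
    linear_combination hek k hk
  have P1s : ∀ k : ℕ, lam - e k - k = -(k:ℂ) + (lam - e k) := fun k => by ring
  have P2 : ∀ k ≤ n, cp k * cm k = c + lam * (s + k) := by
    intro k hk
    rw [(hc k hk).2, hcdef]; ring
  have P2s : ∀ k ≤ n, s + k = cp k + cm k := fun k hk => (hc k hk).1.symm
  have V11 : ∀ k ≤ n, ∀ j : ℕ, a (Sum.inl j) + b (Sum.inl j) * r (Sum.inl k)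
      = ((j:ℂ) - k) * (lam - e k + j) := by
    intro k hk j
    rw [D1 j (r (Sum.inl k)) _ _ (P1s k) (P1 k hk)]; ring
  have V12 : ∀ k j : ℕ, a (Sum.inr j) + b (Sum.inr j) * r (Sum.inl k)
      = s - lam + e k + k + j := by
    intro k j
    rw [D2]; simp only [r, Sum.elim_inl]; ring
  have V21 : ∀ k ≤ n, ∀ j : ℕ, a (Sum.inl j) + b (Sum.inl j) * r (Sum.inr k)
      = (cp k + j) * (cm k + j) := by
    intro k hk j
    exact D1 j _ _ _ (P2s k hk) (P2 k hk)
  have V22 : ∀ k j : ℕ, a (Sum.inr j) + b (Sum.inr j) * r (Sum.inr k) = (j:ℂ) - k := by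
    intro k j
    rw [D2]; simp only [r, Sum.elim_inr]; ring
  have hsubne : ∀ j k : ℕ, j ≠ k → (j:ℂ) - k ≠ 0 := fun j k h =>
    sub_ne_zero.mpr (Nat.cast_injective.ne h)
  have hmem : ∀ k, k ∈ range (n + 1) → k ≤ n := fun k h =>
    Nat.lt_succ_iff.mp (Finset.mem_range.mp h)
  have main := pf_general S a b r (x₁ + x₂) (numPoly n c t u lam)
    (by rw [hcard]; exact numPoly_degree n c t u lam)
    (by
      rintro (k | k) hk
      · have hk := hmem k (Finset.inl_mem_disjSum.mp hk)
        rw [V11 k hk]; ring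
      · rw [V22]; ring)
    (by
      rintro (k | k) hk (j | j) hj hjk
      · have hk := hmem k (Finset.inl_mem_disjSum.mp hk)
        have hj := hmem j (Finset.inl_mem_disjSum.mp hj)
        rw [V11 k hk]
        exact mul_ne_zero (hsubne j k fun h => hjk (by rw [h])) (hden₁ k hk j hj)
      · have hk := hmem k (Finset.inl_mem_disjSum.mp hk)
        have hj := hmem j (Finset.inr_mem_disjSum.mp hj)
        rw [V12]
        exact hden₂ k hk j hj
      · have hk := hmem k (Finset.inr_mem_disjSum.mp hk)
        have hj := hmem j (Finset.inl_mem_disjSum.mp hj)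
        rw [V21 k hk]
        exact mul_ne_zero (hden₃ k hk j hj) (hden₄ k hk j hj)
      · rw [V22]
        exact hsubne j k fun h => hjk (by rw [h]))
    (by
      rintro (k | k) hk
      · have hk := hmem k (Finset.inl_mem_disjSum.mp hk)
        rw [D1 k _ _ _ rfl P0]
        exact mul_ne_zero (hx₁ k hk) (hx₂ k hk)
      · have hk := hmem k (Finset.inr_mem_disjSum.mp hk)
        rw [D2, ← sub_sub]
        exact hs k hk)
  have hL : ∏ i ∈ S, (a i + b i * (x₁ + x₂))
      = poch x₁ (n + 1) * poch x₂ (n + 1) * poch (s - x₁ - x₂) (n + 1) := by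
    simp only [S, Finset.prod_disjSum, poch, ← Finset.prod_mul_distrib]
    refine Finset.prod_congr rfl fun j _ => ?_
    rw [D1 j _ _ _ rfl P0, D2]; ring
  rw [hL, numPoly_eval n c t u lam x₁ x₂ _ rfl P0, ← add_assoc] at main
  rw [main]
  simp only [S]
  rw [Finset.sum_disjSum]
  congr 1
  · refine Finset.sum_congr rfl fun k hk' => ?_
    have hk := hmem k hk'
    have hprod : (∏ j ∈ (range (n + 1)).disjSum (range (n + 1)),
        if j = Sum.inl k then (1:ℂ) else (a j + b j * r (Sum.inl k))) * (lam - e k + k)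
        = (-1) ^ k * (k.factorial * (n - k).factorial) *
          (poch (lam - e k) (n + 1) * poch (s - lam + e k + k) (n + 1)) := by
      rw [Finset.prod_disjSum]
      have q2 : (∏ j ∈ range (n + 1), if (Sum.inr j : ℕ ⊕ ℕ) = Sum.inl k then (1:ℂ)
          else (a (Sum.inr j) + b (Sum.inr j) * r (Sum.inl k)))
          = poch (s - lam + e k + k) (n + 1) := by
        refine Finset.prod_congr rfl fun j _ => ?_
        rw [if_neg (by simp), V12]
      have q1 : (∏ j ∈ range (n + 1), if (Sum.inl j : ℕ ⊕ ℕ) = Sum.inl k then (1:ℂ)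
          else (a (Sum.inl j) + b (Sum.inl j) * r (Sum.inl k))) * (lam - e k + k)
          = (-1) ^ k * (k.factorial * (n - k).factorial) * poch (lam - e k) (n + 1) := by
        rw [← prod_diff_fact' n k hk, poch, ← Finset.prod_mul_distrib,
          ← Finset.mul_prod_erase _ _ hk', ← Finset.mul_prod_erase _ _ hk']
        simp only [if_true, one_mul]
        rw [mul_comm]
        congr 1
        refine Finset.prod_congr rfl fun j hj => ?_
        have hj := Finset.ne_of_mem_erase hj
        rw [if_neg (by simpa using hj), if_neg hj, V11 k hk]
      rw [q2, mul_right_comm, q1]; ring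
    have hd : lam - e k + k ≠ 0 := hden₁ k hk k hk
    have hee : (lam - x₁) * (lam - x₂) / (lam + k) = e k := rfl
    rw [hee]
    have hprod' := eq_div_of_mul_eq hd hprod
    rw [hprod', D1 k _ _ _ rfl P0,
      numPoly_eval n c t u lam (-(k:ℂ)) (lam - e k) (r (Sum.inl k)) (P1s k) (P1 k hk)]
    have r1 : t - -(k:ℂ) = t + k := by ring
    have r2 : t - (lam - e k) = t - lam + e k := by ring
    have r3 : u + r (Sum.inl k) = u + lam - e k - k := by
      simp only [r, Sum.elim_inl]; ring
    rw [r1, r2, r3]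
    have hw : 1 / (x₁ + k) + 1 / (x₂ + k) - 1 / (lam + k)
        = (lam - e k + k) / ((x₁ + k) * (x₂ + k)) := by
      have h1 := hx₁ k hk
      have h2 := hx₂ k hk
      have h3 := hlam k hk
      have h4 := hek k hk
      rw [div_add_div _ _ h1 h2, div_sub_div _ _ (mul_ne_zero h1 h2) h3,
        div_eq_div_iff (mul_ne_zero (mul_ne_zero h1 h2) h3) (mul_ne_zero h1 h2)]
      linear_combination ((x₁ + k) * (x₂ + k)) * h4
    rw [hw]
    have hsq : ((-1:ℂ) ^ k) * (-1) ^ k = 1 := by rw [← mul_pow]; simp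
    have hinv : ((-1:ℂ) ^ k)⁻¹ = (-1) ^ k := inv_eq_of_mul_eq_one_left hsq
    simp only [div_eq_mul_inv, mul_inv, inv_inv, hinv]
    ring
  · refine Finset.sum_congr rfl fun k hk' => ?_
    have hk := hmem k hk'
    have hprod : (∏ j ∈ (range (n + 1)).disjSum (range (n + 1)),
        if j = Sum.inr k then (1:ℂ) else (a j + b j * r (Sum.inr k)))
        = (poch (cp k) (n + 1) * poch (cm k) (n + 1)) *
          ((-1) ^ k * (k.factorial * (n - k).factorial)) := by
      rw [Finset.prod_disjSum]
      congr 1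
      · rw [poch, poch, ← Finset.prod_mul_distrib]
        refine Finset.prod_congr rfl fun j _ => ?_
        rw [if_neg (by simp), V21 k hk]
      · rw [← prod_diff_fact' n k hk]
        refine Finset.prod_congr rfl fun j _ => ?_
        rw [V22]
        simp
    rw [hprod, D2, numPoly_eval n c t u lam (cp k) (cm k) (r (Sum.inr k)) (P2s k hk) (P2 k hk)]
    have r3 : u + r (Sum.inr k) = u + s + k := by
      simp only [r, Sum.elim_inr]; ring
    rw [r3, ← sub_sub]
    have hsq : ((-1:ℂ) ^ k) * (-1) ^ k = 1 := by rw [← mul_pow]; simp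
    have hinv : ((-1:ℂ) ^ k)⁻¹ = (-1) ^ k := inv_eq_of_mul_eq_one_left hsq
    simp only [div_eq_mul_inv, mul_inv, hinv]
    ring
end
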